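/- Logarithmic bound on field gradients under a momentum support bound: Let τ > 0, let f ∈ C¹([0,τ)×ℝ³×ℝ³) and (E,B) ∈ C¹([0,τ)×ℝ³; ℝ³×ℝ³) be a solution of the relativistic Vlasov–Maxwell system with initial data f(0,·,·) = f^in, where f^in ∈ C¹(ℝ³×ℝ³) is nonnegative with compact support, and (E,B)(0,·) = (E^in, B^in) with E^in, B^in ∈ C²(ℝ³;ℝ³) compactly supported and satisfying div_x E^in = ∫_{ℝ³} f^in dξ and div_x B^in = 0. Assume sup_{t∈[0,τ)} R_f(t) < +∞. Then there exists a constant C > 0 such that for all t ∈ [0,τ), ‖E(t)‖_{W^{1,∞}_x} + ‖B(t)‖_{W^{1,∞}_x} ≤ C ( 1 + ln₊ sup_{0≤s≤t} ‖∇_x f(s)‖_{L^∞_{x,ξ}} ), where ln₊ z = max(ln z, 0). -/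

import Mathlib

open MeasureTheory Real Set Filter Metric RealInnerProductSpace
open scoped ENNReal NNReal Topology

noncomputable section

/-- Physical space `ℝ³` with its Euclidean structure. -/
abbrev E3 : Type := EuclideanSpace ℝ (Fin 3)

/-- The `i`-th standard basis vector of `ℝ³`. -/
def e3 (i : Fin 3) : E3 := EuclideanSpace.single i 1

/-- The relativistic velocity `v(ξ) = ξ/√(1+|ξ|²)`. -/
def vrel (ξ : E3) : E3 := (Real.sqrt (1 + ‖ξ‖ ^ 2))⁻¹ • ξ

/-- Cross product on `ℝ³`. -/
def cross3 (a b : E3) : E3 :=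
  (WithLp.equiv 2 (Fin 3 → ℝ)).symm
    ![a 1 * b 2 - a 2 * b 1, a 2 * b 0 - a 0 * b 2, a 0 * b 1 - a 1 * b 0]

/-- Partial derivative in the `i`-th coordinate direction. -/
def pd3 (u : E3 → ℝ) (i : Fin 3) (x : E3) : ℝ := fderiv ℝ u x (e3 i)

/-- Divergence of a vector field on `ℝ³`. -/
def divg (F : E3 → E3) (x : E3) : ℝ := ∑ i : Fin 3, pd3 (fun y => F y i) i x

/-- Curl of a vector field on `ℝ³`. -/
def curl3 (F : E3 → E3) (x : E3) : E3 :=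
  (WithLp.equiv 2 (Fin 3 → ℝ)).symm
    ![pd3 (fun y => F y 2) 1 x - pd3 (fun y => F y 1) 2 x,
      pd3 (fun y => F y 0) 2 x - pd3 (fun y => F y 2) 0 x,
      pd3 (fun y => F y 1) 0 x - pd3 (fun y => F y 0) 1 x]

/-- `W^{1,∞}_{x,ξ}` norm (as an extended real) of `f(t,·,·)`. -/
def WfNorm (f : ℝ → E3 → E3 → ℝ) (t : ℝ) : ℝ≥0∞ :=
  ⨆ p : E3 × E3,
    ((‖f t p.1 p.2‖₊ : ℝ≥0∞) + (‖fderiv ℝ (fun q : E3 × E3 => f t q.1 q.2) p‖₊ : ℝ≥0∞))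

/-- `W^{1,∞}_x` norm (as an extended real) of a field `F(t,·)`. -/
def WFieldNorm (F : ℝ → E3 → E3) (t : ℝ) : ℝ≥0∞ :=
  ⨆ x : E3, ((‖F t x‖₊ : ℝ≥0∞) + (‖fderiv ℝ (F t) x‖₊ : ℝ≥0∞))

/-- The momentum support radius
`R_f(t) = inf { r > 0 | f(t,x,ξ) = 0 for all x and all |ξ| > r }` (with value `∞` if no
such radius exists). -/
def Rsupp (f : ℝ → E3 → E3 → ℝ) (t : ℝ) : ℝ≥0∞ :=
  sInf {r : ℝ≥0∞ | 0 < r ∧ ∀ x ξ : E3, r < (‖ξ‖₊ : ℝ≥0∞) → f t x ξ = 0}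
/-- `ln₊ z = max (ln z) 0`. -/
def lnpos (z : ℝ) : ℝ := max (Real.log z) 0

noncomputable section

abbrev X6 : Type := E3 × E3
abbrev Y3 : Type := ℝ × E3 × E3

def phi (δ : ℝ) (z : E3) : ℝ := Real.sqrt (δ ^ 2 + ‖z‖ ^ 2)
def om (δ : ℝ) (z : E3) : E3 := (phi δ z)⁻¹ • z
def Gam (δ t : ℝ) (x : E3) (p : X6) : Y3 := (t - phi δ p.1, x + p.1, p.2)
def kerK (δ : ℝ) (q : ℝ → ℝ) (A : X6 → ℝ) (p : X6) : ℝ := q (phi δ p.1) * A (om δ p.1, p.2)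
def OmU : Set X6 := {p | 0 < 1 + ⟪vrel p.2, p.1⟫}
def SU (A : X6 → ℝ) : Prop := ContDiffOn ℝ (⊤ : ℕ∞) A OmU
def Om (τ : ℝ) : Set Y3 := Ioo 0 τ ×ˢ (univ : Set X6)
def XS (r : ℝ) (g : Y3 → ℝ) : Prop := ∀ p : Y3, r < ‖p.2.2‖ → g p = 0

lemma phi_pos {δ : ℝ} (hδ : 0 < δ) (z : E3) : 0 < phi δ z := Real.sqrt_pos.2 (by positivity)

lemma phi_sq {δ : ℝ} (z : E3) : phi δ z ^ 2 = δ ^ 2 + ‖z‖ ^ 2 := Real.sq_sqrt (by positivity)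

lemma norm_le_phi {δ : ℝ} (z : E3) : ‖z‖ ≤ phi δ z := by
  apply Real.le_sqrt_of_sq_le; nlinarith [sq_nonneg δ]

lemma norm_lt_phi {δ : ℝ} (hδ : 0 < δ) (z : E3) : ‖z‖ < phi δ z := by
  apply Real.lt_sqrt_of_sq_lt; nlinarith [sq_pos_of_pos hδ]

lemma le_phi {δ : ℝ} (z : E3) : δ ≤ phi δ z := by
  apply Real.le_sqrt_of_sq_le; nlinarith [sq_nonneg ‖z‖]

lemma norm_om_lt {δ : ℝ} (hδ : 0 < δ) (z : E3) : ‖om δ z‖ < 1 := by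
  have h := phi_pos hδ z
  rw [om, norm_smul, norm_inv, Real.norm_of_nonneg h.le, inv_mul_lt_iff₀ h]
  simpa using norm_lt_phi hδ z

lemma norm_om_sq {δ : ℝ} (hδ : 0 < δ) (z : E3) : ‖om δ z‖ ^ 2 = 1 - δ ^ 2 / phi δ z ^ 2 := by
  have h := phi_pos hδ z
  rw [om, norm_smul, norm_inv, Real.norm_of_nonneg h.le]
  field_simp
  rw [phi_sq]; ring

lemma contDiff_phi {δ : ℝ} (hδ : 0 < δ) {n : WithTop ℕ∞} : ContDiff ℝ n (phi δ) := by
  unfold phi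
  apply ContDiff.sqrt
  · exact contDiff_const.add (contDiff_norm_sq ℝ)
  · intro z; positivity

lemma contDiff_om {δ : ℝ} (hδ : 0 < δ) {n : WithTop ℕ∞} : ContDiff ℝ n (om δ) := by
  unfold om
  exact ((contDiff_phi hδ).inv (fun z => (phi_pos hδ z).ne')).smul contDiff_id

lemma hasFDerivAt_phi {δ : ℝ} (hδ : 0 < δ) (z : E3) : HasFDerivAt (phi δ) (innerSL ℝ (om δ z)) z := by
  have h1 : HasFDerivAt (fun z : E3 => δ ^ 2 + ‖z‖ ^ 2) (2 • innerSL ℝ z) z := by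
    simpa using ((hasStrictFDerivAt_norm_sq z).hasFDerivAt).const_add (δ ^ 2)
  have h2 := h1.sqrt (by positivity)
  refine h2.congr_fderiv ?_
  ext e
  simp [om, phi, inner_smul_left]
  field_simp

lemma fderiv_phi {δ : ℝ} (hδ : 0 < δ) (z e : E3) : fderiv ℝ (phi δ) z e = ⟪om δ z, e⟫ := by
  rw [(hasFDerivAt_phi hδ z).fderiv]; simp

lemma fderiv_om {δ : ℝ} (hδ : 0 < δ) (z e : E3) : fderiv ℝ (om δ) z e = (phi δ z)⁻¹ • (e - ⟪om δ z, e⟫ • om δ z) := by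
  have h := phi_pos hδ z
  have h1 : HasFDerivAt (fun z => (phi δ z)⁻¹) _ z :=
    (hasDerivAt_inv h.ne').comp_hasFDerivAt z (hasFDerivAt_phi hδ z)
  have h2 := h1.smul (hasFDerivAt_id z)
  have h3 : HasFDerivAt (om δ) _ z := h2
  rw [h3.fderiv]
  simp [om, smul_sub, smul_smul, inner_smul_left]
  rw [sub_eq_add_neg]
  congr 1
  rw [← neg_smul]
  congr 1
  field_simp
  try simp

lemma norm_vrel_lt (ξ : E3) : ‖vrel ξ‖ < 1 := by
  have h : ‖ξ‖ < Real.sqrt (1 + ‖ξ‖ ^ 2) := by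
    apply Real.lt_sqrt_of_sq_lt; linarith
  have h0 : 0 < Real.sqrt (1 + ‖ξ‖ ^ 2) := by positivity
  rw [vrel, norm_smul, norm_inv, Real.norm_of_nonneg h0.le, inv_mul_lt_iff₀ h0]
  simpa using h

lemma contDiff_vrel {n : WithTop ℕ∞} : ContDiff ℝ n vrel := by
  unfold vrel
  refine ContDiff.smul (f := fun ξ : E3 => (√(1 + ‖ξ‖ ^ 2))⁻¹) ?_ contDiff_id
  apply ContDiff.inv
  · apply ContDiff.sqrt
    · exact contDiff_const.add (contDiff_norm_sq ℝ)
    · intro z; positivity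
  · intro z; positivity

lemma mem_OmU_of_le {w ξ : E3} (hw : ‖w‖ ≤ 1) : (w, ξ) ∈ OmU := by
  have h1 := abs_real_inner_le_norm (vrel ξ) w
  have h2 := norm_vrel_lt ξ
  have h3 : ‖vrel ξ‖ * ‖w‖ ≤ ‖vrel ξ‖ := mul_le_of_le_one_right (norm_nonneg _) hw
  have := (abs_le.1 h1).1
  show 0 < 1 + ⟪vrel ξ, w⟫
  linarith

lemma isOpen_OmU : IsOpen OmU := by
  apply isOpen_lt continuous_const
  have := (contDiff_vrel (n := 0)).continuous
  fun_prop

lemma SU.bound {A : X6 → ℝ} (hA : SU A) (r : ℝ) :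
    ∃ C : ℝ, 0 < C ∧ ∀ w ξ : E3, ‖w‖ ≤ 1 → ‖ξ‖ ≤ r → |A (w, ξ)| ≤ C := by
  have hK : IsCompact ((closedBall (0:E3) 1) ×ˢ (closedBall (0:E3) r)) :=
    (isCompact_closedBall _ _).prod (isCompact_closedBall _ _)
  obtain ⟨C, hC⟩ := hK.exists_bound_of_continuousOn (f := A) (hA.continuousOn.mono (by
    rintro ⟨w, ξ⟩ ⟨hw, _⟩
    exact mem_OmU_of_le (by simpa using hw)))
  refine ⟨max C 1, by positivity, fun w ξ hw hξ => ?_⟩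
  exact (hC (w, ξ) ⟨by simpa using hw, by simpa using hξ⟩).trans (le_max_left _ _)

lemma SU.mul {A B : X6 → ℝ} (hA : SU A) (hB : SU B) : SU (fun p => A p * B p) :=
  ContDiffOn.mul hA hB
lemma SU.add {A B : X6 → ℝ} (hA : SU A) (hB : SU B) : SU (fun p => A p + B p) :=
  ContDiffOn.add hA hB
lemma SU.sub {A B : X6 → ℝ} (hA : SU A) (hB : SU B) : SU (fun p => A p - B p) :=
  ContDiffOn.sub hA hB
lemma SU.neg {A : X6 → ℝ} (hA : SU A) : SU (fun p => - A p) :=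
  ContDiffOn.neg hA
lemma SU.sum {ι : Type*} {s : Finset ι} {A : ι → X6 → ℝ} (hA : ∀ i, SU (A i)) :
    SU (fun p => ∑ i ∈ s, A i p) :=
  ContDiffOn.sum (fun i _ => hA i)
lemma SU.of {A : X6 → ℝ} (hA : ContDiff ℝ (⊤ : ℕ∞) A) : SU A := hA.contDiffOn

lemma contDiff_inner_vrel : ContDiff ℝ (⊤ : ℕ∞) (fun p : X6 => ⟪vrel p.2, p.1⟫) :=
  (contDiff_vrel.comp contDiff_snd).inner ℝ contDiff_fst

def alpha (d0 : ℝ) (dx : E3) (p : X6) : ℝ := (d0 + ⟪dx, p.1⟫) / (1 + ⟪vrel p.2, p.1⟫)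
def beta (d0 : ℝ) (dx : E3) (j : Fin 3) (p : X6) : ℝ := dx j - vrel p.2 j * alpha d0 dx p

lemma SU_alpha (d0 : ℝ) (dx : E3) : SU (alpha d0 dx) := by
  apply ContDiffOn.div
  · exact (contDiff_const.add (contDiff_const.inner ℝ contDiff_fst)).contDiffOn
  · exact (contDiff_const.add contDiff_inner_vrel).contDiffOn
  · intro p hp; exact (ne_of_gt hp)

lemma contDiff_coord (j : Fin 3) {n : WithTop ℕ∞} : ContDiff ℝ n (fun x : E3 => x j) :=
  (EuclideanSpace.proj (𝕜 := ℝ) j : E3 →L[ℝ] ℝ).contDiff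

lemma SU_beta (d0 : ℝ) (dx : E3) (j : Fin 3) : SU (beta d0 dx j) := by
  refine SU.sub (SU.of contDiff_const) (SU.mul (SU.of ?_) (SU_alpha d0 dx))
  exact (contDiff_coord j).comp (contDiff_vrel.comp contDiff_snd)

lemma SU.fd {A : X6 → ℝ} (hA : SU A) {c : X6 → X6} (hc : ContDiff ℝ (⊤ : ℕ∞) c) :
    SU (fun p => fderiv ℝ A p (c p)) := by
  have h : ContDiffOn ℝ (⊤ : ℕ∞) (fderiv ℝ A) OmU :=
    hA.fderiv_of_isOpen isOpen_OmU (by simp)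
  exact h.clm_apply hc.contDiffOn

def PA (j : Fin 3) (A : X6 → ℝ) (p : X6) : ℝ := fderiv ℝ A p (e3 j - p.1 j • p.1, 0)

lemma SU_PA (j : Fin 3) {A : X6 → ℝ} (hA : SU A) : SU (PA j A) := by
  apply hA.fd
  apply ContDiff.prodMk _ contDiff_const
  exact contDiff_const.sub (((contDiff_coord j).comp contDiff_fst).smul contDiff_fst)

lemma inner_e3 (w : E3) (j : Fin 3) : ⟪w, e3 j⟫ = w j := by
  simp [e3, EuclideanSpace.inner_single_right]

lemma e3_apply (i j : Fin 3) : e3 i j = if j = i then 1 else 0 := by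
  simp [e3]

lemma sum_e3 (w : E3) : ∑ j, w j • e3 j = w := by
  ext i; fin_cases i <;> simp [Fin.sum_univ_three, e3_apply]

lemma inner_sum3 (v w : E3) : ⟪v, w⟫ = ∑ j, v j * w j := by
  simp [PiLp.inner_apply, mul_comm]

lemma dir_decomp (d0 : ℝ) (dx : E3) {p : X6} (hp : p ∈ OmU) :
    ((d0, dx, 0) : Y3) = alpha d0 dx p • ((1, vrel p.2, 0) : Y3)
      + ∑ j, beta d0 dx j p • ((- p.1 j, e3 j, 0) : Y3) := by
  have hp' : 1 + ⟪vrel p.2, p.1⟫ ≠ 0 := ne_of_gt hp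
  have ha : alpha d0 dx p * (1 + ⟪vrel p.2, p.1⟫) = d0 + ⟪dx, p.1⟫ := by
    unfold alpha; field_simp
  have h1 : dx = alpha d0 dx p • vrel p.2 + ∑ j, beta d0 dx j p • e3 j := by
    unfold beta
    simp only [sub_smul, Finset.sum_sub_distrib, sum_e3, mul_comm _ (alpha d0 dx p), mul_smul,
      ← Finset.smul_sum]
    simp
  have h0 : d0 = alpha d0 dx p + ∑ j, beta d0 dx j p * (- p.1 j) := by
    rw [inner_sum3, inner_sum3] at ha
    simp only [beta, Fin.sum_univ_three] at ha ⊢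
    linarith
  ext1
  · simp only [Prod.fst_add, Prod.fst_sum, Prod.smul_fst, smul_eq_mul, mul_one]
    exact h0
  · ext1
    · simp only [Prod.snd_add, Prod.snd_sum, Prod.smul_snd, Prod.fst_add, Prod.fst_sum,
        Prod.smul_fst]
      exact h1
    · simp [Fin.sum_univ_three]
end

noncomputable section

instance instHaarX6 : (volume : Measure X6).IsAddHaarMeasure :=
  inferInstanceAs ((volume : Measure E3).prod (volume : Measure E3)).IsAddHaarMeasure

structure Cfg (δ τ t T : ℝ) : Prop where
  hδ : 0 < δ
  hT : T < t
  ht : t < τ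
structure Q0 (T : ℝ) (q : ℝ → ℝ) : Prop where
  c : ContinuousOn q (Ioi 0)
  z : ∀ s, T ≤ s → q s = 0
structure Q1 (T : ℝ) (q : ℝ → ℝ) : Prop where
  c : ContDiffOn ℝ 1 q (Ioi 0)
  z : ∀ s, T ≤ s → q s = 0
structure G0 (τ r : ℝ) (g : Y3 → ℝ) : Prop where
  c : ContinuousOn g (Om τ)
  z : XS r g
structure G1 (τ r : ℝ) (g : Y3 → ℝ) : Prop where
  c : ContDiffOn ℝ 1 g (Om τ)
  z : XS r g

lemma isOpen_Om (τ : ℝ) : IsOpen (Om τ) := isOpen_Ioo.prod isOpen_univ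

lemma Q1.q0 {T : ℝ} {q : ℝ → ℝ} (h : Q1 T q) : Q0 T q := ⟨h.c.continuousOn, h.z⟩
lemma G1.g0 {τ r : ℝ} {g : Y3 → ℝ} (h : G1 τ r g) : G0 τ r g := ⟨h.c.continuousOn, h.z⟩

lemma Q1.deriv {T : ℝ} {q : ℝ → ℝ} (h : Q1 T q) : Q0 T (deriv q) := by
  have hc : ContinuousOn (_root_.deriv q) (Ioi 0) :=
    h.c.continuousOn_deriv_of_isOpen isOpen_Ioi (by simp)
  have h1 : ∀ s, T < s → _root_.deriv q s = 0 := by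
    intro s hs
    have : q =ᶠ[𝓝 s] fun _ => 0 := by
      filter_upwards [Ioi_mem_nhds hs] with y hy using h.z y (le_of_lt hy)
    rw [this.deriv_eq]; simp
  refine ⟨hc, fun s hs => ?_⟩
  rcases hs.lt_or_eq with h2 | h2
  · exact h1 s h2
  · subst h2
    by_cases hT : 0 < T
    · have hcT : ContinuousAt (_root_.deriv q) T := hc.continuousAt (Ioi_mem_nhds hT)
      have h3 : Tendsto (_root_.deriv q) (𝓝[>] T) (𝓝 (_root_.deriv q T)) :=
        hcT.mono_left nhdsWithin_le_nhds
      have h4 : Tendsto (_root_.deriv q) (𝓝[>] T) (𝓝 0) := by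
        apply tendsto_const_nhds.congr'
        filter_upwards [self_mem_nhdsWithin] with y hy using (h1 y hy).symm
      exact tendsto_nhds_unique h3 h4
    · by_contra hne
      have hd : DifferentiableAt ℝ q T := differentiableAt_of_deriv_ne_zero hne
      have e1 : HasDerivWithinAt q (_root_.deriv q T) (Ici T) T := hd.hasDerivAt.hasDerivWithinAt
      have e2 : HasDerivWithinAt q 0 (Ici T) T := by
        apply (hasDerivWithinAt_const T (Ici T) (0:ℝ)).congr
        · intro y hy; exact h.z y hy
        · exact h.z T le_rfl
      exact hne ((uniqueDiffWithinAt_Ici T).eq_deriv _ e1 e2)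

lemma Q0.div {T : ℝ} {q : ℝ → ℝ} (h : Q0 T q) : Q0 T (fun s => q s / s) :=
  ⟨h.c.div continuousOn_id (fun s hs => ne_of_gt hs), fun s hs => by simp [h.z s hs]⟩

lemma G1.fd {τ r : ℝ} {g : Y3 → ℝ} (h : G1 τ r g) {c : Y3 → Y3} (hc : Continuous c) :
    G0 τ r (fun p => fderiv ℝ g p (c p)) := by
  refine ⟨?_, fun p hp => ?_⟩
  · exact (h.c.continuousOn_fderiv_of_isOpen (isOpen_Om τ) (by simp)).clm_apply hc.continuousOn
  · have : g =ᶠ[𝓝 p] fun _ => 0 := by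
      have ho : IsOpen {p : Y3 | r < ‖p.2.2‖} := isOpen_lt continuous_const (by fun_prop)
      filter_upwards [ho.mem_nhds hp] with y hy using h.z y hy
    rw [this.fderiv_eq]; simp

lemma Gam_mem {δ τ t T : ℝ} (h : Cfg δ τ t T) {x : E3} {p : X6} (hp : phi δ p.1 < t) :
    Gam δ t x p ∈ Om τ := by
  refine ⟨⟨?_, ?_⟩, mem_univ _⟩
  · simp [Gam]; exact hp
  · have := phi_pos h.hδ p.1
    have := h.ht
    simp [Gam]; linarith

lemma continuous_phi {δ : ℝ} (hδ : 0 < δ) : Continuous (phi δ) := (contDiff_phi hδ (n := 0)).continuous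
lemma continuous_om {δ : ℝ} (hδ : 0 < δ) : Continuous (om δ) := (contDiff_om hδ (n := 0)).continuous
lemma contDiff_Gam {δ : ℝ} (hδ : 0 < δ) (t : ℝ) (x : E3) : ContDiff ℝ 1 (Gam δ t x) :=
  (contDiff_const.sub ((contDiff_phi hδ).comp contDiff_fst)).prodMk
    ((contDiff_const.add contDiff_fst).prodMk contDiff_snd)

lemma om_mem {δ : ℝ} (hδ : 0 < δ) (p : X6) : (om δ p.1, p.2) ∈ OmU :=
  mem_OmU_of_le (norm_om_lt hδ p.1).le

lemma continuous_ker {δ : ℝ} (hδ : 0 < δ) {q : ℝ → ℝ} (hq : ContinuousOn q (Ioi 0))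
    {A : X6 → ℝ} (hA : SU A) : Continuous (kerK δ q A) := by
  have h1 := continuous_phi hδ
  have h2 := continuous_om hδ
  apply Continuous.mul
  · exact hq.comp_continuous (by fun_prop) (fun p => phi_pos hδ p.1)
  · exact hA.continuousOn.comp_continuous (by fun_prop) (fun p => om_mem hδ p)

lemma ker_zero {δ T : ℝ} {q : ℝ → ℝ} (hq : ∀ s, T ≤ s → q s = 0) {A : X6 → ℝ} {p : X6}
    (hp : T ≤ phi δ p.1) : kerK δ q A p = 0 := by simp [kerK, hq _ hp]

lemma cont_kerG {δ τ t T : ℝ} (h : Cfg δ τ t T) {q : ℝ → ℝ} (hq : Q0 T q) {A : X6 → ℝ}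
    (hA : SU A) {k : Y3 → ℝ} (hk : ContinuousOn k (Om τ)) (x : E3) :
    Continuous (fun p => kerK δ q A p * k (Gam δ t x p)) := by
  have h1 := continuous_phi h.hδ
  rw [continuous_iff_continuousAt]
  intro p
  by_cases hp : phi δ p.1 < t
  · apply (continuous_ker h.hδ hq.c hA).continuousAt.mul
    have : ContinuousAt k (Gam δ t x p) :=
      hk.continuousAt ((isOpen_Om τ).mem_nhds (Gam_mem h hp))
    exact this.comp (contDiff_Gam h.hδ t x).continuous.continuousAt
  · have hT : T < phi δ p.1 := h.hT.trans_le (not_lt.1 hp)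
    have ho : IsOpen {p : X6 | T < phi δ p.1} := isOpen_lt continuous_const (by fun_prop)
    apply (continuousAt_const (y := (0:ℝ))).congr
    filter_upwards [ho.mem_nhds hT] with y hy
    rw [ker_zero hq.z (le_of_lt hy)]; simp

lemma supp_kerG {δ τ t T r : ℝ} {q : ℝ → ℝ} (hq : Q0 T q) {A : X6 → ℝ}
    {k : Y3 → ℝ} (hk : G0 τ r k) (x : E3) :
    HasCompactSupport (fun p => kerK δ q A p * k (Gam δ t x p)) := by
  apply HasCompactSupport.intro
    (K := (closedBall (0:E3) T) ×ˢ (closedBall (0:E3) r))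
    ((isCompact_closedBall _ _).prod (isCompact_closedBall _ _))
  intro p hp
  simp only [mem_prod, mem_closedBall, dist_zero_right, not_and_or, not_le] at hp
  rcases hp with hp | hp
  · rw [ker_zero hq.z (hp.le.trans (norm_le_phi _))]; simp
  · rw [hk.z (Gam δ t x p) hp]; simp

lemma int_kerG {δ τ t T r : ℝ} (h : Cfg δ τ t T) {q : ℝ → ℝ} (hq : Q0 T q) {A : X6 → ℝ}
    (hA : SU A) {k : Y3 → ℝ} (hk : G0 τ r k) (x : E3) :
    Integrable (fun p => kerK δ q A p * k (Gam δ t x p)) :=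
  (cont_kerG h hq hA hk.c x).integrable_of_hasCompactSupport (supp_kerG hq hk x)

lemma hasFDerivAt_ker {δ : ℝ} (hδ : 0 < δ) {q : ℝ → ℝ} (hq : ContDiffOn ℝ 1 q (Ioi 0))
    {A : X6 → ℝ} (hA : SU A) (p : X6) :
    HasFDerivAt (kerK δ q A)
      (q (phi δ p.1) • ((fderiv ℝ A (om δ p.1, p.2)).comp
          (((fderiv ℝ (om δ) p.1).comp (ContinuousLinearMap.fst ℝ E3 E3)).prod
            (ContinuousLinearMap.snd ℝ E3 E3)))
        + A (om δ p.1, p.2) • (deriv q (phi δ p.1) •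
          ((fderiv ℝ (phi δ) p.1).comp (ContinuousLinearMap.fst ℝ E3 E3)))) p := by
  have hq' : HasDerivAt q (deriv q (phi δ p.1)) (phi δ p.1) :=
    ((hq.differentiableOn (by simp)).differentiableAt (Ioi_mem_nhds (phi_pos hδ p.1))).hasDerivAt
  have h1 : HasFDerivAt (fun p : X6 => phi δ p.1)
      ((fderiv ℝ (phi δ) p.1).comp (ContinuousLinearMap.fst ℝ E3 E3)) p :=
    (((contDiff_phi hδ (n := 1)).differentiable (by simp)) p.1).hasFDerivAt.comp p hasFDerivAt_fst
  have h2 : HasFDerivAt (fun p : X6 => om δ p.1)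
      ((fderiv ℝ (om δ) p.1).comp (ContinuousLinearMap.fst ℝ E3 E3)) p :=
    (((contDiff_om hδ (n := 1)).differentiable (by simp)) p.1).hasFDerivAt.comp p hasFDerivAt_fst
  have hA' : HasFDerivAt A (fderiv ℝ A (om δ p.1, p.2)) (om δ p.1, p.2) :=
    ((hA.differentiableOn (by simp)).differentiableAt
      (isOpen_OmU.mem_nhds (om_mem hδ p))).hasFDerivAt
  exact (hq'.comp_hasFDerivAt p h1).mul
    (hA'.comp (f := fun p : X6 => (om δ p.1, p.2)) p (h2.prodMk hasFDerivAt_snd))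

lemma fderiv_ker_x {δ : ℝ} (hδ : 0 < δ) {q : ℝ → ℝ} (hq : ContDiffOn ℝ 1 q (Ioi 0))
    {A : X6 → ℝ} (hA : SU A) (p : X6) (j : Fin 3) :
    fderiv ℝ (kerK δ q A) p (e3 j, 0) =
      kerK δ (fun s => q s / s) (PA j A) p + kerK δ (deriv q) (fun p => p.1 j * A p) p := by
  rw [(hasFDerivAt_ker hδ hq hA p).fderiv]
  simp only [add_apply, smul_apply,
    ContinuousLinearMap.comp_apply, ContinuousLinearMap.prod_apply,
    ContinuousLinearMap.coe_fst', ContinuousLinearMap.coe_snd', fderiv_om hδ, fderiv_phi hδ,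
    inner_e3, kerK, PA, smul_eq_mul]
  have : (((phi δ p.1)⁻¹ • (e3 j - (om δ p.1) j • om δ p.1), (0:E3)) : X6)
      = (phi δ p.1)⁻¹ • (e3 j - (om δ p.1) j • om δ p.1, 0) := by simp
  rw [this, map_smul, smul_eq_mul]
  ring

lemma fderiv_ker_xi {δ : ℝ} (hδ : 0 < δ) {q : ℝ → ℝ} (hq : ContDiffOn ℝ 1 q (Ioi 0))
    {A : X6 → ℝ} (hA : SU A) (p : X6) (e : E3) :
    fderiv ℝ (kerK δ q A) p (0, e) = kerK δ q (fun p => fderiv ℝ A p (0, e)) p := by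
  rw [(hasFDerivAt_ker hδ hq hA p).fderiv]
  simp [kerK]

lemma fderiv_gGam {δ τ t T r : ℝ} (h : Cfg δ τ t T) {g : Y3 → ℝ} (hg : G1 τ r g) (x : E3)
    {p : X6} (hp : phi δ p.1 < t) :
    DifferentiableAt ℝ (fun p => g (Gam δ t x p)) p ∧
    ∀ e : X6, fderiv ℝ (fun p => g (Gam δ t x p)) p e =
      fderiv ℝ g (Gam δ t x p) (- ⟪om δ p.1, e.1⟫, e.1, e.2) := by
  have hg' : HasFDerivAt g (fderiv ℝ g (Gam δ t x p)) (Gam δ t x p) :=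
    ((hg.c.differentiableOn (by simp)).differentiableAt
      ((isOpen_Om τ).mem_nhds (Gam_mem h hp))).hasFDerivAt
  have h1 : HasFDerivAt (fun p : X6 => t - phi δ p.1)
      (-((innerSL ℝ (om δ p.1)).comp (ContinuousLinearMap.fst ℝ E3 E3))) p :=
    ((hasFDerivAt_phi h.hδ p.1).comp p hasFDerivAt_fst).const_sub t
  have h2 : HasFDerivAt (fun p : X6 => x + p.1) (ContinuousLinearMap.fst ℝ E3 E3) p :=
    hasFDerivAt_fst.const_add x
  have h3 : HasFDerivAt (Gam δ t x) _ p := h1.prodMk (h2.prodMk hasFDerivAt_snd)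
  have h4 := hg'.comp p h3
  refine ⟨h4.differentiableAt, fun e => ?_⟩
  have : fderiv ℝ (fun p => g (Gam δ t x p)) p = _ := h4.fderiv
  rw [this]
  simp

lemma ibp {δ τ t T r : ℝ} (h : Cfg δ τ t T) {q : ℝ → ℝ} (hq : Q1 T q) {A : X6 → ℝ}
    (hA : SU A) {g : Y3 → ℝ} (hg : G1 τ r g) (x : E3) (e : X6)
    (hi : Integrable (fun p => fderiv ℝ (kerK δ q A) p e * g (Gam δ t x p))) :
    Integrable (fun p => kerK δ q A p * fderiv ℝ g (Gam δ t x p) (- ⟪om δ p.1, e.1⟫, e.1, e.2)) ∧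
    ∫ p, kerK δ q A p * fderiv ℝ g (Gam δ t x p) (- ⟪om δ p.1, e.1⟫, e.1, e.2) =
      - ∫ p, fderiv ℝ (kerK δ q A) p e * g (Gam δ t x p) := by
  have hts : ∀ p ∈ tsupport (kerK δ q A), phi δ p.1 < t := by
    intro p hp
    have hcl : IsClosed {p : X6 | phi δ p.1 ≤ T} :=
      isClosed_le ((continuous_phi h.hδ).comp continuous_fst) continuous_const
    have : tsupport (kerK δ q A) ⊆ {p : X6 | phi δ p.1 ≤ T} := by
      apply closure_minimal _ hcl
      intro y hy
      by_contra hcon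
      exact hy (ker_zero hq.z (le_of_lt (not_le.1 hcon)))
    exact (this hp : phi δ p.1 ≤ T).trans_lt h.hT
  have heq : ∀ p, kerK δ q A p * fderiv ℝ (fun p => g (Gam δ t x p)) p e
      = kerK δ q A p * fderiv ℝ g (Gam δ t x p) (- ⟪om δ p.1, e.1⟫, e.1, e.2) := by
    intro p
    by_cases hp : phi δ p.1 < t
    · rw [(fderiv_gGam h hg x hp).2]
    · rw [ker_zero hq.z (h.hT.le.trans (not_lt.1 hp))]; simp
  have hint : Integrable (fun p => kerK δ q A p *
      fderiv ℝ g (Gam δ t x p) (- ⟪om δ p.1, e.1⟫, e.1, e.2)) := by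
    have hsum : ∀ p, kerK δ q A p * fderiv ℝ g (Gam δ t x p) (- ⟪om δ p.1, e.1⟫, e.1, e.2)
        = kerK δ q A p * fderiv ℝ g (Gam δ t x p) (0, e.1, e.2)
          + kerK δ q (fun p => - ⟪p.1, e.1⟫ * A p) p * fderiv ℝ g (Gam δ t x p) (1, 0, 0) := by
      intro p
      have : ((- ⟪om δ p.1, e.1⟫, e.1, e.2) : Y3)
          = (0, e.1, e.2) + (- ⟪om δ p.1, e.1⟫) • (1, 0, 0) := by simp
      rw [this, map_add, map_smul]
      simp only [kerK, smul_eq_mul]; ring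
    simp_rw [hsum]
    apply Integrable.add
    · exact int_kerG h hq.q0 hA (hg.fd continuous_const) x
    · refine int_kerG h hq.q0 (SU.mul (SU.of ?_) hA) (hg.fd continuous_const) x
      exact (contDiff_fst.inner ℝ contDiff_const).neg
  refine ⟨hint, ?_⟩
  simp_rw [← heq]
  apply integral_mul_fderiv_eq_neg_fderiv_mul_of_integrable hi
  · simpa only [heq] using hint
  · exact int_kerG h hq.q0 hA hg.g0 x
  · intro p _; exact (hasFDerivAt_ker h.hδ hq.c hA p).differentiableAt
  · intro p hp; exact (fderiv_gGam h hg x (hts p hp)).1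
end

noncomputable section

def II (δ t : ℝ) (x : E3) (q : ℝ → ℝ) (A : X6 → ℝ) (g : Y3 → ℝ) : ℝ :=
  ∫ p : X6, kerK δ q A p * g (Gam δ t x p)

def TT (g : Y3 → ℝ) (p : Y3) : ℝ := fderiv ℝ g p (1, vrel p.2.2, 0)

lemma continuous_vrel : Continuous vrel := (contDiff_vrel (n := 0)).continuous

lemma G1.TT {τ r : ℝ} {g : Y3 → ℝ} (h : G1 τ r g) : G0 τ r (TT g) :=
  h.fd (c := fun p => (1, vrel p.2.2, 0)) (by have := continuous_vrel; fun_prop)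

lemma II_congr {δ τ t T : ℝ} (h : Cfg δ τ t T) {q : ℝ → ℝ} (hq : Q0 T q) {A : X6 → ℝ}
    {g g' : Y3 → ℝ} (x : E3) (hgg : ∀ p ∈ Om τ, g p = g' p) :
    II δ t x q A g = II δ t x q A g' := by
  apply integral_congr_ae
  refine Eventually.of_forall fun p => ?_
  by_cases hp : phi δ p.1 < t
  · simp only [hgg _ (Gam_mem h hp)]
  · simp [ker_zero hq.z (h.hT.le.trans (not_lt.1 hp))]

lemma L3 {δ τ t T r : ℝ} (h : Cfg δ τ t T) {q : ℝ → ℝ} (hq : Q1 T q) {A : X6 → ℝ}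
    (hA : SU A) {g : Y3 → ℝ} (hg : G1 τ r g) (x : E3) (e : E3) :
    II δ t x q A (fun p => fderiv ℝ g p (0, 0, e)) =
      II δ t x q (fun p => - fderiv ℝ A p (0, e)) g := by
  have h1 := (ibp h hq hA hg x (0, e) (by
    simp_rw [fderiv_ker_xi h.hδ hq.c hA]
    exact int_kerG h hq.q0 (hA.fd contDiff_const) hg.g0 x)).2
  simp only [inner_zero_right, neg_zero] at h1
  unfold II
  rw [h1, ← integral_neg]
  simp_rw [fderiv_ker_xi h.hδ hq.c hA]
  simp [kerK]

def A2 (d0 : ℝ) (dx : E3) (A : X6 → ℝ) (p : X6) : ℝ :=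
  ∑ j, - PA j (fun p => A p * beta d0 dx j p) p
def A3 (d0 : ℝ) (dx : E3) (A : X6 → ℝ) (p : X6) : ℝ :=
  ∑ j, - (p.1 j * (A p * beta d0 dx j p))

lemma SU_A1 (d0 : ℝ) (dx : E3) {A : X6 → ℝ} (hA : SU A) : SU (fun p => A p * alpha d0 dx p) :=
  hA.mul (SU_alpha d0 dx)
lemma SU_co (j : Fin 3) : SU (fun p => p.1 j) := SU.of ((contDiff_coord j).comp contDiff_fst)
lemma SU_A2 (d0 : ℝ) (dx : E3) {A : X6 → ℝ} (hA : SU A) : SU (A2 d0 dx A) :=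
  SU.sum fun j => (SU_PA j (hA.mul (SU_beta d0 dx j))).neg
lemma SU_A3 (d0 : ℝ) (dx : E3) {A : X6 → ℝ} (hA : SU A) : SU (A3 d0 dx A) :=
  SU.sum fun j => ((SU_co j).mul (hA.mul (SU_beta d0 dx j))).neg

lemma L2 {δ τ t T r : ℝ} (h : Cfg δ τ t T) {q : ℝ → ℝ} (hq : Q1 T q) {A : X6 → ℝ}
    (hA : SU A) {g : Y3 → ℝ} (hg : G1 τ r g) (x : E3) (d0 : ℝ) (dx : E3) :
    II δ t x q A (fun p => fderiv ℝ g p (d0, dx, 0)) =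
      II δ t x q (fun p => A p * alpha d0 dx p) (TT g)
      + II δ t x (fun s => q s / s) (A2 d0 dx A) g + II δ t x (deriv q) (A3 d0 dx A) g := by
  have hAb : ∀ j, SU (fun p => A p * beta d0 dx j p) := fun j => hA.mul (SU_beta d0 dx j)
  have hi1 : ∀ j, Integrable fun p => kerK δ (fun s => q s / s)
      (PA j (fun p => A p * beta d0 dx j p)) p * g (Gam δ t x p) := fun j =>
    int_kerG h hq.q0.div (SU_PA j (hAb j)) hg.g0 x
  have hi2 : ∀ j, Integrable fun p => kerK δ (deriv q)
      (fun p => p.1 j * (A p * beta d0 dx j p)) p * g (Gam δ t x p) := fun j =>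
    int_kerG h hq.deriv ((SU_co j).mul (hAb j)) hg.g0 x
  have hb := fun j => ibp h hq (hAb j) hg x (e3 j, 0) (by
    simp_rw [fderiv_ker_x h.hδ hq.c (hAb j), add_mul]
    exact (hi1 j).add (hi2 j))
  have hdec : ∀ p : X6, kerK δ q A p * fderiv ℝ g (Gam δ t x p) (d0, dx, 0) =
      kerK δ q (fun p => A p * alpha d0 dx p) p * TT g (Gam δ t x p)
      + ∑ j, kerK δ q (fun p => A p * beta d0 dx j p) p *
        fderiv ℝ g (Gam δ t x p) (- ⟪om δ p.1, e3 j⟫, e3 j, 0) := by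
    intro p
    rw [dir_decomp d0 dx (om_mem h.hδ p), map_add, map_smul, map_sum]
    simp only [map_smul, inner_e3, TT, kerK, Gam, smul_eq_mul, mul_add, Finset.mul_sum]
    congr 1
    · ring
    · exact Finset.sum_congr rfl fun j _ => by ring
  unfold II
  simp_rw [hdec]
  rw [integral_add (int_kerG h hq.q0 (SU_A1 d0 dx hA) hg.TT x)
    (integrable_finsetSum _ fun j _ => (hb j).1), integral_finsetSum _ fun j _ => (hb j).1]
  simp_rw [fun j => (hb j).2]
  rw [add_assoc]
  congr 1
  have e1 : ∀ j, -∫ p, fderiv ℝ (kerK δ q (fun p => A p * beta d0 dx j p)) p (e3 j, 0) *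
      g (Gam δ t x p) = (∫ p, - (kerK δ (fun s => q s / s)
      (PA j (fun p => A p * beta d0 dx j p)) p * g (Gam δ t x p))) + ∫ p, -(kerK δ (deriv q)
      (fun p => p.1 j * (A p * beta d0 dx j p)) p * g (Gam δ t x p)) := by
    intro j
    simp_rw [fderiv_ker_x h.hδ hq.c (hAb j), add_mul]
    rw [integral_add (hi1 j) (hi2 j), integral_neg, integral_neg]; ring
  simp_rw [e1]
  rw [Finset.sum_add_distrib, ← integral_finsetSum _ fun j _ => (hi1 j).fun_neg,
    ← integral_finsetSum _ fun j _ => (hi2 j).fun_neg]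
  congr 1
  · congr 1; ext p; simp only [kerK, A2, Finset.mul_sum, Finset.sum_mul]
    exact Finset.sum_congr rfl fun j _ => by ring
  · congr 1; ext p; simp only [kerK, A3, Finset.mul_sum, Finset.sum_mul]
    exact Finset.sum_congr rfl fun j _ => by ring

structure Trip (τ r : ℝ) (g K : Y3 → ℝ) (H : Fin 3 → Y3 → ℝ) : Prop where
  hg : G1 τ r g
  hK : G0 τ r K
  hH : ∀ l, G1 τ r (H l)
  eq : ∀ p ∈ Om τ, TT g p = K p - ∑ l, fderiv ℝ (H l) p (0, 0, e3 l)

def Bl (d0 : ℝ) (dx : E3) (A : X6 → ℝ) (l : Fin 3) (p : X6) : ℝ :=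
  fderiv ℝ (fun p => A p * alpha d0 dx p) p (0, e3 l)
lemma SU_Bl (d0 : ℝ) (dx : E3) {A : X6 → ℝ} (hA : SU A) (l : Fin 3) : SU (Bl d0 dx A l) :=
  (SU_A1 d0 dx hA).fd contDiff_const

lemma comb {δ τ t T r : ℝ} (h : Cfg δ τ t T) {q : ℝ → ℝ} (hq : Q1 T q) {A : X6 → ℝ}
    (hA : SU A) {g K : Y3 → ℝ} {H : Fin 3 → Y3 → ℝ} (hg : Trip τ r g K H) (x : E3)
    (d0 : ℝ) (dx : E3) :
    II δ t x q A (fun p => fderiv ℝ g p (d0, dx, 0)) =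
      II δ t x q (fun p => A p * alpha d0 dx p) K
      + ∑ l, II δ t x q (Bl d0 dx A l) (H l)
      + II δ t x (fun s => q s / s) (A2 d0 dx A) g + II δ t x (deriv q) (A3 d0 dx A) g := by
  rw [L2 h hq hA hg.hg]
  congr 2
  rw [II_congr h hq.q0 x hg.eq]
  have hc : ∀ l : Fin 3, Continuous fun _ : Y3 => ((0, 0, e3 l) : Y3) := fun l => continuous_const
  have hi : ∀ l, Integrable fun p => kerK δ q (fun p => A p * alpha d0 dx p) p *
      fderiv ℝ (H l) (Gam δ t x p) (0, 0, e3 l) := fun l =>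
    int_kerG h hq.q0 (SU_A1 d0 dx hA) ((hg.hH l).fd (hc l)) x
  have : ∀ l, II δ t x q (Bl d0 dx A l) (H l) = - II δ t x q (fun p => A p * alpha d0 dx p)
      (fun p => fderiv ℝ (H l) p (0, 0, e3 l)) := by
    intro l
    rw [L3 h hq (SU_A1 d0 dx hA) (hg.hH l)]
    simp [II, kerK, Bl, integral_neg]
  simp_rw [this]
  simp only [II, mul_sub, Finset.mul_sum]
  rw [integral_sub (int_kerG h hq.q0 (SU_A1 d0 dx hA) hg.hK x)
    (integrable_finsetSum _ fun l _ => hi l), integral_finsetSum _ fun l _ => hi l]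
  simp [sub_eq_add_neg]
end

noncomputable section

def S3 : ℝ := 3 * (volume (ball (0:E3) 1)).toReal

lemma S3_nonneg : 0 ≤ S3 := by unfold S3; positivity

lemma radial {f : ℝ → ℝ} (hf : IntegrableOn (fun y => y ^ 2 * f y) (Ioi 0)) :
    Integrable (fun z : E3 => f ‖z‖) ∧ ∫ z : E3, f ‖z‖ = S3 * ∫ y in Ioi (0:ℝ), y ^ 2 * f y := by
  constructor
  · rw [integrable_fun_norm_addHaar (μ := (volume : Measure E3))]
    simpa using hf
  · rw [integral_fun_norm_addHaar (μ := (volume : Measure E3))]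
    simp [S3, Measure.real, mul_assoc]

lemma R1 {t : ℝ} (ht : 0 ≤ t) :
    Integrable (fun z : E3 => (Iio t).indicator (fun s => (s ^ 2)⁻¹) ‖z‖) ∧
      ∫ z : E3, (Iio t).indicator (fun s => (s ^ 2)⁻¹) ‖z‖ = S3 * t := by
  have e : EqOn (fun y : ℝ => y ^ 2 * (Iio t).indicator (fun s => (s ^ 2)⁻¹) y)
      ((Iio t).indicator (fun _ => (1:ℝ))) (Ioi 0) := by
    intro y hy
    have : y ≠ 0 := ne_of_gt hy
    by_cases h : y < t
    · simp [h, this]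
    · simp [h]
  have hi : IntegrableOn (fun y : ℝ => y ^ 2 * (Iio t).indicator (fun s => (s ^ 2)⁻¹) y) (Ioi 0) := by
    refine IntegrableOn.congr_fun ?_ e.symm measurableSet_Ioi
    rw [IntegrableOn, integrable_indicator_iff measurableSet_Iio, IntegrableOn,
      Measure.restrict_restrict measurableSet_Iio, inter_comm, Ioi_inter_Iio]
    simp
  refine ⟨(radial hi).1, ?_⟩
  rw [(radial hi).2, setIntegral_congr_fun measurableSet_Ioi e,
    setIntegral_indicator measurableSet_Iio, Ioi_inter_Iio]
  simp [ht]

lemma R4 {t d : ℝ} (ht : 0 ≤ t) (hd : 0 < d) :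
    Integrable (fun z : E3 => (Iio t).indicator (fun s => (s ^ 2 * (d + s))⁻¹) ‖z‖) ∧
      ∫ z : E3, (Iio t).indicator (fun s => (s ^ 2 * (d + s))⁻¹) ‖z‖ = S3 * Real.log (1 + t / d) := by
  have e : EqOn (fun y : ℝ => y ^ 2 * (Iio t).indicator (fun s => (s ^ 2 * (d + s))⁻¹) y)
      ((Iio t).indicator (fun s => (d + s)⁻¹)) (Ioi 0) := by
    intro y hy
    have : y ≠ 0 := ne_of_gt hy
    by_cases h : y < t
    · simp [h]; field_simp
    · simp [h]
  have hc : ContinuousOn (fun s : ℝ => (d + s)⁻¹) (Icc 0 t) := by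
    apply ContinuousOn.inv₀ (by fun_prop)
    intro s hs; have := hs.1; positivity
  have hi : IntegrableOn (fun y : ℝ => y ^ 2 * (Iio t).indicator (fun s => (s ^ 2 * (d + s))⁻¹) y) (Ioi 0) := by
    refine IntegrableOn.congr_fun ?_ e.symm measurableSet_Ioi
    rw [IntegrableOn, integrable_indicator_iff measurableSet_Iio, IntegrableOn,
      Measure.restrict_restrict measurableSet_Iio, inter_comm, Ioi_inter_Iio]
    exact (hc.integrableOn_compact isCompact_Icc).mono_set Ioo_subset_Icc_self
  refine ⟨(radial hi).1, ?_⟩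
  rw [(radial hi).2, setIntegral_congr_fun measurableSet_Ioi e,
    setIntegral_indicator measurableSet_Iio, Ioi_inter_Iio]
  congr 1
  rw [← integral_Ioc_eq_integral_Ioo, ← intervalIntegral.integral_of_le ht]
  rw [intervalIntegral.integral_comp_add_left (fun s => s⁻¹) d, integral_inv_of_pos (by linarith) (by linarith)]
  congr 1; field_simp; ring

def ps (h s : ℝ) : ℝ := Real.smoothTransition (2 * s / h - 1)

lemma ps_contDiff (h : ℝ) {n : ℕ∞} : ContDiff ℝ n (ps h) :=
  Real.smoothTransition.contDiff.comp (by fun_prop)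
lemma ps_nonneg (h s : ℝ) : 0 ≤ ps h s := Real.smoothTransition.nonneg _
lemma ps_le_one (h s : ℝ) : ps h s ≤ 1 := Real.smoothTransition.le_one _
lemma ps_zero {h s : ℝ} (hh : 0 < h) (hs : s ≤ h / 2) : ps h s = 0 :=
  Real.smoothTransition.zero_of_nonpos (by
    have : 2 * s / h ≤ 1 := by rw [div_le_one hh]; linarith
    linarith)
lemma ps_one {h s : ℝ} (hh : 0 < h) (hs : h ≤ s) : ps h s = 1 :=
  Real.smoothTransition.one_of_one_le (by
    have : 2 ≤ 2 * s / h := by rw [le_div_iff₀ hh]; linarith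
    linarith)
lemma ps_mono {h : ℝ} (hh : 0 < h) : Monotone (ps h) := fun a b hab =>
  Real.smoothTransition.monotone (by gcongr)
lemma dps_nonneg {h : ℝ} (hh : 0 < h) (s : ℝ) : 0 ≤ deriv (ps h) s := (ps_mono hh).deriv_nonneg
lemma dps_zero {h s : ℝ} (hh : 0 < h) (hs : s ≤ h / 2) : deriv (ps h) s = 0 := by
  apply IsLocalMin.deriv_eq_zero
  exact Eventually.of_forall fun y => by rw [ps_zero hh hs]; exact ps_nonneg _ _
lemma dps_zero' {h s : ℝ} (hh : 0 < h) (hs : h ≤ s) : deriv (ps h) s = 0 := by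
  apply IsLocalMax.deriv_eq_zero
  exact Eventually.of_forall fun y => by rw [ps_one hh hs]; exact ps_le_one _ _

structure Par (δ τ t h : ℝ) : Prop where
  hδ : 0 < δ
  hδt : δ ≤ t / 4
  hh : 0 < h
  hht : h ≤ t / 2
  ht : t < τ

lemma Par.cfg {δ τ t h : ℝ} (H : Par δ τ t h) : Cfg δ τ t (t - h / 2) :=
  ⟨H.hδ, by linarith [H.hh], H.ht⟩
lemma Par.tpos {δ τ t h : ℝ} (H : Par δ τ t h) : 0 < t := by linarith [H.hδ, H.hδt]

def cut (h t : ℝ) (c : ℝ → ℝ) (s : ℝ) : ℝ := ps h (t - s) * c s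
def dcut (h t : ℝ) (c : ℝ → ℝ) (s : ℝ) : ℝ := deriv (ps h) (t - s) * c s

lemma cut_Q1 {h t : ℝ} (hh : 0 < h) {c : ℝ → ℝ} (hc : ContDiffOn ℝ 1 c (Ioi 0)) :
    Q1 (t - h / 2) (cut h t c) := by
  refine ⟨ContDiffOn.mul ?_ hc, fun s hs => ?_⟩
  · exact (((ps_contDiff h (n := 1)).comp (contDiff_const.sub contDiff_id))).contDiffOn
  · rw [cut, ps_zero hh (by linarith)]; simp
lemma dcut_Q0 {h t : ℝ} (hh : 0 < h) {c : ℝ → ℝ} (hc : ContinuousOn c (Ioi 0)) :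
    Q0 (t - h / 2) (dcut h t c) := by
  refine ⟨ContinuousOn.mul ?_ hc, fun s hs => ?_⟩
  · exact (((ps_contDiff h (n := 1)).continuous_deriv (by simp)).comp (by fun_prop)).continuousOn
  · rw [dcut, dps_zero hh (by linarith)]; simp
lemma cut_deriv {h t : ℝ} {c : ℝ → ℝ} {c' s : ℝ} (hc : HasDerivAt c c' s) :
    deriv (cut h t c) s = - dcut h t c s + ps h (t - s) * c' := by
  have h1 : HasDerivAt (ps h) (deriv (ps h) (t - s)) (t - s) :=
    ((ps_contDiff h (n := 1)).differentiable (by simp) _).hasDerivAt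
  have h2 : HasDerivAt (fun s => ps h (t - s)) (- deriv (ps h) (t - s)) s := by
    simpa using h1.comp_const_sub t s
  have := (h2.mul hc).deriv
  simp only [dcut]
  rw [← neg_mul]
  exact this

lemma kerK_congr {δ : ℝ} (hδ : 0 < δ) {q q' : ℝ → ℝ} (hq : ∀ s, 0 < s → q s = q' s) (A : X6 → ℝ)
    (p : X6) : kerK δ q A p = kerK δ q' A p := by
  simp only [kerK, hq _ (phi_pos hδ p.1)]
lemma II_congr_q {δ t : ℝ} (hδ : 0 < δ) {q q' : ℝ → ℝ} (hq : ∀ s, 0 < s → q s = q' s) (A : X6 → ℝ)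
    (g : Y3 → ℝ) (x : E3) : II δ t x q A g = II δ t x q' A g := by
  simp only [II, kerK_congr hδ hq]

lemma est {A : X6 → ℝ} (hA : SU A) {r : ℝ} (hr : 0 ≤ r) : ∃ C : ℝ, 0 < C ∧ ∀ {δ t : ℝ} {x : E3} {q : ℝ → ℝ}
    {g : Y3 → ℝ} {W : E3 → ℝ} {w : ℝ}, 0 < δ → XS r g → Integrable W → ∫ z, W z ≤ w →
    (∀ z ξ : E3, ‖ξ‖ ≤ r → |q (phi δ z) * g (Gam δ t x (z, ξ))| ≤ W z) →
    |II δ t x q A g| ≤ C * w := by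
  obtain ⟨C, hC, hb⟩ := hA.bound r
  set b : ℝ := (volume (closedBall (0:E3) r)).toReal with hbdef
  refine ⟨C * b + 1, by positivity, ?_⟩
  intro δ t x q g W w hδ hg hW hw h
  have hW0 : ∀ z, 0 ≤ W z := fun z => (abs_nonneg _).trans (h z 0 (by simpa using hr))
  have hI : Integrable (fun p : X6 => C * W p.1 * (closedBall (0:E3) r).indicator (fun _ => (1:ℝ)) p.2) := by
    apply Integrable.mul_prod (hW.const_mul C)
    rw [integrable_indicator_iff measurableSet_closedBall]
    exact integrableOn_const (measure_closedBall_lt_top.ne)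
  have h1 : |II δ t x q A g| ≤ ∫ p : X6, C * W p.1 * (closedBall (0:E3) r).indicator (fun _ => (1:ℝ)) p.2 := by
    rw [← Real.norm_eq_abs]
    apply norm_integral_le_of_norm_le hI
    refine Eventually.of_forall fun p => ?_
    by_cases hp : ‖p.2‖ ≤ r
    · have e1 := hb (om δ p.1) p.2 (norm_om_lt hδ _).le hp
      have e2 := h p.1 p.2 hp
      have : kerK δ q A p * g (Gam δ t x p) = A (om δ p.1, p.2) * (q (phi δ p.1) * g (Gam δ t x (p.1, p.2))) := by
        simp only [kerK]; ring
      rw [this, norm_mul]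
      simp only [Real.norm_eq_abs, mem_closedBall, dist_zero_right, hp, indicator_of_mem, mul_one]
      gcongr
    · rw [hg (Gam δ t x p) (not_le.1 hp)]
      simp [hp]
  have h2 : ∫ p : X6, C * W p.1 * (closedBall (0:E3) r).indicator (fun _ => (1:ℝ)) p.2 = C * (∫ z, W z) * b := by
    rw [Measure.volume_eq_prod, integral_prod_mul (fun z => C * W z), integral_const_mul,
      integral_indicator measurableSet_closedBall]
    simp [hbdef, Measure.real]
  rw [h2] at h1
  have hw0 : 0 ≤ ∫ z, W z := integral_nonneg hW0
  calc _ ≤ _ := h1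
    _ = C * b * ∫ z, W z := by ring
    _ ≤ C * b * w := by gcongr
    _ ≤ _ := by nlinarith [hw0.trans hw]

lemma int_phi {δ T : ℝ} (hδ : 0 < δ) {q : ℝ → ℝ} (hq : Q0 T q) :
    Integrable (fun z => q (phi δ z)) := by
  apply Continuous.integrable_of_hasCompactSupport
  · exact hq.c.comp_continuous (continuous_phi hδ) (fun z => phi_pos hδ z)
  · apply HasCompactSupport.intro (isCompact_closedBall (0:E3) T)
    intro z hz
    simp only [mem_closedBall, dist_zero_right, not_le] at hz
    exact hq.z _ (hz.le.trans (norm_le_phi z))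

lemma ae_ne0 : ∀ᵐ z : E3, z ≠ 0 := by
  simp [ae_iff]

lemma inv_pow_contDiffOn (n : ℕ) {m : WithTop ℕ∞} : ContDiffOn ℝ m (fun s : ℝ => (s ^ n)⁻¹) (Ioi 0) := by
  apply ContDiffOn.inv (contDiff_id.pow n).contDiffOn
  intro s hs; have : (0:ℝ) < s := hs
  simp; intro h; exact absurd h this.ne'

lemma Wa {δ τ t h : ℝ} (H : Par δ τ t h) :
    Integrable (fun z => cut h t (fun s => (s ^ 2)⁻¹) (phi δ z)) ∧
      ∫ z, cut h t (fun s => (s ^ 2)⁻¹) (phi δ z) ≤ S3 * t := by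
  have hi := int_phi H.hδ (cut_Q1 (t := t) H.hh (inv_pow_contDiffOn 2)).q0
  refine ⟨hi, ?_⟩
  rw [← (R1 H.tpos.le).2]
  apply integral_mono_ae hi (R1 H.tpos.le).1
  filter_upwards [ae_ne0] with z hz
  have hz' : 0 < ‖z‖ := norm_pos_iff.2 hz
  by_cases hzt : ‖z‖ < t
  · simp only [cut, mem_Iio, hzt, indicator_of_mem]
    calc _ ≤ 1 * (‖z‖ ^ 2)⁻¹ := by
          gcongr
          · exact ps_le_one _ _
          · exact norm_le_phi z
      _ = _ := one_mul _
  · have := norm_le_phi (δ := δ) z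
    rw [cut, ps_zero H.hh (by linarith [H.hh])]
    simp [hzt]

lemma Wd {δ τ t h d : ℝ} (H : Par δ τ t h) (hd : 0 < d) :
    Integrable (fun z => cut h t (fun s => (s ^ 2 * (d + s))⁻¹) (phi δ z)) ∧
      ∫ z, cut h t (fun s => (s ^ 2 * (d + s))⁻¹) (phi δ z) ≤ S3 * Real.log (1 + t / d) := by
  have hc : ContDiffOn ℝ 1 (fun s : ℝ => (s ^ 2 * (d + s))⁻¹) (Ioi 0) := by
    apply ContDiffOn.inv (by fun_prop)
    intro s hs; have : (0:ℝ) < s := hs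
    positivity
  have hi := int_phi H.hδ (cut_Q1 (t := t) H.hh hc).q0
  refine ⟨hi, ?_⟩
  rw [← (R4 H.tpos.le hd).2]
  apply integral_mono_ae hi (R4 H.tpos.le hd).1
  filter_upwards [ae_ne0] with z hz
  have hz' : 0 < ‖z‖ := norm_pos_iff.2 hz
  have hph := phi_pos H.hδ z
  by_cases hzt : ‖z‖ < t
  · simp only [cut, mem_Iio, hzt, indicator_of_mem]
    calc _ ≤ 1 * (‖z‖ ^ 2 * (d + ‖z‖))⁻¹ := by
          gcongr ?_ * (?_)⁻¹
          · exact ps_le_one _ _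
          · gcongr
            · exact norm_le_phi z
            · exact norm_le_phi z
      _ = _ := one_mul _
  · have := norm_le_phi (δ := δ) z
    rw [cut, ps_zero H.hh (by linarith [H.hh])]
    simp [hzt]

def chiB : ContDiffBump (0:E3) := ⟨1/2, 1, by norm_num, by norm_num⟩
def chi (ξ : E3) : ℝ := chiB.normed volume ξ
lemma chi_contDiff {n : ℕ∞} : ContDiff ℝ n chi := chiB.contDiff_normed
lemma chi_nonneg (ξ : E3) : 0 ≤ chi ξ := chiB.nonneg_normed ξ
lemma chi_int : ∫ ξ, chi ξ = 1 := chiB.integral_normed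
lemma chi_zero {ξ : E3} (h : 1 ≤ ‖ξ‖) : chi ξ = 0 := by
  have : ξ ∉ Function.support chi := by
    unfold chi
    rw [chiB.support_normed_eq]
    simpa [chiB] using h
  simpa using this
lemma chi_integrable : Integrable chi := chiB.integrable_normed

lemma chi_G1 (τ : ℝ) {r : ℝ} (hr : 1 ≤ r) : G1 τ r (fun p => chi p.2.2) :=
  ⟨((chi_contDiff (n := 1)).comp (contDiff_snd.comp contDiff_snd)).contDiffOn,
    fun p hp => chi_zero (by linarith)⟩

lemma PA_co (j l : Fin 3) (p : X6) : PA j (fun p => p.1 l) p = (if l = j then 1 else 0) - p.1 j * p.1 l := by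
  have h : HasFDerivAt (fun p : X6 => p.1 l) ((EuclideanSpace.proj (𝕜 := ℝ) l : E3 →L[ℝ] ℝ).comp
    (ContinuousLinearMap.fst ℝ E3 E3)) p :=
    ((EuclideanSpace.proj (𝕜 := ℝ) l : E3 →L[ℝ] ℝ).comp (ContinuousLinearMap.fst ℝ E3 E3)).hasFDerivAt
  rw [PA, h.fderiv]
  simp [e3_apply]

lemma SU_n2 : SU (fun p => ‖p.1‖ ^ 2) := SU.of ((contDiff_norm_sq ℝ).comp contDiff_fst)

lemma normsq3 (w : E3) : ‖w‖ ^ 2 = ∑ j, w j * w j := by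
  rw [← real_inner_self_eq_norm_sq, inner_sum3]

/-- integration by parts against the radial direction -/
lemma ibp_rad {δ τ t T r : ℝ} (h : Cfg δ τ t T) {q : ℝ → ℝ} (hq : Q1 T q)
    {g : Y3 → ℝ} (hg : G1 τ r g) (x : E3) :
    ∑ l, II δ t x q (fun p => p.1 l) (fun p => fderiv ℝ g p (0, e3 l, 0)) -
      II δ t x q (fun p => ‖p.1‖ ^ 2) (fun p => fderiv ℝ g p (1, 0, 0)) =
    - (II δ t x (fun s => q s / s) (fun p => 3 - ‖p.1‖ ^ 2) g
      + II δ t x (deriv q) (fun p => ‖p.1‖ ^ 2) g) := by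
  have hi1 : ∀ j, Integrable fun p => kerK δ (fun s => q s / s)
      (PA j (fun p => p.1 j)) p * g (Gam δ t x p) := fun j =>
    int_kerG h hq.q0.div (SU_PA j (SU_co j)) hg.g0 x
  have hi2 : ∀ j : Fin 3, Integrable fun p => kerK δ (deriv q)
      (fun p => p.1 j * p.1 j) p * g (Gam δ t x p) := fun j =>
    int_kerG h hq.deriv ((SU_co j).mul (SU_co j)) hg.g0 x
  have hb := fun j => ibp h hq (SU_co j) hg x (e3 j, 0) (by
    simp_rw [fderiv_ker_x h.hδ hq.c (SU_co j), add_mul]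
    exact (hi1 j).add (hi2 j))
  have i3 : ∀ l, Integrable fun p => kerK δ q (fun p => p.1 l) p * fderiv ℝ g (Gam δ t x p) (0, e3 l, 0) :=
    fun l => int_kerG h hq.q0 (SU_co l) (hg.fd continuous_const) x
  have i4 := int_kerG h hq.q0 SU_n2 (hg.fd (c := fun _ => (1, 0, 0)) continuous_const) x
  have e : ∑ l, II δ t x q (fun p => p.1 l) (fun p => fderiv ℝ g p (0, e3 l, 0)) -
      II δ t x q (fun p => ‖p.1‖ ^ 2) (fun p => fderiv ℝ g p (1, 0, 0)) =
      ∑ j, ∫ p, kerK δ q (fun p => p.1 j) p * fderiv ℝ g (Gam δ t x p) (- ⟪om δ p.1, e3 j⟫, e3 j, 0) := by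
    rw [← integral_finsetSum _ fun j _ => (hb j).1]
    unfold II
    rw [← integral_finsetSum _ fun j _ => i3 j, ← integral_sub (integrable_finsetSum _ fun j _ => i3 j) i4]
    congr 1; ext p
    have : ∀ j, ((- ⟪om δ p.1, e3 j⟫, e3 j, 0) : Y3)
          = (0, e3 j, 0) - (om δ p.1 j) • (1, 0, 0) := by intro j; simp [inner_e3]
    simp only [this, map_sub, map_smul, kerK, smul_eq_mul, normsq3, Fin.sum_univ_three]
    ring
  rw [e]
  simp_rw [fun j => (hb j).2, fderiv_ker_x h.hδ hq.c (SU_co _), add_mul]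
  rw [Finset.sum_neg_distrib, ← integral_finsetSum _ fun j _ => (hi1 j).fun_add (hi2 j)]
  unfold II
  rw [← integral_add (int_kerG h hq.q0.div ((SU.of contDiff_const).sub SU_n2) hg.g0 x)
    (int_kerG h hq.deriv SU_n2 hg.g0 x)]
  congr 2; ext p
  simp only [kerK, PA_co, normsq3, Fin.sum_univ_three]
  simp
  ring

lemma II_chi {δ t : ℝ} (x : E3) (q : ℝ → ℝ) (a : E3 → ℝ) :
    II δ t x q (fun p => a p.1) (fun p => chi p.2.2) = ∫ z, q (phi δ z) * a (om δ z) := by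
  unfold II
  simp only [kerK, Gam]
  rw [Measure.volume_eq_prod, integral_prod_mul (fun z => q (phi δ z) * a (om δ z)) chi, chi_int, mul_one]

lemma int_phi_om {δ T : ℝ} (hδ : 0 < δ) {q : ℝ → ℝ} (hq : Q0 T q) {a : E3 → ℝ} (ha : Continuous a) :
    Integrable (fun z => q (phi δ z) * a (om δ z)) := by
  apply Continuous.integrable_of_hasCompactSupport
  · exact (hq.c.comp_continuous (continuous_phi hδ) (fun z => phi_pos hδ z)).mul
      (ha.comp (continuous_om hδ))
  · apply HasCompactSupport.intro (isCompact_closedBall (0:E3) T)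
    intro z hz
    simp only [mem_closedBall, dist_zero_right, not_le] at hz
    rw [hq.z _ (hz.le.trans (norm_le_phi z)), zero_mul]

lemma hasDerivAt_inv_pow (n : ℕ) {s : ℝ} (hs : 0 < s) :
    HasDerivAt (fun s : ℝ => (s ^ n)⁻¹) (- n * (s ^ (n + 1))⁻¹) s := by
  have := (hasDerivAt_pow n s).fun_inv (by positivity)
  refine this.congr_deriv ?_
  cases n with
  | zero => simp
  | succ k => simp; field_simp; ring

lemma Par.big {δ τ t h : ℝ} (H : Par δ τ t h) {z : E3} (hz : deriv (ps h) (t - phi δ z) ≠ 0) :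
    t / 2 ≤ phi δ z ∧ phi δ z < t ∧ t - phi δ z ≤ h ∧ 1 / 2 ≤ ‖om δ z‖ ^ 2 := by
  have h1 : t - phi δ z ≤ h := by
    by_contra hc; exact hz (dps_zero' H.hh (not_le.1 hc).le)
  have h2 : h / 2 < t - phi δ z := by
    by_contra hc; exact hz (dps_zero H.hh (not_lt.1 hc))
  have h3 : t / 2 ≤ phi δ z := by linarith [H.hht]
  have := H.hh
  have ht := H.tpos
  refine ⟨h3, by linarith, h1, ?_⟩
  rw [norm_om_sq H.hδ]
  have : δ ^ 2 / phi δ z ^ 2 ≤ 1 / 2 := by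
    have hp := phi_pos H.hδ z
    rw [div_le_iff₀ (by positivity)]
    nlinarith [H.hδt, H.hδ]
  linarith

lemma We {δ τ t h : ℝ} (H : Par δ τ t h) :
    Integrable (fun z => dcut h t (fun s => (s ^ 1)⁻¹) (phi δ z)) ∧
      ∫ z, dcut h t (fun s => (s ^ 1)⁻¹) (phi δ z) ≤ 6 * S3 * t := by
  have hd0 := dcut_Q0 (t := t) H.hh (inv_pow_contDiffOn 1 (m := 0)).continuousOn
  have hi := int_phi H.hδ hd0
  refine ⟨hi, ?_⟩
  have hq := cut_Q1 (t := t) H.hh (inv_pow_contDiffOn 1)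
  have h0 := ibp_rad H.cfg hq (chi_G1 τ le_rfl) 0
  have hz : ∀ (p : Y3) (d : ℝ × E3), fderiv ℝ (fun p : Y3 => chi p.2.2) p (d.1, d.2, 0) = 0 := by
    intro p d
    have hc : HasFDerivAt chi (fderiv ℝ chi p.2.2) p.2.2 :=
      ((chi_contDiff (n := 1)).differentiable (by simp) _).hasFDerivAt
    have : HasFDerivAt (fun p : Y3 => chi p.2.2) _ p :=
      hc.comp p (f := fun p : Y3 => p.2.2) (hasFDerivAt_snd.comp p hasFDerivAt_snd)
    rw [this.fderiv]; simp
  have z1 : ∀ l, (fun p => fderiv ℝ (fun p : Y3 => chi p.2.2) p (0, e3 l, 0)) = fun _ => 0 := by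
    intro l; ext p; exact hz p (0, e3 l)
  have z2 : (fun p => fderiv ℝ (fun p : Y3 => chi p.2.2) p (1, 0, 0)) = fun _ => 0 := by
    ext p; exact hz p (1, 0)
  simp only [z1, z2] at h0
  rw [II_chi _ _ (fun w => 3 - ‖w‖ ^ 2), II_chi _ _ (fun w => ‖w‖ ^ 2)] at h0
  have e2 : ∀ z, deriv (cut h t fun s => (s ^ 1)⁻¹) (phi δ z) * ‖om δ z‖ ^ 2 =
     - (dcut h t (fun s => (s ^ 1)⁻¹) (phi δ z) * ‖om δ z‖ ^ 2) - cut h t (fun s => (s ^ 2)⁻¹) (phi δ z) * ‖om δ z‖ ^ 2 := by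
    intro z
    rw [cut_deriv (hasDerivAt_inv_pow 1 (phi_pos H.hδ z))]
    simp only [cut]; push_cast; ring
  have e3 : ∀ z, cut h t (fun s => (s ^ 1)⁻¹) (phi δ z) / phi δ z * (3 - ‖om δ z‖ ^ 2) =
      cut h t (fun s => (s ^ 2)⁻¹) (phi δ z) * (3 - ‖om δ z‖ ^ 2) := by
    intro z; have := phi_pos H.hδ z
    simp only [cut]; field_simp
  have hc2 := (cut_Q1 (t := t) H.hh (inv_pow_contDiffOn 2)).q0
  have j1 := int_phi_om H.hδ hc2 (a := fun w => ‖w‖ ^ 2) (by fun_prop)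
  have j2 := int_phi_om H.hδ hc2 (a := fun w => 3 - ‖w‖ ^ 2) (by fun_prop)
  have j3 := int_phi_om H.hδ hd0 (a := fun w => ‖w‖ ^ 2) (by fun_prop)
  simp_rw [e2, e3] at h0
  rw [integral_sub j3.fun_neg j1, integral_neg] at h0
  simp only [II, mul_zero, integral_zero, Finset.sum_const_zero, sub_zero] at h0
  have k1 : 0 ≤ ∫ z, cut h t (fun s => (s ^ 2)⁻¹) (phi δ z) * ‖om δ z‖ ^ 2 :=
    integral_nonneg fun z => mul_nonneg (mul_nonneg (ps_nonneg _ _) (by positivity)) (by positivity)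
  have k2 : ∫ z, cut h t (fun s => (s ^ 2)⁻¹) (phi δ z) * (3 - ‖om δ z‖ ^ 2) ≤ 3 * (S3 * t) := by
    calc _ ≤ ∫ z, 3 * cut h t (fun s => (s ^ 2)⁻¹) (phi δ z) := by
          apply integral_mono j2 ((Wa H).1.const_mul 3)
          intro z
          have : 0 ≤ cut h t (fun s => (s ^ 2)⁻¹) (phi δ z) := mul_nonneg (ps_nonneg _ _) (by positivity)
          simp only
          nlinarith [sq_nonneg ‖om δ z‖]
      _ ≤ _ := by rw [integral_const_mul]; linarith [(Wa H).2]
  have k3 : ∫ z, dcut h t (fun s => (s ^ 1)⁻¹) (phi δ z) ≤ ∫ z, 2 * (dcut h t (fun s => (s ^ 1)⁻¹) (phi δ z) * ‖om δ z‖ ^ 2) := by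
    apply integral_mono hi (j3.const_mul 2)
    intro z
    have hp := phi_pos H.hδ z
    by_cases hz : deriv (ps h) (t - phi δ z) = 0
    · simp [dcut, hz]
    · have := (H.big hz).2.2.2
      have : 0 ≤ dcut h t (fun s => (s ^ 1)⁻¹) (phi δ z) := mul_nonneg (dps_nonneg H.hh _) (by positivity)
      simp only
      nlinarith
  rw [integral_const_mul] at k3
  linarith

lemma Wf {δ τ t h : ℝ} (H : Par δ τ t h) :
    Integrable (fun z => dcut h t (fun s => (s ^ 2)⁻¹) (phi δ z)) ∧
      ∫ z, dcut h t (fun s => (s ^ 2)⁻¹) (phi δ z) ≤ 12 * S3 := by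
  have hd0 := dcut_Q0 (t := t) H.hh (inv_pow_contDiffOn 2 (m := 0)).continuousOn
  have hi := int_phi H.hδ hd0
  refine ⟨hi, ?_⟩
  have ht := H.tpos
  calc _ ≤ ∫ z, 2 / t * dcut h t (fun s => (s ^ 1)⁻¹) (phi δ z) := by
        apply integral_mono hi ((We H).1.const_mul _)
        intro z
        have hp := phi_pos H.hδ z
        by_cases hz : deriv (ps h) (t - phi δ z) = 0
        · simp [dcut, hz]
        · have h1 := (H.big hz).1
          have : (phi δ z ^ 2)⁻¹ ≤ 2 / t * (phi δ z ^ 1)⁻¹ := by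
            rw [pow_one, ← div_eq_mul_inv, div_div, inv_le_comm₀ (by positivity) (by positivity), inv_div]
            nlinarith
          simp only [dcut]
          have := mul_le_mul_of_nonneg_left this (dps_nonneg H.hh (t - phi δ z))
          linarith
    _ ≤ 2 / t * (6 * S3 * t) := by
        rw [integral_const_mul]; gcongr; exact (We H).2
    _ = _ := by field_simp; ring
end

noncomputable section

lemma ibp1 {δ τ t T r : ℝ} (h : Cfg δ τ t T) {q : ℝ → ℝ} (hq : Q1 T q)
    {g : Y3 → ℝ} (hg : G1 τ r g) (x : E3) (l : Fin 3) :
    II δ t x q (fun _ => 1) (fun p => fderiv ℝ g p (0, e3 l, 0)) -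
      II δ t x q (fun p => p.1 l) (fun p => fderiv ℝ g p (1, 0, 0)) =
    - II δ t x (deriv q) (fun p => p.1 l) g := by
  have h1 : SU (fun _ => (1:ℝ)) := SU.of contDiff_const
  have hPA : ∀ p, PA l (fun _ => (1:ℝ)) p = 0 := by intro p; simp [PA]
  have e1 : ∀ p, fderiv ℝ (kerK δ q (fun _ => 1)) p (e3 l, 0) = kerK δ (deriv q) (fun p => p.1 l) p := by
    intro p; rw [fderiv_ker_x h.hδ hq.c h1]; simp [kerK, hPA]
  have hb := ibp h hq h1 hg x (e3 l, 0) (by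
    simp_rw [e1]
    exact int_kerG h hq.deriv (SU_co l) hg.g0 x)
  have i1 := int_kerG h hq.q0 h1 (hg.fd (c := fun _ => (0, e3 l, 0)) continuous_const) x
  have i2 := int_kerG h hq.q0 (SU_co l) (hg.fd (c := fun _ => (1, 0, 0)) continuous_const) x
  unfold II
  simp_rw [← e1]
  rw [← hb.2, ← integral_sub i1 i2]
  congr 1; ext p
  have : ((- ⟪om δ p.1, e3 l⟫, e3 l, 0) : Y3)
        = (0, e3 l, 0) - (om δ p.1 l) • (1, 0, 0) := by simp [inner_e3]
  simp only [this, map_sub, map_smul, kerK, smul_eq_mul]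
  ring

lemma II_two {δ τ t T r : ℝ} (h : Cfg δ τ t T) (x : E3) {q q1 q2 : ℝ → ℝ} {A B1 B2 : X6 → ℝ}
    {g : Y3 → ℝ} (hg : G0 τ r g) (h1 : Q0 T q1) (h2 : Q0 T q2) (hB1 : SU B1) (hB2 : SU B2) (a b : ℝ)
    (he : ∀ s w ξ, 0 < s → q s * A (w, ξ) = a * (q1 s * B1 (w, ξ)) + b * (q2 s * B2 (w, ξ))) :
    II δ t x q A g = a * II δ t x q1 B1 g + b * II δ t x q2 B2 g := by
  unfold II
  rw [← integral_const_mul, ← integral_const_mul, ← integral_add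
    ((int_kerG h h1 hB1 hg x).const_mul a) ((int_kerG h h2 hB2 hg x).const_mul b)]
  congr 1; ext p
  simp only [kerK, he _ _ _ (phi_pos h.hδ p.1)]
  ring

def ip (n : ℕ) (s : ℝ) : ℝ := (s ^ n)⁻¹

structure WavY (τ r : ℝ) (u p : Y3 → ℝ) (q : Fin 3 → Y3 → ℝ) : Prop where
  hu : G1 τ r u
  hp : G1 τ r p
  hq : ∀ l, G1 τ r (q l)
  e1 : ∀ y ∈ Om τ, fderiv ℝ u y (1, 0, 0) = p y
  e2 : ∀ l, ∀ y ∈ Om τ, fderiv ℝ u y (0, e3 l, 0) = q l y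
  e3' : ∀ l, ∀ y ∈ Om τ, fderiv ℝ (q l) y (1, 0, 0) = fderiv ℝ p y (0, e3 l, 0)

lemma cutQ {h t : ℝ} (hh : 0 < h) (n : ℕ) : Q1 (t - h / 2) (cut h t (ip n)) :=
  cut_Q1 hh (inv_pow_contDiffOn n)
lemma dcutQ {h t : ℝ} (hh : 0 < h) (n : ℕ) : Q0 (t - h / 2) (dcut h t (ip n)) :=
  dcut_Q0 hh (inv_pow_contDiffOn n (m := 0)).continuousOn
lemma cut_div {h t s : ℝ} (n : ℕ) : cut h t (ip n) s / s = cut h t (ip (n+1)) s := by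
  simp only [cut, ip, pow_succ, mul_inv, div_eq_mul_inv]; ring
lemma cut_d {h t s : ℝ} (hs : 0 < s) (n : ℕ) : deriv (cut h t (ip n)) s =
    - dcut h t (ip n) s - n * cut h t (ip (n+1)) s := by
  have := cut_deriv (h := h) (t := t) (hasDerivAt_inv_pow n hs)
  unfold ip
  rw [this]; simp only [cut]; ring

def nn (p : X6) : ℝ := 1 - ‖p.1‖ ^ 2
lemma SU_nn : SU nn := (SU.of contDiff_const).sub SU_n2
lemma SU_one : SU (fun _ => 1) := SU.of contDiff_const

lemma kirch {δ τ t h r : ℝ} (H : Par δ τ t h) (x : E3) {u p : Y3 → ℝ} {q : Fin 3 → Y3 → ℝ}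
    (W : WavY τ r u p q) :
    II δ t x (cut h t (ip 1)) (fun _ => 1)
      (fun y => fderiv ℝ p y (1, 0, 0) - ∑ l, fderiv ℝ (q l) y (0, e3 l, 0)) =
    II δ t x (cut h t (ip 1)) nn (fun y => fderiv ℝ p y (1, 0, 0))
    + 3 * II δ t x (cut h t (ip 2)) nn p + 3 * II δ t x (cut h t (ip 3)) nn u
    - (∑ l, II δ t x (dcut h t (ip 1)) (fun y => y.1 l) (q l)
      + II δ t x (dcut h t (ip 1)) (fun y => ‖y.1‖ ^ 2) p
      + II δ t x (dcut h t (ip 2)) (fun y => ‖y.1‖ ^ 2) u) := by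
  have hc := H.cfg
  have Q1' := cutQ (t := t) H.hh 1
  have Q2' := cutQ (t := t) H.hh 2
  have Q3' := cutQ (t := t) H.hh 3
  have D1' := dcutQ (t := t) H.hh 1
  have D2' := dcutQ (t := t) H.hh 2
  have a1 := fun l => ibp1 hc Q1' (W.hq l) x l
  have a2 := ibp_rad hc Q1' W.hp x
  have a3 := ibp_rad hc Q2' W.hu x
  have b1 : ∀ l, II δ t x (cut h t (ip 1)) (fun p => p.1 l) (fun p => fderiv ℝ (q l) p (1, 0, 0))
      = II δ t x (cut h t (ip 1)) (fun p => p.1 l) (fun y => fderiv ℝ p y (0, e3 l, 0)) :=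
    fun l => II_congr hc Q1'.q0 x (W.e3' l)
  have b2 : ∀ l, II δ t x (cut h t (ip 2)) (fun p => p.1 l) (fun p => fderiv ℝ u p (0, e3 l, 0))
      = II δ t x (cut h t (ip 2)) (fun p => p.1 l) (q l) :=
    fun l => II_congr hc Q2'.q0 x (W.e2 l)
  have b3 : II δ t x (cut h t (ip 2)) (fun p => ‖p.1‖ ^ 2) (fun p => fderiv ℝ u p (1, 0, 0))
      = II δ t x (cut h t (ip 2)) (fun p => ‖p.1‖ ^ 2) p :=
    II_congr hc Q2'.q0 x W.e1
  have c1 : ∀ l, II δ t x (deriv (cut h t (ip 1))) (fun p => p.1 l) (q l) =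
      (-1) * II δ t x (dcut h t (ip 1)) (fun p => p.1 l) (q l)
      + (-1) * II δ t x (cut h t (ip 2)) (fun p => p.1 l) (q l) := fun l => by
    apply II_two hc x (W.hq l).g0 D1' Q2'.q0 (SU_co l) (SU_co l)
    intro s w ξ hs; rw [cut_d hs]; push_cast; ring
  have c2 : II δ t x (deriv (cut h t (ip 1))) (fun p => ‖p.1‖ ^ 2) p =
      (-1) * II δ t x (dcut h t (ip 1)) (fun p => ‖p.1‖ ^ 2) p
      + (-1) * II δ t x (cut h t (ip 2)) (fun p => ‖p.1‖ ^ 2) p := by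
    apply II_two hc x W.hp.g0 D1' Q2'.q0 SU_n2 SU_n2
    intro s w ξ hs; rw [cut_d hs]; push_cast; ring
  have c3 : II δ t x (deriv (cut h t (ip 2))) (fun p => ‖p.1‖ ^ 2) u =
      (-1) * II δ t x (dcut h t (ip 2)) (fun p => ‖p.1‖ ^ 2) u
      + (-2) * II δ t x (cut h t (ip 3)) (fun p => ‖p.1‖ ^ 2) u := by
    apply II_two hc x W.hu.g0 D2' Q3'.q0 SU_n2 SU_n2
    intro s w ξ hs; rw [cut_d hs]; push_cast; ring
  have c4 : II δ t x (fun s => cut h t (ip 1) s / s) (fun p => 3 - ‖p.1‖ ^ 2) p =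
      3 * II δ t x (cut h t (ip 2)) nn p + 2 * II δ t x (cut h t (ip 2)) (fun p => ‖p.1‖ ^ 2) p := by
    apply II_two hc x W.hp.g0 Q2'.q0 Q2'.q0 SU_nn SU_n2
    intro s w ξ hs; rw [cut_div]; simp only [nn]; ring
  have c5 : II δ t x (fun s => cut h t (ip 2) s / s) (fun p => 3 - ‖p.1‖ ^ 2) u =
      3 * II δ t x (cut h t (ip 3)) nn u + 2 * II δ t x (cut h t (ip 3)) (fun p => ‖p.1‖ ^ 2) u := by
    apply II_two hc x W.hu.g0 Q3'.q0 Q3'.q0 SU_nn SU_n2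
    intro s w ξ hs; rw [cut_div]; simp only [nn]; ring
  have c6 : II δ t x (cut h t (ip 1)) nn (fun y => fderiv ℝ p y (1, 0, 0)) =
      1 * II δ t x (cut h t (ip 1)) (fun _ => 1) (fun y => fderiv ℝ p y (1, 0, 0))
      + (-1) * II δ t x (cut h t (ip 1)) (fun p => ‖p.1‖ ^ 2) (fun y => fderiv ℝ p y (1, 0, 0)) := by
    apply II_two hc x (W.hp.fd continuous_const) Q1'.q0 Q1'.q0 SU_one SU_n2
    intro s w ξ hs; simp only [nn]; ring
  have c7 : II δ t x (cut h t (ip 1)) (fun _ => 1)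
      (fun y => fderiv ℝ p y (1, 0, 0) - ∑ l, fderiv ℝ (q l) y (0, e3 l, 0)) =
      II δ t x (cut h t (ip 1)) (fun _ => 1) (fun y => fderiv ℝ p y (1, 0, 0))
      - ∑ l, II δ t x (cut h t (ip 1)) (fun _ => 1) (fun y => fderiv ℝ (q l) y (0, e3 l, 0)) := by
    have i1 := int_kerG hc Q1'.q0 SU_one (W.hp.fd (c := fun _ => (1, 0, 0)) continuous_const) x
    have i2 := fun l => int_kerG hc Q1'.q0 SU_one ((W.hq l).fd (c := fun _ => (0, e3 l, 0)) continuous_const) x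
    unfold II
    rw [← integral_finsetSum _ fun l _ => i2 l, ← integral_sub i1 (integrable_finsetSum _ fun l _ => i2 l)]
    congr 1; ext p; rw [mul_sub, Finset.mul_sum]
  have d1 := Finset.sum_congr (rfl : (Finset.univ : Finset (Fin 3)) = Finset.univ) fun l _ => a1 l
  simp only [b1, b2, b3, c1, c2, c3, c4, c5, Fin.sum_univ_three] at a2 a3 d1
  rw [c7, c6]
  simp only [Fin.sum_univ_three]
  linarith
end

noncomputable section

def Om3 (τ : ℝ) : Set (ℝ × E3) := Ioo 0 τ ×ˢ (univ : Set E3)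
def lift (U : ℝ × E3 → ℝ) (p : Y3) : ℝ := U (p.1, p.2.1) * chi p.2.2

lemma isOpen_Om3 (τ : ℝ) : IsOpen (Om3 τ) := isOpen_Ioo.prod isOpen_univ

lemma lift_G1 {τ : ℝ} {U : ℝ × E3 → ℝ} (h : ContDiffOn ℝ 1 U (Om3 τ)) : G1 τ 1 (lift U) := by
  refine ⟨ContDiffOn.mul (h.comp (f := fun p : Y3 => (p.1, p.2.1)) (by fun_prop) ?_) (chi_G1 τ le_rfl).c, fun p hp => ?_⟩
  · intro p hp; exact ⟨hp.1, mem_univ _⟩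
  · rw [lift, chi_zero hp.le, mul_zero]

lemma lift_fd {τ : ℝ} {U : ℝ × E3 → ℝ} (h : ContDiffOn ℝ 1 U (Om3 τ)) {p : Y3} (hp : p ∈ Om τ)
    (d0 : ℝ) (dx : E3) : fderiv ℝ (lift U) p (d0, dx, 0) = fderiv ℝ U (p.1, p.2.1) (d0, dx) * chi p.2.2 := by
  have h1 : HasFDerivAt U (fderiv ℝ U (p.1, p.2.1)) (p.1, p.2.1) :=
    ((h.differentiableOn (by simp)).differentiableAt ((isOpen_Om3 τ).mem_nhds ⟨hp.1, mem_univ _⟩)).hasFDerivAt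
  have hc : HasFDerivAt chi (fderiv ℝ chi p.2.2) p.2.2 :=
      ((chi_contDiff (n := 1)).differentiable (by simp) _).hasFDerivAt
  have h2 : HasFDerivAt (fun p : Y3 => chi p.2.2) _ p :=
      hc.comp p (f := fun p : Y3 => p.2.2) (hasFDerivAt_snd.comp p hasFDerivAt_snd)
  have h3 : HasFDerivAt (fun p : Y3 => U (p.1, p.2.1)) _ p :=
    h1.comp p (f := fun p : Y3 => (p.1, p.2.1)) (hasFDerivAt_fst.prodMk (hasFDerivAt_fst.comp p hasFDerivAt_snd))
  have h4 : HasFDerivAt (lift U) _ p := h3.mul h2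
  rw [h4.fderiv]
  simp [mul_comm]

def JJ (δ t : ℝ) (x : E3) (q : ℝ → ℝ) (a : E3 → ℝ) (U : ℝ × E3 → ℝ) : ℝ :=
  ∫ z, q (phi δ z) * a (om δ z) * U (t - phi δ z, x + z)

lemma II_lift (δ t : ℝ) (x : E3) (q : ℝ → ℝ) (a : E3 → ℝ) (U : ℝ × E3 → ℝ) :
    II δ t x q (fun p => a p.1) (lift U) = JJ δ t x q a U := by
  unfold II JJ
  simp only [kerK, Gam, lift]
  have := integral_prod_mul (μ := (volume : Measure E3)) (ν := (volume : Measure E3))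
    (fun z => q (phi δ z) * a (om δ z) * U (t - phi δ z, x + z)) chi
  rw [chi_int, mul_one] at this
  rw [Measure.volume_eq_prod, ← this]
  congr 1; ext p; ring

structure Wav (τ : ℝ) (U P : ℝ × E3 → ℝ) (Q : Fin 3 → ℝ × E3 → ℝ) : Prop where
  hu : ContDiffOn ℝ 1 U (Om3 τ)
  hp : ContDiffOn ℝ 1 P (Om3 τ)
  hq : ∀ l, ContDiffOn ℝ 1 (Q l) (Om3 τ)
  e1 : ∀ y ∈ Om3 τ, fderiv ℝ U y (1, 0) = P y
  e2 : ∀ l, ∀ y ∈ Om3 τ, fderiv ℝ U y (0, e3 l) = Q l y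
  e3' : ∀ l, ∀ y ∈ Om3 τ, fderiv ℝ (Q l) y (1, 0) = fderiv ℝ P y (0, e3 l)

lemma Wav.lift {τ : ℝ} {U P : ℝ × E3 → ℝ} {Q : Fin 3 → ℝ × E3 → ℝ} (W : Wav τ U P Q) :
    WavY τ 1 (lift U) (lift P) (fun l => lift (Q l)) := by
  have hm : ∀ y : Y3, y ∈ Om τ → (y.1, y.2.1) ∈ Om3 τ := fun y hy => ⟨hy.1, mem_univ _⟩
  refine ⟨lift_G1 W.hu, lift_G1 W.hp, fun l => lift_G1 (W.hq l), ?_, ?_, ?_⟩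
  · intro y hy; rw [lift_fd W.hu hy, W.e1 _ (hm y hy)]; rfl
  · intro l y hy; rw [lift_fd W.hu hy, W.e2 _ _ (hm y hy)]; rfl
  · intro l y hy; rw [lift_fd (W.hq l) hy, lift_fd W.hp hy, W.e3' _ _ (hm y hy)]

def box (P : ℝ × E3 → ℝ) (P' : Fin 3 → ℝ × E3 → ℝ) (y : ℝ × E3) : ℝ :=
  fderiv ℝ P y (1, 0) - ∑ l, fderiv ℝ (P' l) y (0, e3 l)

lemma kirchJ {δ τ t h : ℝ} (H : Par δ τ t h) (x : E3) {U P : ℝ × E3 → ℝ} {Q : Fin 3 → ℝ × E3 → ℝ}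
    (W : Wav τ U P Q) :
    JJ δ t x (cut h t (ip 1)) (fun _ => 1) (box P Q) =
    JJ δ t x (cut h t (ip 1)) (fun w => 1 - ‖w‖ ^ 2) (fun y => fderiv ℝ P y (1, 0))
    + 3 * JJ δ t x (cut h t (ip 2)) (fun w => 1 - ‖w‖ ^ 2) P
    + 3 * JJ δ t x (cut h t (ip 3)) (fun w => 1 - ‖w‖ ^ 2) U
    - (∑ l, JJ δ t x (dcut h t (ip 1)) (fun w => w l) (Q l)
      + JJ δ t x (dcut h t (ip 1)) (fun w => ‖w‖ ^ 2) P
      + JJ δ t x (dcut h t (ip 2)) (fun w => ‖w‖ ^ 2) U) := by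
  have k := kirch H x W.lift
  have hm : ∀ y : Y3, y ∈ Om τ → (y.1, y.2.1) ∈ Om3 τ := fun y hy => ⟨hy.1, mem_univ _⟩
  have Q1' := cutQ (t := t) H.hh 1
  have e1 : II δ t x (cut h t (ip 1)) (fun _ => 1)
      (fun y => fderiv ℝ (lift P) y (1, 0, 0) - ∑ l, fderiv ℝ (lift (Q l)) y (0, e3 l, 0)) =
      II δ t x (cut h t (ip 1)) (fun _ => 1) (lift (box P Q)) := by
    apply II_congr H.cfg Q1'.q0
    intro y hy
    rw [lift_fd W.hp hy]
    simp_rw [lift_fd (W.hq _) hy]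
    simp only [lift, box, sub_mul, Finset.sum_mul]
  have e2 : II δ t x (cut h t (ip 1)) nn (fun y => fderiv ℝ (lift P) y (1, 0, 0)) =
      II δ t x (cut h t (ip 1)) nn (lift (fun y => fderiv ℝ P y (1, 0))) := by
    apply II_congr H.cfg Q1'.q0
    intro y hy
    rw [lift_fd W.hp hy]; rfl
  rw [e1, e2] at k
  have n1 : nn = fun p : X6 => (fun w : E3 => 1 - ‖w‖ ^ 2) p.1 := rfl
  rw [n1] at k
  rw [II_lift _ _ _ _ (fun _ => 1), II_lift _ _ _ _ (fun w : E3 => 1 - ‖w‖ ^ 2), II_lift _ _ _ _ (fun w : E3 => 1 - ‖w‖ ^ 2),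
    II_lift _ _ _ _ (fun w : E3 => 1 - ‖w‖ ^ 2), II_lift _ _ _ _ (fun w : E3 => ‖w‖ ^ 2), II_lift _ _ _ _ (fun w : E3 => ‖w‖ ^ 2)] at k
  simp_rw [fun l : Fin 3 => II_lift δ t x (dcut h t (ip 1)) (fun w : E3 => w l) (Q l)] at k
  exact k

lemma JJ_est {δ t : ℝ} {x : E3} {q : ℝ → ℝ} {a : E3 → ℝ} {U : ℝ × E3 → ℝ} {W : E3 → ℝ}
    (hW : Integrable W) (hb : ∀ z, |q (phi δ z) * a (om δ z) * U (t - phi δ z, x + z)| ≤ W z) :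
    |JJ δ t x q a U| ≤ ∫ z, W z := by
  rw [← Real.norm_eq_abs]
  exact norm_integral_le_of_norm_le hW (Eventually.of_forall hb)

lemma phi_smul {δ : ℝ} (hδ : 0 < δ) (y : E3) : phi δ (δ • y) = δ * phi 1 y := by
  unfold phi
  rw [norm_smul, Real.norm_of_nonneg hδ.le]
  have : δ ^ 2 + (δ * ‖y‖) ^ 2 = δ ^ 2 * (1 ^ 2 + ‖y‖ ^ 2) := by ring
  rw [this, Real.sqrt_mul (by positivity), Real.sqrt_sq hδ.le]

lemma phi5_int : Integrable (fun y : E3 => (phi 1 y ^ 5)⁻¹) := by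
  have := integrable_rpow_neg_one_add_norm_sq (E := E3) (μ := volume) (r := 5) (by simp; norm_num)
  refine this.congr (Eventually.of_forall fun y => ?_)
  simp only [phi]
  have h0 : 0 ≤ 1 + ‖y‖ ^ 2 := by positivity
  rw [one_pow, Real.sqrt_eq_rpow, ← Real.rpow_natCast (_ ^ (1/2:ℝ)), ← Real.rpow_mul h0, ← Real.rpow_neg h0]
  norm_num

def c0 : ℝ := 3 * ∫ y : E3, (phi 1 y ^ 5)⁻¹

lemma c0_pos : 0 < c0 := by
  unfold c0
  have : 0 < ∫ y : E3, (phi 1 y ^ 5)⁻¹ := by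
    rw [integral_pos_iff_support_of_nonneg (fun y => by have := phi_pos one_pos y; positivity) phi5_int]
    have : Function.support (fun y : E3 => (phi 1 y ^ 5)⁻¹) = univ := by
      ext y; have := phi_pos one_pos y; simp [this.ne']
    rw [this]; simp
  linarith

lemma cone_bdd {τ t h : ℝ} (hh : 0 < h) (ht : t < τ) (x : E3) {U : ℝ × E3 → ℝ} (hU : ContinuousOn U (Om3 τ)) :
    ∃ M : ℝ, 0 ≤ M ∧ ∀ s y, h / 2 ≤ s → s ≤ t → ‖y - x‖ ≤ t → |U (s, y)| ≤ M := by
  have hK : IsCompact (Icc (h / 2) t ×ˢ closedBall x t) := isCompact_Icc.prod (isCompact_closedBall _ _)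
  obtain ⟨M, hM⟩ := hK.exists_bound_of_continuousOn (hU.mono (by
    rintro ⟨s, y⟩ ⟨hs, _⟩
    exact ⟨⟨by linarith [hs.1], by linarith [hs.2]⟩, mem_univ _⟩))
  refine ⟨max M 0, le_max_right _ _, fun s y h1 h2 h3 => ?_⟩
  exact (hM (s, y) ⟨⟨h1, h2⟩, by simpa [dist_eq_norm] using h3⟩).trans (le_max_left _ _)

lemma cut_pt {δ t h : ℝ} (hδ : 0 < δ) (hh : 0 < h) (x z : E3) (hz : ps h (t - phi δ z) ≠ 0) :
    h / 2 ≤ t - phi δ z ∧ t - phi δ z ≤ t ∧ ‖x + z - x‖ ≤ t := by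
  have h1 : h / 2 < t - phi δ z := by
    by_contra hc; exact hz (ps_zero hh (not_lt.1 hc))
  have := norm_le_phi (δ := δ) z
  have := phi_pos hδ z
  refine ⟨h1.le, by linarith, ?_⟩
  simp; linarith

lemma cont3 {δ τ t T : ℝ} (h : Cfg δ τ t T) {q : ℝ → ℝ} (hq : Q0 T q) {a : E3 → ℝ}
    (ha : ContDiff ℝ (⊤ : ℕ∞) a) {U : ℝ × E3 → ℝ} (hU : ContinuousOn U (Om3 τ)) (x : E3) :
    Continuous (fun z => q (phi δ z) * a (om δ z) * U (t - phi δ z, x + z)) := by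
  have h1 := cont_kerG h hq (A := fun p => a p.1) (SU.of (ha.comp contDiff_fst))
    (k := fun p => U (p.1, p.2.1)) (hU.comp (f := fun p : Y3 => (p.1, p.2.1)) (by fun_prop) (fun p hp => ⟨hp.1, mem_univ _⟩)) x
  exact h1.comp (g := fun p => _) (f := fun z : E3 => ((z, 0) : X6)) (by fun_prop)

lemma J3_lim {τ t h : ℝ} (hh : 0 < h) (hht : h ≤ t / 2) (ht : t < τ) (x : E3) {U : ℝ × E3 → ℝ}
    (hU : ContinuousOn U (Om3 τ)) :
    Tendsto (fun δ => 3 * JJ δ t x (cut h t (ip 3)) (fun w => 1 - ‖w‖ ^ 2) U) (𝓝[>] 0) (𝓝 (c0 * U (t, x))) := by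
  obtain ⟨M, hM0, hM⟩ := cone_bdd hh ht x hU
  have hev : ∀ᶠ δ in 𝓝[>] (0:ℝ), 0 < δ := self_mem_nhdsWithin
  have key : ∀ δ : ℝ, 0 < δ → JJ δ t x (cut h t (ip 3)) (fun w => 1 - ‖w‖ ^ 2) U =
      ∫ y, ps h (t - δ * phi 1 y) * (phi 1 y ^ 5)⁻¹ * U (t - δ * phi 1 y, x + δ • y) := by
    intro δ hδ
    have := Measure.integral_comp_smul (μ := (volume : Measure E3))
      (fun z => cut h t (ip 3) (phi δ z) * (1 - ‖om δ z‖ ^ 2) * U (t - phi δ z, x + z)) δ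
    have e2 : JJ δ t x (cut h t (ip 3)) (fun w => 1 - ‖w‖ ^ 2) U = δ ^ 3 * ∫ y,
        (fun z => cut h t (ip 3) (phi δ z) * (1 - ‖om δ z‖ ^ 2) * U (t - phi δ z, x + z)) (δ • y) := by
      rw [this]
      simp only [finrank_euclideanSpace, Fintype.card_fin, smul_eq_mul, JJ]
      rw [abs_of_pos (by positivity)]
      field_simp
    rw [e2, ← integral_const_mul]
    congr 1; ext y
    have hp := phi_pos one_pos y
    simp only [norm_om_sq hδ, phi_smul hδ, cut, ip]
    field_simp
    ring
  have hlim : Tendsto (fun δ : ℝ => ∫ y, ps h (t - δ * phi 1 y) * (phi 1 y ^ 5)⁻¹ * U (t - δ * phi 1 y, x + δ • y))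
      (𝓝[>] 0) (𝓝 (∫ y : E3, 1 * (phi 1 y ^ 5)⁻¹ * U (t, x))) := by
    apply tendsto_integral_filter_of_dominated_convergence (fun y => (phi 1 y ^ 5)⁻¹ * M)
    · filter_upwards [hev] with δ hδ
      have hcfg : Cfg δ τ t (t - h / 2) := ⟨hδ, by linarith, ht⟩
      have hc := cont3 hcfg (cutQ (t := t) hh 3).q0 (a := fun w => 1 - ‖w‖ ^ 2)
        (contDiff_const.sub (contDiff_norm_sq ℝ)) hU x
      have hc2 : Continuous fun y : E3 => δ ^ 3 * (cut h t (ip 3) (phi δ (δ • y)) * (1 - ‖om δ (δ • y)‖ ^ 2) * U (t - phi δ (δ • y), x + δ • y)) :=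
        continuous_const.mul (hc.comp (f := fun y : E3 => δ • y) (by fun_prop))
      refine (hc2.congr fun y => ?_).aestronglyMeasurable
      have hp := phi_pos one_pos y
      simp only [norm_om_sq hδ, phi_smul hδ, cut, ip]
      field_simp
      ring
    · filter_upwards [hev] with δ hδ
      refine Eventually.of_forall fun y => ?_
      have hp := phi_pos one_pos y
      by_cases hz : ps h (t - phi δ (δ • y)) = 0
      · rw [phi_smul hδ] at hz
        rw [hz]; simp; positivity
      · obtain ⟨a1, a2, a3⟩ := cut_pt hδ hh x (δ • y) hz
        have := hM _ _ a1 a2 a3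
        rw [phi_smul hδ] at this
        rw [norm_mul, norm_mul, Real.norm_of_nonneg (ps_nonneg _ _), Real.norm_of_nonneg (by positivity), Real.norm_eq_abs]
        calc _ ≤ 1 * (phi 1 y ^ 5)⁻¹ * M := by
              gcongr; exact ps_le_one _ _
          _ = _ := by ring
    · exact phi5_int.mul_const M
    · refine Eventually.of_forall fun y => ?_
      have h0 : Tendsto (fun δ : ℝ => t - δ * phi 1 y) (𝓝[>] 0) (𝓝 t) := by
        have : Continuous (fun δ : ℝ => t - δ * phi 1 y) := by fun_prop
        simpa using (this.tendsto 0).mono_left nhdsWithin_le_nhds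
      have h1 : Tendsto (fun δ : ℝ => x + δ • y) (𝓝[>] 0) (𝓝 x) := by
        have : Continuous (fun δ : ℝ => x + δ • y) := by fun_prop
        simpa using (this.tendsto 0).mono_left nhdsWithin_le_nhds
      refine Tendsto.mul (Tendsto.mul ?_ tendsto_const_nhds) ?_
      · have : Tendsto (ps h) (𝓝 t) (𝓝 (ps h t)) := (ps_contDiff h (n := 0)).continuous.tendsto t
        rw [ps_one hh (by linarith)] at this
        exact this.comp h0
      · have : ContinuousAt U (t, x) := hU.continuousAt ((isOpen_Om3 τ).mem_nhds ⟨⟨by linarith, ht⟩, mem_univ _⟩)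
        exact this.tendsto.comp (h0.prodMk_nhds h1)
  have e : c0 * U (t, x) = 3 * ∫ y : E3, 1 * (phi 1 y ^ 5)⁻¹ * U (t, x) := by
    rw [c0, integral_mul_const]; simp; ring
  rw [e]
  apply (hlim.const_mul 3).congr'
  filter_upwards [hev] with δ hδ
  rw [key δ hδ]

lemma dlog_lim {t : ℝ} (ht : 0 < t) : Tendsto (fun δ : ℝ => δ * Real.log (1 + t / δ)) (𝓝[>] 0) (𝓝 0) := by
  have h1 : Tendsto (fun δ : ℝ => δ * Real.log (δ + t)) (𝓝[>] 0) (𝓝 0) := by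
    have : ContinuousAt (fun δ : ℝ => δ * Real.log (δ + t)) 0 :=
      continuousAt_id.mul (ContinuousAt.log (by fun_prop) (by simpa using ht.ne'))
    simpa using this.tendsto.mono_left nhdsWithin_le_nhds
  have h2 : Tendsto (fun δ : ℝ => δ * Real.log δ) (𝓝[>] 0) (𝓝 0) := by
    simpa using (Real.continuous_mul_log.tendsto 0).mono_left nhdsWithin_le_nhds
  have h3 := h1.sub h2
  rw [sub_zero] at h3
  apply h3.congr'
  filter_upwards [self_mem_nhdsWithin] with δ hδ
  have hδ' : 0 < δ := hδ
  have : 1 + t / δ = (δ + t) / δ := by field_simp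
  rw [this, Real.log_div (by positivity) hδ'.ne']
  ring

lemma kirch_bound {τ t h D Bd : ℝ} (hh : 0 < h) (hht : h ≤ t / 2) (ht : t < τ) (x : E3)
    {U P : ℝ × E3 → ℝ} {Q : Fin 3 → ℝ × E3 → ℝ} (W : Wav τ U P Q) (hD : 0 ≤ D)
    (hUD : ∀ s y, 0 < s → s ≤ h → ‖y - x‖ ≤ t → |U (s, y)| ≤ D)
    (hPD : ∀ s y, 0 < s → s ≤ h → ‖y - x‖ ≤ t → |P (s, y)| ≤ D)
    (hQD : ∀ l, ∀ s y, 0 < s → s ≤ h → ‖y - x‖ ≤ t → |Q l (s, y)| ≤ D)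
    (hB : ∀ δ, Par δ τ t h → |JJ δ t x (cut h t (ip 1)) (fun _ => 1) (box P Q)| ≤ Bd) :
    c0 * |U (t, x)| ≤ Bd + D * S3 * (24 * t + 12) := by
  have ht0 : 0 < t := by linarith
  obtain ⟨M1, hM10, hM1⟩ := cone_bdd hh ht x W.hp.continuousOn
  obtain ⟨M2, hM20, hM2⟩ := cone_bdd hh ht x
    ((W.hp.continuousOn_fderiv_of_isOpen (isOpen_Om3 τ) (by simp)).clm_apply (continuousOn_const (c := ((1, 0) : ℝ × E3))))
  have hev : ∀ᶠ δ in 𝓝[>] (0:ℝ), |3 * JJ δ t x (cut h t (ip 3)) (fun w => 1 - ‖w‖ ^ 2) U| ≤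
      Bd + D * S3 * (24 * t + 12) + (M2 * S3 * t) * δ + 6 * M1 * S3 * (δ * Real.log (1 + t / δ)) := by
    filter_upwards [Ioc_mem_nhdsGT (show (0:ℝ) < t / 4 by linarith)] with δ hδ
    have H : Par δ τ t h := ⟨hδ.1, hδ.2, hh, hht, ht⟩
    have k := kirchJ H x W
    have hon : ∀ z, ‖om δ z‖ ≤ 1 := fun z => (norm_om_lt H.hδ z).le
    have hon2 : ∀ z, ‖om δ z‖ ^ 2 ≤ 1 := fun z => by
      have := hon z; have := norm_nonneg (om δ z); nlinarith
    have hdc : ∀ n z, 0 ≤ dcut h t (ip n) (phi δ z) := fun n z => by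
      have := phi_pos H.hδ z
      exact mul_nonneg (dps_nonneg hh _) (by unfold ip; positivity)
    -- boundary terms
    have bnd : ∀ (n : ℕ) (a : E3 → ℝ) (V : ℝ × E3 → ℝ), (∀ z, |a (om δ z)| ≤ 1) →
        (∀ s y, 0 < s → s ≤ h → ‖y - x‖ ≤ t → |V (s, y)| ≤ D) → ∀ z,
        |dcut h t (ip n) (phi δ z) * a (om δ z) * V (t - phi δ z, x + z)| ≤ D * dcut h t (ip n) (phi δ z) := by
      intro n a V ha hV z
      by_cases hz : deriv (ps h) (t - phi δ z) = 0
      · simp [dcut, hz]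
      · obtain ⟨_, b2, b3, _⟩ := H.big hz
        have hv := hV (t - phi δ z) (x + z) (by linarith) b3 (by
          have := norm_le_phi (δ := δ) z
          simp; linarith)
        rw [abs_mul, abs_mul, abs_of_nonneg (hdc n z)]
        calc _ ≤ dcut h t (ip n) (phi δ z) * 1 * D := by
              gcongr
              · exact mul_nonneg (hdc n z) zero_le_one
              · exact hdc n z
              · exact ha z
          _ = _ := by ring
    have t1 : ∀ l : Fin 3, |JJ δ t x (dcut h t (ip 1)) (fun w => w l) (Q l)| ≤ D * (6 * S3 * t) := fun l => by
      refine (JJ_est ((We H).1.const_mul D) (bnd 1 (fun w => w l) (Q l) (fun z => ?_) (hQD l))).trans ?_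
      · exact (PiLp.norm_apply_le (om δ z) l).trans (hon z)
      · rw [integral_const_mul]; exact mul_le_mul_of_nonneg_left (We H).2 hD
    have t2 : |JJ δ t x (dcut h t (ip 1)) (fun w => ‖w‖ ^ 2) P| ≤ D * (6 * S3 * t) := by
      refine (JJ_est ((We H).1.const_mul D) (bnd 1 (fun w => ‖w‖ ^ 2) P (fun z => ?_) hPD)).trans ?_
      · rw [abs_of_nonneg (by positivity)]; exact hon2 z
      · rw [integral_const_mul]; exact mul_le_mul_of_nonneg_left (We H).2 hD
    have t3 : |JJ δ t x (dcut h t (ip 2)) (fun w => ‖w‖ ^ 2) U| ≤ D * (12 * S3) := by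
      refine (JJ_est ((Wf H).1.const_mul D) (bnd 2 (fun w => ‖w‖ ^ 2) U (fun z => ?_) hUD)).trans ?_
      · rw [abs_of_nonneg (by positivity)]; exact hon2 z
      · rw [integral_const_mul]; exact mul_le_mul_of_nonneg_left (Wf H).2 hD
    have t4 : |JJ δ t x (cut h t (ip 1)) (fun w => 1 - ‖w‖ ^ 2) (fun y => fderiv ℝ P y (1, 0))| ≤ M2 * δ * (S3 * t) := by
      refine (JJ_est ((Wa H).1.const_mul (M2 * δ)) (fun z => ?_)).trans ?_
      · by_cases hz : ps h (t - phi δ z) = 0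
        · simp [cut, hz]
        · obtain ⟨a1, a2, a3⟩ := cut_pt H.hδ hh x z hz
          have hv := hM2 _ _ a1 a2 a3
          have hp := phi_pos H.hδ z
          have h1 : (phi δ z)⁻¹ * (δ ^ 2 / phi δ z ^ 2) ≤ δ * (phi δ z ^ 2)⁻¹ := by
            have : δ * (phi δ z)⁻¹ ≤ 1 := by rw [← div_eq_mul_inv, div_le_one hp]; exact le_phi z
            have e : (phi δ z)⁻¹ * (δ ^ 2 / phi δ z ^ 2) = (δ * (phi δ z)⁻¹) * (δ * (phi δ z ^ 2)⁻¹) := by ring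
            rw [e]
            have h0 : 0 ≤ δ * (phi δ z ^ 2)⁻¹ := by have := H.hδ; positivity
            nlinarith
          simp only [norm_om_sq H.hδ, cut, ip, sub_sub_cancel, pow_one]
          rw [abs_mul, abs_of_nonneg (a := _ * _) (mul_nonneg (mul_nonneg (ps_nonneg _ _) (by positivity)) (by positivity)), mul_assoc (ps h _)]
          calc _ ≤ ps h (t - phi δ z) * (δ * (phi δ z ^ 2)⁻¹) * M2 := by
                gcongr
                · exact mul_nonneg (ps_nonneg _ _) (by have := H.hδ; positivity)
                · exact ps_nonneg _ _
            _ = _ := by ring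
      · rw [integral_const_mul]; exact mul_le_mul_of_nonneg_left (Wa H).2 (mul_nonneg hM20 H.hδ.le)
    have t5 : |JJ δ t x (cut h t (ip 2)) (fun w => 1 - ‖w‖ ^ 2) P| ≤ M1 * (2 * δ) * (S3 * Real.log (1 + t / δ)) := by
      refine (JJ_est ((Wd H H.hδ).1.const_mul (M1 * (2 * δ))) (fun z => ?_)).trans ?_
      · by_cases hz : ps h (t - phi δ z) = 0
        · simp [cut, hz]
        · obtain ⟨a1, a2, a3⟩ := cut_pt H.hδ hh x z hz
          have hv := hM1 _ _ a1 a2 a3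
          have hp := phi_pos H.hδ z
          have hd := H.hδ
          have h1 : (phi δ z ^ 2)⁻¹ * (δ ^ 2 / phi δ z ^ 2) ≤ 2 * δ * (phi δ z ^ 2 * (δ + phi δ z))⁻¹ := by
            have hl := le_phi (δ := δ) z
            rw [← div_eq_inv_mul, ← div_eq_mul_inv, div_div, div_le_div_iff₀ (by positivity) (by positivity)]
            have : δ ^ 2 * (δ + phi δ z) ≤ 2 * δ * phi δ z ^ 2 := by nlinarith [mul_nonneg hd.le (sub_nonneg.2 hl)]
            have hp2 : 0 < phi δ z ^ 2 := by positivity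
            nlinarith
          simp only [norm_om_sq H.hδ, cut, ip, sub_sub_cancel]
          rw [abs_mul, abs_of_nonneg (a := _ * _) (mul_nonneg (mul_nonneg (ps_nonneg _ _) (by positivity)) (by positivity)), mul_assoc (ps h _)]
          calc _ ≤ ps h (t - phi δ z) * (2 * δ * (phi δ z ^ 2 * (δ + phi δ z))⁻¹) * M1 := by
                gcongr
                · exact mul_nonneg (ps_nonneg _ _) (by positivity)
                · exact ps_nonneg _ _
            _ = _ := by ring
      · rw [integral_const_mul]; exact mul_le_mul_of_nonneg_left (Wd H H.hδ).2 (mul_nonneg hM10 (by linarith [H.hδ]))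
    have t6 := hB δ H
    have t10 := t1 0
    have t11 := t1 1
    have t12 := t1 2
    simp only [Fin.sum_univ_three] at k
    rw [abs_le] at *
    constructor <;> nlinarith
  have hl := (J3_lim hh hht ht x W.hu.continuousOn).abs
  have hr : Tendsto (fun δ : ℝ => Bd + D * S3 * (24 * t + 12) + (M2 * S3 * t) * δ + 6 * M1 * S3 * (δ * Real.log (1 + t / δ)))
      (𝓝[>] 0) (𝓝 (Bd + D * S3 * (24 * t + 12) + (M2 * S3 * t) * 0 + 6 * M1 * S3 * 0)) := by
    refine Tendsto.add (Tendsto.add tendsto_const_nhds (Tendsto.const_mul _ ?_)) ((dlog_lim ht0).const_mul _)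
    exact tendsto_id.mono_left nhdsWithin_le_nhds
  have := le_of_tendsto_of_tendsto hl hr hev
  rw [abs_mul, abs_of_pos c0_pos] at this
  linarith
end

noncomputable section


lemma PI_cont {V : Type*} [NormedAddCommGroup V] [NormedSpace ℝ V] {Ω : Set Y3} {F : Y3 → V} (hF : ContinuousOn F Ω)
    {k : E3 → ℝ} (hk : Continuous k) (hks : HasCompactSupport k) {S : Y3 → E3 → Y3}
    (hS : Continuous fun q : Y3 × E3 => S q.1 q.2) (hSm : ∀ p ∈ Ω, ∀ w, S p w ∈ Ω) :
    ContinuousOn (fun p => ∫ w, k w • F (S p w)) Ω := by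
  refine continuousOn_integral_of_compact_support (k := tsupport k) hks ?_ ?_
  · refine ContinuousOn.smul (hk.comp continuous_snd).continuousOn
      (hF.comp (f := fun q : Y3 × E3 => S q.1 q.2) hS.continuousOn ?_)
    intro q hq; exact hSm _ hq.1 _
  · intro p x _ hx
    rw [image_eq_zero_of_notMem_tsupport hx, zero_smul]

lemma PI_intg {V : Type*} [NormedAddCommGroup V] [NormedSpace ℝ V] {Ω : Set Y3} {F : Y3 → V} (hF : ContinuousOn F Ω)
    {k : E3 → ℝ} (hk : Continuous k) (hks : HasCompactSupport k) {S : E3 → Y3}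
    (hS : Continuous S) (hSm : ∀ w, S w ∈ Ω) :
    Continuous (fun w => k w • F (S w)) ∧ Integrable (fun w => k w • F (S w)) := by
  have hc : Continuous (fun w => k w • F (S w)) := hk.smul (hF.comp_continuous hS hSm)
  exact ⟨hc, hc.integrable_of_hasCompactSupport hks.smul_right⟩

lemma PI_deriv {Ω : Set Y3} (hΩ : IsOpen Ω) {F : Y3 → ℝ} (hF : ContDiffOn ℝ 1 F Ω)
    {k : E3 → ℝ} (hk : Continuous k) (hks : HasCompactSupport k) {L : Y3 →L[ℝ] Y3} {m : E3 → Y3}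
    (hm : Continuous m) (hSm : ∀ p ∈ Ω, ∀ w, L p + m w ∈ Ω) :
    (∀ p ∈ Ω, HasFDerivAt (fun p => ∫ w, k w * F (L p + m w))
      (∫ w, k w • (fderiv ℝ F (L p + m w)).comp L) p) ∧
    ContDiffOn ℝ 1 (fun p => ∫ w, k w * F (L p + m w)) Ω := by
  have hS : Continuous fun q : Y3 × E3 => L q.1 + m q.2 := by fun_prop
  have hF' : ContinuousOn (fun p => (fderiv ℝ F p).comp L) Ω :=
    (hF.continuousOn_fderiv_of_isOpen hΩ (by simp)).clm_comp continuousOn_const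
  have key : ∀ p ∈ Ω, HasFDerivAt (fun p => ∫ w, k w * F (L p + m w))
      (∫ w, k w • (fderiv ℝ F (L p + m w)).comp L) p := by
    intro p hp
    obtain ⟨ρ, hρ, hb⟩ := Metric.isOpen_iff.1 hΩ p hp
    have hcb : closedBall p (ρ/2) ⊆ Ω := (closedBall_subset_ball (by linarith)).trans hb
    obtain ⟨C, hC⟩ := ((isCompact_closedBall p (ρ/2)).prod hks.isCompact).exists_bound_of_continuousOn
      (f := fun q : Y3 × E3 => k q.2 • (fderiv ℝ F (L q.1 + m q.2)).comp L)
      (ContinuousOn.smul (hk.comp continuous_snd).continuousOn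
      (hF'.comp (f := fun q : Y3 × E3 => L q.1 + m q.2) hS.continuousOn (fun q hq => hSm _ (hcb hq.1) _)))
    refine hasFDerivAt_integral_of_dominated_of_fderiv_le (𝕜 := ℝ) (F := fun p w => k w * F (L p + m w))
      (F' := fun p w => k w • (fderiv ℝ F (L p + m w)).comp L) (s := closedBall p (ρ/2))
      (bound := (tsupport k).indicator fun _ => C) (closedBall_mem_nhds p (by linarith)) ?_ ?_ ?_ ?_ ?_ ?_
    · filter_upwards [hΩ.mem_nhds hp] with y hy
      exact (PI_intg hF.continuousOn hk hks (S := fun w => L y + m w) (by fun_prop) (hSm y hy)).1.aestronglyMeasurable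
    · exact (PI_intg hF.continuousOn hk hks (S := fun w => L p + m w) (by fun_prop) (hSm p hp)).2
    · exact (PI_intg hF' hk hks (S := fun w => L p + m w) (by fun_prop) (hSm p hp)).1.aestronglyMeasurable
    · refine Eventually.of_forall fun w y hy => ?_
      by_cases hw : w ∈ tsupport k
      · rw [indicator_of_mem hw]; exact hC (y, w) ⟨hy, hw⟩
      · rw [indicator_of_notMem hw, image_eq_zero_of_notMem_tsupport hw]; simp
    · rw [integrable_indicator_iff (isClosed_tsupport k).measurableSet]
      exact integrableOn_const hks.isCompact.measure_lt_top.ne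
    · refine Eventually.of_forall fun w y hy => ?_
      have h1 : HasFDerivAt F (fderiv ℝ F (L y + m w)) (L y + m w) :=
        ((hF.differentiableOn (by simp)).differentiableAt (hΩ.mem_nhds (hSm y (hcb hy) w))).hasFDerivAt
      exact (h1.comp y (f := fun y => L y + m w) (L.hasFDerivAt.add_const (m w))).const_mul (k w)
  refine ⟨key, ?_⟩
  rw [show (1 : WithTop ℕ∞) = 0 + 1 from rfl, contDiffOn_succ_iff_fderiv_of_isOpen hΩ]
  refine ⟨fun p hp => (key p hp).differentiableAt.differentiableWithinAt, by simp, ?_⟩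
  rw [contDiffOn_zero]
  exact (PI_cont hF' hk hks hS hSm).congr fun p hp => (key p hp).fderiv

def cx (k : E3 → ℝ) (V : E3 → ℝ) (x : E3) : ℝ := ∫ y, k y * V (x - y)
def cv (k : E3 → ℝ) (F : Y3 → ℝ) (p : Y3) : ℝ := cx k (fun x => F (p.1, x, p.2.2)) p.2.1
def mom (m : E3 → ℝ) (F : Y3 → ℝ) (p : Y3) : ℝ := ∫ ξ, m ξ * F (p.1, p.2.1, ξ)
def dk (e : E3) (k : E3 → ℝ) (y : E3) : ℝ := fderiv ℝ k y e

structure KC (k : E3 → ℝ) : Prop where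
  c : ContDiff ℝ (⊤ : ℕ∞) k
  s : HasCompactSupport k

lemma KC.dk {k : E3 → ℝ} (h : KC k) (e : E3) : KC (dk e k) :=
  ⟨(h.c.fderiv_right (m := (⊤ : ℕ∞)) (by simp)).clm_apply contDiff_const, (h.s.fderiv_apply (𝕜 := ℝ) e)⟩

lemma dk_comm {k : E3 → ℝ} (h : KC k) (a b : E3) : dk a (dk b k) = dk b (dk a k) := by
  ext y
  have hs : IsSymmSndFDerivAt ℝ k y := (h.c.contDiffAt).isSymmSndFDerivAt (by simpa using (by exact_mod_cast le_top : ((2 : ℕ∞) : WithTop ℕ∞) ≤ ((⊤ : ℕ∞) : WithTop ℕ∞)))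
  have hd : DifferentiableAt ℝ (fderiv ℝ k) y :=
    ((h.c.fderiv_right (m := (⊤ : ℕ∞)) (by simp)).differentiable (by simp)) y
  have : ∀ a b, dk a (dk b k) y = fderiv ℝ (fderiv ℝ k) y a b := by
    intro a b
    unfold dk
    rw [fderiv_clm_apply hd (by fun_prop)]
    simp
  rw [this, this]; exact hs a b

def cL : Y3 →L[ℝ] Y3 := ContinuousLinearMap.id ℝ Y3
def mL : Y3 →L[ℝ] Y3 := (ContinuousLinearMap.fst ℝ ℝ X6).prod
  (((ContinuousLinearMap.fst ℝ E3 E3).comp (ContinuousLinearMap.snd ℝ ℝ X6)).prod 0)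

lemma cv_eq (k : E3 → ℝ) (F : Y3 → ℝ) : cv k F = fun p => ∫ w, k w * F (cL p + (0, -w, 0)) := by
  ext p; unfold cv cx
  congr 1; ext y; simp [cL, sub_eq_add_neg]
  left; congr 1; ext <;> simp

lemma mom_eq (k : E3 → ℝ) (F : Y3 → ℝ) : mom k F = fun p => ∫ w, k w * F (mL p + (0, 0, w)) := by
  ext p; unfold mom
  congr 1; ext y; simp [mL]

def Omc (τ : ℝ) : Set Y3 := Ico 0 τ ×ˢ (univ : Set X6)
def OK (Ω : Set Y3) : Prop := ∃ I : Set ℝ, Ω = I ×ˢ (univ : Set X6)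
lemma OK_Om (τ : ℝ) : OK (Om τ) := ⟨_, rfl⟩
lemma OK_Omc (τ : ℝ) : OK (Omc τ) := ⟨_, rfl⟩
lemma OK.m {Ω : Set Y3} (h : OK Ω) {p q : Y3} (hp : p ∈ Ω) (e : p.1 = q.1) : q ∈ Ω := by
  obtain ⟨I, rfl⟩ := h
  exact ⟨e ▸ hp.1, mem_univ _⟩

lemma cv_cont {Ω : Set Y3} (hΩ : OK Ω) {k : E3 → ℝ} (hk : KC k) {F : Y3 → ℝ} (hF : ContinuousOn F Ω) :
    ContinuousOn (cv k F) Ω := by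
  rw [cv_eq]
  exact PI_cont hF hk.c.continuous hk.s (S := fun p w => cL p + (0, -w, 0)) (by fun_prop)
    (fun p hp w => hΩ.m hp (by simp [cL]))

lemma cv_int {Ω : Set Y3} (hΩ : OK Ω) {k : E3 → ℝ} (hk : KC k) {F : Y3 → ℝ} (hF : ContinuousOn F Ω) {p : Y3} (hp : p ∈ Ω) :
    Integrable fun y => k y * F (p.1, p.2.1 - y, p.2.2) :=
  (PI_intg hF hk.c.continuous hk.s (S := fun w => (p.1, p.2.1 - w, p.2.2)) (by fun_prop)
    (fun w => hΩ.m hp rfl)).2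

lemma cv_C1 {τ : ℝ} {k : E3 → ℝ} (hk : KC k) {F : Y3 → ℝ} (hF : ContDiffOn ℝ 1 F (Om τ)) :
    ContDiffOn ℝ 1 (cv k F) (Om τ) := by
  rw [cv_eq]
  exact (PI_deriv (isOpen_Om τ) hF hk.c.continuous hk.s (L := cL) (m := fun w => (0, -w, 0)) (by fun_prop)
    (fun p hp w => (OK_Om τ).m hp (by simp [cL]))).2

lemma cv_fd {τ : ℝ} {k : E3 → ℝ} (hk : KC k) {F : Y3 → ℝ} (hF : ContDiffOn ℝ 1 F (Om τ)) {p : Y3} (hp : p ∈ Om τ)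
    (d : Y3) : fderiv ℝ (cv k F) p d = cv k (fun q => fderiv ℝ F q d) p := by
  have hm : ∀ p ∈ Om τ, ∀ w : E3, cL p + (0, -w, 0) ∈ Om τ := fun p hp w => (OK_Om τ).m hp (by simp [cL])
  rw [cv_eq, cv_eq, ((PI_deriv (isOpen_Om τ) hF hk.c.continuous hk.s (L := cL) (m := fun w => (0, -w, 0)) (by fun_prop)
    hm).1 p hp).fderiv]
  rw [ContinuousLinearMap.integral_apply]
  · simp [cL]
  · exact (PI_intg (F := fun p => (fderiv ℝ F p).comp cL) (Ω := Om τ)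
      ((hF.continuousOn_fderiv_of_isOpen (isOpen_Om τ) (by simp)).clm_comp continuousOn_const)
      hk.c.continuous hk.s (S := fun w => cL p + (0, -w, 0)) (by fun_prop) (hm p hp)).2

lemma cx_dk {k : E3 → ℝ} (hk : KC k) {V : E3 → ℝ} (hV : ContDiff ℝ 1 V) (e x : E3) :
    cx (dk e k) V x = cx k (fun y => fderiv ℝ V y e) x := by
  unfold cx
  have hd : ∀ y, HasFDerivAt (fun y => V (x - y)) (-(fderiv ℝ V (x - y))) y := by
    intro y
    have := ((hV.differentiable (by simp)) (x - y)).hasFDerivAt.comp y (f := fun y => x - y) ((hasFDerivAt_id y).const_sub x)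
    have e : (fderiv ℝ V (x - y)).comp (-(ContinuousLinearMap.id ℝ E3)) = -(fderiv ℝ V (x - y)) := by ext; simp
    rw [e] at this
    exact this
  have hf : ∀ y, fderiv ℝ (fun y => V (x - y)) y e = - fderiv ℝ V (x - y) e := by
    intro y; rw [(hd y).fderiv]; simp
  have hVc := hV.continuous
  have hkc := hk.c.continuous
  have hV' : Continuous fun y => fderiv ℝ V y e := (hV.continuous_fderiv (by simp)).clm_apply continuous_const
  have hk' := (hk.dk e)
  have h := integral_mul_fderiv_eq_neg_fderiv_mul_of_integrable (μ := (volume : Measure E3)) (f := k) (g := fun y => V (x - y)) (v := e)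
    (Continuous.integrable_of_hasCompactSupport (hk'.c.continuous.mul (by fun_prop)) hk'.s.mul_right)
    (by simp_rw [hf]; exact (Continuous.integrable_of_hasCompactSupport (hkc.mul (by fun_prop)) hk.s.mul_right))
    (Continuous.integrable_of_hasCompactSupport (hkc.mul (by fun_prop)) hk.s.mul_right)
    (fun y _ => hk.c.differentiable (by simp) y) (fun y _ => (hd y).differentiableAt)
  simp_rw [hf, mul_neg, integral_neg] at h
  simp only [dk]
  linarith

lemma slice_fd {τ : ℝ} {F : Y3 → ℝ} (hF : ContDiffOn ℝ 1 F (Om τ)) {p : Y3} (hp : p ∈ Om τ) :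
    ContDiff ℝ 1 (fun x => F (p.1, x, p.2.2)) ∧
    ∀ x e, fderiv ℝ (fun x => F (p.1, x, p.2.2)) x e = fderiv ℝ F (p.1, x, p.2.2) (0, e, 0) := by
  have hm : ∀ x : E3, ((p.1, x, p.2.2) : Y3) ∈ Om τ := fun x => (OK_Om τ).m hp rfl
  constructor
  · rw [← contDiffOn_univ]
    exact hF.comp (f := fun x : E3 => ((p.1, x, p.2.2) : Y3)) (by fun_prop) (fun x _ => hm x)
  · intro x e
    have h1 := ((hF.differentiableOn (by simp)).differentiableAt ((isOpen_Om τ).mem_nhds (hm x))).hasFDerivAt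
    have h2 : HasFDerivAt (fun x : E3 => ((p.1, x, p.2.2) : Y3))
        ((0 : E3 →L[ℝ] ℝ).prod ((ContinuousLinearMap.id ℝ E3).prod 0)) x :=
      (hasFDerivAt_const _ _).prodMk ((hasFDerivAt_id x).prodMk (hasFDerivAt_const _ _))
    have h3 : HasFDerivAt (fun x => F (p.1, x, p.2.2)) _ x := h1.comp x h2
    rw [h3.fderiv]; simp

lemma cv_dk {τ : ℝ} {k : E3 → ℝ} (hk : KC k) {F : Y3 → ℝ} (hF : ContDiffOn ℝ 1 F (Om τ)) {p : Y3} (hp : p ∈ Om τ)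
    (e : E3) : cv (dk e k) F p = cv k (fun q => fderiv ℝ F q (0, e, 0)) p := by
  unfold cv
  rw [cx_dk hk (slice_fd hF hp).1]
  simp_rw [(slice_fd hF hp).2]

lemma cv_add {Ω : Set Y3} (hΩ : OK Ω) {k : E3 → ℝ} (hk : KC k) {F G : Y3 → ℝ} (hF : ContinuousOn F Ω)
    (hG : ContinuousOn G Ω) {p : Y3} (hp : p ∈ Ω) : cv k (fun q => F q + G q) p = cv k F p + cv k G p := by
  unfold cv cx
  rw [← integral_add (cv_int hΩ hk hF hp) (cv_int hΩ hk hG hp)]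
  simp only [mul_add]

lemma cv_smul (c : ℝ) (k : E3 → ℝ) (F : Y3 → ℝ) (p : Y3) : cv k (fun q => c * F q) p = c * cv k F p := by
  unfold cv cx
  rw [← integral_const_mul]; congr 1; ext y; ring

lemma cv_congr {Ω : Set Y3} (hΩ : OK Ω) {k : E3 → ℝ} {F G : Y3 → ℝ} (h : ∀ q ∈ Ω, F q = G q) {p : Y3} (hp : p ∈ Ω) :
    cv k F p = cv k G p := by
  unfold cv cx
  congr 1; ext y; simp only [h (p.1, p.2.1 - y, p.2.2) (hΩ.m hp rfl)]

lemma cv_neg (k : E3 → ℝ) (F : Y3 → ℝ) (p : Y3) : cv k (fun q => - F q) p = - cv k F p := by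
  simpa using cv_smul (-1) k F p

lemma cv_sub {Ω : Set Y3} (hΩ : OK Ω) {k : E3 → ℝ} (hk : KC k) {F G : Y3 → ℝ} (hF : ContinuousOn F Ω)
    (hG : ContinuousOn G Ω) {p : Y3} (hp : p ∈ Ω) : cv k (fun q => F q - G q) p = cv k F p - cv k G p := by
  simp_rw [sub_eq_add_neg]
  rw [cv_add hΩ hk hF hG.fun_neg hp, cv_neg]

lemma cv_sum {Ω : Set Y3} (hΩ : OK Ω) {k : E3 → ℝ} (hk : KC k) {F : Fin 3 → Y3 → ℝ} (hF : ∀ l, ContinuousOn (F l) Ω)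
    {p : Y3} (hp : p ∈ Ω) : cv k (fun q => ∑ l, F l q) p = ∑ l, cv k (F l) p := by
  unfold cv cx
  rw [← integral_finsetSum _ fun l _ => cv_int hΩ hk (hF l) hp]
  simp only [Finset.mul_sum]

lemma cv_XS {r : ℝ} {F : Y3 → ℝ} (k : E3 → ℝ) (h : XS r F) : XS r (cv k F) := by
  intro p hp
  unfold cv cx
  have : ∀ y, F (p.1, p.2.1 - y, p.2.2) = 0 := fun y => h _ hp
  simp [this]
end

noncomputable section


lemma exists_cutoff (r : ℝ) : ∃ b : E3 → ℝ, Continuous b ∧ HasCompactSupport b ∧ ∀ ξ, ‖ξ‖ ≤ r → b ξ = 1 := by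
  let b : ContDiffBump (0 : E3) := ⟨max r 1, max r 1 + 1, by positivity, by linarith⟩
  refine ⟨b, b.continuous, b.hasCompactSupport, fun ξ hξ => b.one_of_mem_closedBall ?_⟩
  simpa [b] using Or.inl hξ

lemma mom_cut {r : ℝ} {b : E3 → ℝ} (hb : ∀ ξ, ‖ξ‖ ≤ r → b ξ = 1) {F : Y3 → ℝ} (hF : XS r F) (m : E3 → ℝ) :
    mom m F = mom (fun ξ => m ξ * b ξ) F := by
  ext p; unfold mom
  congr 1; ext ξ
  by_cases h : ‖ξ‖ ≤ r
  · simp only [hb ξ h, mul_one]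
  · rw [hF (p.1, p.2.1, ξ) (not_le.1 h)]; simp

lemma mom_cont {Ω : Set Y3} (hΩ : OK Ω) {r : ℝ} {m : E3 → ℝ} (hm : Continuous m) {F : Y3 → ℝ}
    (hF : ContinuousOn F Ω) (hz : XS r F) : ContinuousOn (mom m F) Ω := by
  obtain ⟨b, hb, hbs, hb1⟩ := exists_cutoff r
  rw [mom_cut hb1 hz, mom_eq]
  exact PI_cont hF (hm.mul hb) hbs.mul_left (S := fun p w => mL p + (0, 0, w)) (by fun_prop)
    (fun p hp w => hΩ.m hp (by simp [mL]))

lemma XS_fd {τ r : ℝ} {F : Y3 → ℝ} (hF : G1 τ r F) (d : Y3) : G0 τ r (fun q => fderiv ℝ F q d) :=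
  hF.fd continuous_const

lemma mom_fd {τ r : ℝ} {m : E3 → ℝ} (hm : Continuous m) {F : Y3 → ℝ} (hF : G1 τ r F) :
    ContDiffOn ℝ 1 (mom m F) (Om τ) ∧
    ∀ p ∈ Om τ, ∀ d0 dx, fderiv ℝ (mom m F) p (d0, dx, 0) = mom m (fun q => fderiv ℝ F q (d0, dx, 0)) p := by
  obtain ⟨b, hb, hbs, hb1⟩ := exists_cutoff r
  have hmm : ∀ p ∈ Om τ, ∀ w : E3, mL p + (0, 0, w) ∈ Om τ := fun p hp w => (OK_Om τ).m hp (by simp [mL])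
  have k := PI_deriv (isOpen_Om τ) hF.c (k := fun ξ => m ξ * b ξ) (hm.mul hb) hbs.mul_left (L := mL) (m := fun w => (0, 0, w)) (by fun_prop) hmm
  have e : mom m F = _ := (mom_cut hb1 hF.z m).trans (mom_eq _ _)
  refine ⟨by rw [e]; exact k.2, fun p hp d0 dx => ?_⟩
  rw [mom_cut hb1 (XS_fd hF _).z m, e, mom_eq, (k.1 p hp).fderiv, ContinuousLinearMap.integral_apply]
  · simp [mL]
  · exact (PI_intg (F := fun p => (fderiv ℝ F p).comp mL) (Ω := Om τ)
      ((hF.c.continuousOn_fderiv_of_isOpen (isOpen_Om τ) (by simp)).clm_comp continuousOn_const)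
      (hm.mul hb) hbs.mul_left (S := fun w => mL p + (0, 0, w)) (by fun_prop) (hmm p hp)).2

lemma cv_mom {Ω : Set Y3} (hΩ : OK Ω) {r : ℝ} {k : E3 → ℝ} (hk : KC k) {m : E3 → ℝ} (hm : Continuous m) {F : Y3 → ℝ}
    (hF : ContinuousOn F Ω) (hz : XS r F) {p : Y3} (hp : p ∈ Ω) : cv k (mom m F) p = mom m (cv k F) p := by
  obtain ⟨b, hb, hbs, hb1⟩ := exists_cutoff r
  rw [mom_cut hb1 hz, mom_cut hb1 (cv_XS k hz)]
  unfold cv cx mom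
  simp only [← integral_const_mul]
  rw [integral_integral_swap]
  · congr 1; ext ξ; congr 1; ext y; ring
  · apply Continuous.integrable_of_hasCompactSupport
    · have h1 : Continuous fun q : E3 × E3 => F (p.1, p.2.1 - q.1, q.2) :=
        hF.comp_continuous (f := fun q : E3 × E3 => ((p.1, p.2.1 - q.1, q.2) : Y3)) (by fun_prop) (fun q => hΩ.m hp rfl)
      exact (hk.c.continuous.comp continuous_fst).mul (((hm.mul hb).comp continuous_snd).mul h1)
    · refine HasCompactSupport.intro (hk.s.isCompact.prod hbs.isCompact) fun q hq => ?_
      simp only [mem_prod, not_and_or] at hq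
      rcases hq with h | h
      · simp [Function.uncurry, image_eq_zero_of_notMem_tsupport h]
      · simp [Function.uncurry, image_eq_zero_of_notMem_tsupport h]

def res (F : Y3 → ℝ) (y : ℝ × E3) : ℝ := F (y.1, y.2, 0)

lemma JJ_mom {δ τ t T r : ℝ} (h : Cfg δ τ t T) {q : ℝ → ℝ} (hq : Q0 T q) (x : E3) {m : E3 → ℝ}
    (hm : ContDiff ℝ (⊤ : ℕ∞) m) {G : Y3 → ℝ} (hG : G0 τ r G) :
    JJ δ t x q (fun _ => 1) (res (mom m G)) = II δ t x q (fun p => m p.2) G ∧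
    Integrable fun z => q (phi δ z) * 1 * (res (mom m G)) (t - phi δ z, x + z) := by
  have hi := int_kerG h hq (A := fun p => m p.2) (SU.of (hm.comp contDiff_snd)) hG x
  have e : ∀ z, ∫ ξ, kerK δ q (fun p => m p.2) (z, ξ) * G (Gam δ t x (z, ξ)) =
      q (phi δ z) * 1 * (res (mom m G)) (t - phi δ z, x + z) := by
    intro z
    simp only [res, mom, kerK, Gam, mul_one]
    rw [← integral_const_mul]; congr 1; ext ξ; ring
  rw [Measure.volume_eq_prod] at hi
  constructor
  · unfold II JJ
    rw [Measure.volume_eq_prod, integral_prod _ hi]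
    simp_rw [e]
  · have := hi.integral_prod_left
    simp_rw [e] at this
    exact this

lemma Trip.cv {τ r : ℝ} {g K : Y3 → ℝ} {H : Fin 3 → Y3 → ℝ} (T : Trip τ r g K H) {k : E3 → ℝ} (hk : KC k) :
    Trip τ r (cv k g) (cv k K) (fun l => cv k (H l)) := by
  refine ⟨⟨cv_C1 hk T.hg.c, cv_XS k T.hg.z⟩, ⟨cv_cont (OK_Om τ) hk T.hK.c, cv_XS k T.hK.z⟩,
    fun l => ⟨cv_C1 hk (T.hH l).c, cv_XS k (T.hH l).z⟩, fun p hp => ?_⟩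
  have h1 : TT (_root_.cv k g) p = _root_.cv k (TT g) p := by
    rw [TT, cv_fd hk T.hg.c hp]; rfl
  rw [h1, cv_congr (OK_Om τ) T.eq hp, cv_sub (OK_Om τ) hk T.hK.c
    (continuousOn_finsetSum _ fun l _ => (XS_fd (T.hH l) _).c) hp,
    cv_sum (OK_Om τ) hk (fun l => (XS_fd (T.hH l) _).c) hp]
  congr 1
  exact Finset.sum_congr rfl fun l _ => (cv_fd hk (T.hH l).c hp _).symm

lemma Trip.mul {τ r : ℝ} {g K : Y3 → ℝ} {H : Fin 3 → Y3 → ℝ} (T : Trip τ r g K H) {a : Y3 → ℝ}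
    (ha : ContDiffOn ℝ 1 a (Om τ)) :
    Trip τ r (fun p => a p * g p) (fun p => a p * K p + TT a p * g p + ∑ m, fderiv ℝ a p (0, 0, e3 m) * H m p)
      (fun m p => a p * H m p) := by
  have hz : ∀ {g : Y3 → ℝ} (b : Y3 → ℝ), XS r g → XS r (fun p => b p * g p) := fun b h p hp => by simp [h p hp]
  have hfd : ContinuousOn (fderiv ℝ a) (Om τ) := ha.continuousOn_fderiv_of_isOpen (isOpen_Om τ) (by simp)
  refine ⟨⟨ha.mul T.hg.c, hz _ T.hg.z⟩, ⟨?_, ?_⟩, fun l => ⟨ha.mul (T.hH l).c, hz _ (T.hH l).z⟩, ?_⟩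
  · refine ((ha.continuousOn.mul T.hK.c).add (ContinuousOn.mul ?_ T.hg.g0.c)).add (continuousOn_finsetSum _ fun l _ =>
      (hfd.clm_apply continuousOn_const).mul (T.hH l).g0.c)
    exact hfd.clm_apply (by have := continuous_vrel; fun_prop)
  · intro p hp
    simp only [T.hK.z p hp, T.hg.z p hp, fun m => (T.hH m).z p hp]; simp
  · intro p hp
    have hd : ∀ {g : Y3 → ℝ}, ContDiffOn ℝ 1 g (Om τ) → DifferentiableAt ℝ g p := fun h =>
      (h.differentiableOn (by simp)).differentiableAt ((isOpen_Om τ).mem_nhds hp)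
    have e : ∀ {g : Y3 → ℝ}, ContDiffOn ℝ 1 g (Om τ) → ∀ d, fderiv ℝ (fun p => a p * g p) p d =
        a p * fderiv ℝ g p d + fderiv ℝ a p d * g p := by
      intro g h d
      have := ((hd ha).hasFDerivAt.mul (hd h).hasFDerivAt).fderiv
      have e2 : (fun p => a p * g p) = a * g := rfl
      rw [e2, this]; simp; ring
    have h0 := T.eq p hp
    simp only [TT] at h0 ⊢
    rw [e T.hg.c, h0]
    simp_rw [e (T.hH _).c, Finset.sum_add_distrib, mul_sub, Finset.mul_sum]
    ring
end

noncomputable section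


structure Mx (τ r : ℝ) (F0 : Y3 → ℝ) (E B : Fin 3 → Y3 → ℝ) (a b : Fin 3 → E3 → ℝ) (c : E3 → ℝ) : Prop where
  hf : G1 τ r F0
  hE : ∀ i, ContDiffOn ℝ 1 (E i) (Om τ)
  hB : ∀ i, ContDiffOn ℝ 1 (B i) (Om τ)
  ha : ∀ i, ContDiff ℝ (⊤ : ℕ∞) (a i)
  hb : ∀ i, ContDiff ℝ (⊤ : ℕ∞) (b i)
  hc : ContDiff ℝ (⊤ : ℕ∞) c
  e1 : ∀ i, ∀ p ∈ Om τ, fderiv ℝ (E i) p (1, 0, 0) = fderiv ℝ (B (i+2)) p (0, e3 (i+1), 0)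
    - fderiv ℝ (B (i+1)) p (0, e3 (i+2), 0) - mom (a i) F0 p
  e2 : ∀ i, ∀ p ∈ Om τ, fderiv ℝ (B i) p (1, 0, 0) = -(fderiv ℝ (E (i+2)) p (0, e3 (i+1), 0)
    - fderiv ℝ (E (i+1)) p (0, e3 (i+2), 0)) - mom (b i) F0 p
  e4 : ∀ p ∈ Om τ, ∑ l, fderiv ℝ (E l) p (0, e3 l, 0) = mom c F0 p

def PPx (k : E3 → ℝ) (F0 : Y3 → ℝ) (B : Fin 3 → Y3 → ℝ) (a : Fin 3 → E3 → ℝ) (i : Fin 3) (p : Y3) : ℝ :=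
  cv (dk (e3 (i+1)) k) (B (i+2)) p - cv (dk (e3 (i+2)) k) (B (i+1)) p - cv k (mom (a i) F0) p

lemma fd_cont {τ : ℝ} {F : Y3 → ℝ} (hF : ContDiffOn ℝ 1 F (Om τ)) (d : Y3) :
    ContinuousOn (fun q => fderiv ℝ F q d) (Om τ) :=
  (hF.continuousOn_fderiv_of_isOpen (isOpen_Om τ) (by simp)).clm_apply continuousOn_const

lemma cv_swap {τ : ℝ} {k : E3 → ℝ} (hk : KC k) {F : Y3 → ℝ} (hF : ContDiffOn ℝ 1 F (Om τ)) {p : Y3} (hp : p ∈ Om τ)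
    (a b : E3) : cv (dk a k) (fun q => fderiv ℝ F q (0, b, 0)) p = cv (dk b k) (fun q => fderiv ℝ F q (0, a, 0)) p := by
  rw [← cv_dk (hk.dk a) hF hp, ← cv_dk (hk.dk b) hF hp, dk_comm hk]

lemma res_fd {τ : ℝ} {F : Y3 → ℝ} (hF : ContDiffOn ℝ 1 F (Om τ)) :
    ContDiffOn ℝ 1 (res F) (Om3 τ) ∧ ∀ y ∈ Om3 τ, ∀ d0 dx, fderiv ℝ (res F) y (d0, dx) = fderiv ℝ F (y.1, y.2, 0) (d0, dx, 0) := by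
  have hm : ∀ y ∈ Om3 τ, ((y.1, y.2, 0) : Y3) ∈ Om τ := fun y hy => ⟨hy.1, mem_univ _⟩
  constructor
  · exact hF.comp (f := fun y : ℝ × E3 => ((y.1, y.2, 0) : Y3)) (by fun_prop) hm
  · intro y hy d0 dx
    have h1 := ((hF.differentiableOn (by simp)).differentiableAt ((isOpen_Om τ).mem_nhds (hm y hy))).hasFDerivAt
    have h2 : HasFDerivAt (fun y : ℝ × E3 => ((y.1, y.2, 0) : Y3)) ((ContinuousLinearMap.fst ℝ ℝ E3).prod
        ((ContinuousLinearMap.snd ℝ ℝ E3).prod 0)) y :=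
      HasFDerivAt.prodMk hasFDerivAt_fst (HasFDerivAt.prodMk (f₁ := fun y : ℝ × E3 => y.2) hasFDerivAt_snd (hasFDerivAt_const (0 : E3) y))
    have h3 : HasFDerivAt (res F) _ y := h1.comp y h2
    rw [h3.fderiv]; simp

section
variable {τ r : ℝ} {F0 : Y3 → ℝ} {E B : Fin 3 → Y3 → ℝ} {a b : Fin 3 → E3 → ℝ} {c : E3 → ℝ}

lemma Mx.PC1 (M : Mx τ r F0 E B a b c) {k : E3 → ℝ} (hk : KC k) (i : Fin 3) :
    ContDiffOn ℝ 1 (PPx k F0 B a i) (Om τ) :=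
  ((cv_C1 (hk.dk _) (M.hB _)).sub (cv_C1 (hk.dk _) (M.hB _))).sub (cv_C1 hk (mom_fd (M.ha i).continuous M.hf).1)

lemma Mx.Pfd (M : Mx τ r F0 E B a b c) {k : E3 → ℝ} (hk : KC k) (i : Fin 3) {p : Y3} (hp : p ∈ Om τ) (d : Y3) :
    fderiv ℝ (PPx k F0 B a i) p d = cv (dk (e3 (i+1)) k) (fun q => fderiv ℝ (B (i+2)) q d) p
      - cv (dk (e3 (i+2)) k) (fun q => fderiv ℝ (B (i+1)) q d) p - cv k (fun q => fderiv ℝ (mom (a i) F0) q d) p := by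
  have hd : ∀ {g : Y3 → ℝ}, ContDiffOn ℝ 1 g (Om τ) → DifferentiableAt ℝ g p := fun h =>
      (h.differentiableOn (by simp)).differentiableAt ((isOpen_Om τ).mem_nhds hp)
  have h1 := cv_C1 (hk.dk (e3 (i+1))) (M.hB (i+2))
  have h2 := cv_C1 (hk.dk (e3 (i+2))) (M.hB (i+1))
  have h3 := cv_C1 hk (mom_fd (M.ha i).continuous M.hf).1
  rw [← cv_fd (hk.dk _) (M.hB _) hp, ← cv_fd (hk.dk _) (M.hB _) hp, ← cv_fd hk (mom_fd (M.ha i).continuous M.hf).1 hp]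
  have := (((hd h1).hasFDerivAt.sub (hd h2).hasFDerivAt).sub (hd h3).hasFDerivAt).fderiv
  have e : PPx k F0 B a i = cv (dk (e3 (i+1)) k) (B (i+2)) - cv (dk (e3 (i+2)) k) (B (i+1)) - cv k (mom (a i) F0) := rfl
  rw [e, this]; simp

lemma Mx.wav (M : Mx τ r F0 E B a b c) {k : E3 → ℝ} (hk : KC k) (i : Fin 3) :
    Wav τ (res (cv k (E i))) (res (PPx k F0 B a i)) (fun l => res (cv (dk (e3 l) k) (E i))) := by
  have hm : ∀ y ∈ Om3 τ, ((y.1, y.2, 0) : Y3) ∈ Om τ := fun y hy => ⟨hy.1, mem_univ _⟩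
  have hJ := mom_fd (M.ha i).continuous M.hf
  have e1 : ∀ {k : E3 → ℝ}, KC k → ∀ p ∈ Om τ, cv k (fun q => fderiv ℝ (E i) q (1, 0, 0)) p =
      cv k (fun q => fderiv ℝ (B (i+2)) q (0, e3 (i+1), 0)) p
      - cv k (fun q => fderiv ℝ (B (i+1)) q (0, e3 (i+2), 0)) p - cv k (mom (a i) F0) p := by
    intro k hk p hp
    rw [cv_congr (OK_Om τ) (M.e1 i) hp, cv_sub (OK_Om τ) hk ((fd_cont (M.hB _) _).fun_sub (fd_cont (M.hB _) _)) hJ.1.continuousOn hp,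
      cv_sub (OK_Om τ) hk (fd_cont (M.hB _) _) (fd_cont (M.hB _) _) hp]
  refine ⟨(res_fd (cv_C1 hk (M.hE i))).1, (res_fd (M.PC1 hk i)).1, fun l => (res_fd (cv_C1 (hk.dk _) (M.hE i))).1, ?_, ?_, ?_⟩
  · intro y hy
    rw [(res_fd (cv_C1 hk (M.hE i))).2 y hy, cv_fd hk (M.hE i) (hm y hy), e1 hk _ (hm y hy), ← cv_dk hk (M.hB _) (hm y hy),
      ← cv_dk hk (M.hB _) (hm y hy)]
    rfl
  · intro l y hy
    rw [(res_fd (cv_C1 hk (M.hE i))).2 y hy, cv_fd hk (M.hE i) (hm y hy), ← cv_dk hk (M.hE _) (hm y hy)]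
    rfl
  · intro l y hy
    rw [(res_fd (cv_C1 (hk.dk _) (M.hE i))).2 y hy, cv_fd (hk.dk _) (M.hE i) (hm y hy), e1 (hk.dk _) _ (hm y hy),
      (res_fd (M.PC1 hk i)).2 y hy, M.Pfd hk i (hm y hy), cv_swap hk (M.hB _) (hm y hy), cv_swap hk (M.hB (i+1)) (hm y hy),
      cv_dk hk hJ.1 (hm y hy)]

lemma sum3 (i : Fin 3) (f : Fin 3 → ℝ) : ∑ l, f l = f i + f (i+1) + f (i+2) := by
  fin_cases i <;> simp [Fin.sum_univ_three] <;> ring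

def bx (a b : Fin 3 → E3 → ℝ) (c : E3 → ℝ) (g : Y3 → ℝ) (i : Fin 3) (p : Y3) : ℝ :=
  -(mom (a i) (fun q => fderiv ℝ g q (1, 0, 0)) p + mom c (fun q => fderiv ℝ g q (0, e3 i, 0)) p
    + mom (b (i+2)) (fun q => fderiv ℝ g q (0, e3 (i+1), 0)) p - mom (b (i+1)) (fun q => fderiv ℝ g q (0, e3 (i+2), 0)) p)

lemma Mx.box (M : Mx τ r F0 E B a b c) {k : E3 → ℝ} (hk : KC k) (i : Fin 3) {y : ℝ × E3} (hy : y ∈ Om3 τ) :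
    box (res (PPx k F0 B a i)) (fun l => res (cv (dk (e3 l) k) (E i))) y = res (bx a b c (cv k F0) i) y := by
  have hp : ((y.1, y.2, 0) : Y3) ∈ Om τ := ⟨hy.1, mem_univ _⟩
  have hG : G1 τ r (cv k F0) := ⟨cv_C1 hk M.hf.c, cv_XS k M.hf.z⟩
  unfold _root_.box
  rw [(res_fd (M.PC1 hk i)).2 y hy, M.Pfd hk i hp]
  simp_rw [(res_fd (cv_C1 (hk.dk _) (M.hE i))).2 y hy, cv_fd (hk.dk _) (M.hE i) hp]
  unfold res bx
  set p : Y3 := (y.1, y.2, 0) with hpd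
  have key : ∀ {m : E3 → ℝ}, ContDiff ℝ (⊤ : ℕ∞) m → ∀ d0 dx, mom m (fun q => fderiv ℝ (cv k F0) q (d0, dx, 0)) p =
      cv k (fun q => fderiv ℝ (mom m F0) q (d0, dx, 0)) p := by
    intro m hm d0 dx
    rw [cv_congr (OK_Om τ) (fun q hq => (mom_fd hm.continuous M.hf).2 q hq d0 dx) hp,
      cv_mom (OK_Om τ) hk hm.continuous (XS_fd M.hf _).c (XS_fd M.hf _).z hp]
    unfold mom
    congr 1; ext ξ
    simp only []
    rw [cv_fd hk M.hf.c (p := (p.1, p.2.1, ξ)) ((OK_Om τ).m hp rfl)]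
  rw [key (M.ha i), key M.hc, key (M.hb _), key (M.hb _)]
  have hJ := fun j => (mom_fd (M.hb j).continuous M.hf).1
  have hR := (mom_fd M.hc.continuous M.hf).1
  have e2 : ∀ j d, cv (dk d k) (fun q => fderiv ℝ (B j) q (1, 0, 0)) p =
      -(cv (dk d k) (fun q => fderiv ℝ (E (j+2)) q (0, e3 (j+1), 0)) p
      - cv (dk d k) (fun q => fderiv ℝ (E (j+1)) q (0, e3 (j+2), 0)) p) - cv (dk d k) (mom (b j) F0) p := by
    intro j d
    rw [cv_congr (OK_Om τ) (M.e2 j) hp, cv_sub (OK_Om τ) (hk.dk d) ((fd_cont (M.hE _) _).fun_sub (fd_cont (M.hE _) _)).fun_neg (hJ j).continuousOn hp,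
      cv_neg, cv_sub (OK_Om τ) (hk.dk d) (fd_cont (M.hE _) _) (fd_cont (M.hE _) _) hp]
  rw [e2, e2, cv_dk hk (hJ _) hp, cv_dk hk (hJ _) hp]
  have e3' : cv k (fun q => fderiv ℝ (mom c F0) q (0, e3 i, 0)) p =
      ∑ l, cv (dk (e3 l) k) (fun q => fderiv ℝ (E l) q (0, e3 i, 0)) p := by
    rw [← cv_dk hk hR hp, ← cv_congr (OK_Om τ) M.e4 hp, cv_sum (OK_Om τ) (hk.dk _) (fun l => fd_cont (M.hE l) _) hp]
    exact Finset.sum_congr rfl fun l _ => cv_swap hk (M.hE l) hp _ _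
  rw [e3', sum3 i, sum3 i]
  have i1 : i + 2 + 2 = i + 1 := by fin_cases i <;> rfl
  have i2 : i + 2 + 1 = i := by fin_cases i <;> rfl
  have i3 : i + 1 + 2 = i := by fin_cases i <;> rfl
  have i4 : i + 1 + 1 = i + 2 := by fin_cases i <;> rfl
  rw [i1, i2, i3, i4]
  ring
end
end

noncomputable section


def CBd (t : ℝ) (x : E3) (r : ℝ) (g : Y3 → ℝ) (b : ℝ → ℝ) : Prop :=
  ∀ s y ξ, 0 < s → ‖y - x‖ ≤ t - s → ‖ξ‖ ≤ r → |g (s, y, ξ)| ≤ b s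

lemma CBd.at {t : ℝ} {x : E3} {r : ℝ} {g : Y3 → ℝ} {b : ℝ → ℝ} (hb : CBd t x r g b) {δ h : ℝ} (hδ : 0 < δ) (hh : 0 < h)
    {z ξ : E3} (hz : h / 2 ≤ t - phi δ z) (hξ : ‖ξ‖ ≤ r) : |g (Gam δ t x (z, ξ))| ≤ b (t - phi δ z) := by
  apply hb _ _ _ (by linarith) _ hξ
  have := norm_le_phi (δ := δ) z
  simpa using this

lemma B1 {A : X6 → ℝ} (hA : SU A) {r τ : ℝ} (hr : 0 ≤ r) (hτ : 0 < τ) : ∃ C : ℝ, 0 < C ∧ ∀ {δ t h : ℝ} {x : E3}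
    {g : Y3 → ℝ} {α N lam : ℝ}, Par δ τ t h → XS r g → 0 ≤ α → 0 ≤ N → 0 < lam →
    CBd t x r g (fun s => α + N * exp (lam * s)) →
    |II δ t x (cut h t (ip 1)) A g| ≤ C * (α + N * exp (lam * t) / lam) := by
  obtain ⟨C, hC, he⟩ := est hA hr
  refine ⟨C * ((1 + τ) * (S3 * τ + 1)), by have := S3_nonneg; positivity, ?_⟩
  intro δ t h x g α N lam H hg hα hN hl hb
  have ht := H.tpos
  have hS := S3_nonneg
  have hw := Wa H
  refine (he H.hδ hg (hw.1.const_mul (α * t + N * exp (lam * t) / lam)) (w := ((1 + τ) * (S3 * τ + 1)) * (α + N * exp (lam * t) / lam)) ?_ ?_).trans (le_of_eq (by ring))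
  · rw [integral_const_mul]
    have h0 : 0 ≤ N * exp (lam * t) / lam := by positivity
    calc (α * t + N * exp (lam * t) / lam) * _ ≤ (α * t + N * exp (lam * t) / lam) * (S3 * t) := by gcongr; exact hw.2
      _ ≤ (α * τ + N * exp (lam * t) / lam) * (S3 * τ) := by have := H.ht.le; gcongr
      _ ≤ ((1 + τ) * (α + N * exp (lam * t) / lam)) * (S3 * τ + 1) := by
        gcongr
        · nlinarith
        · linarith
      _ = _ := by ring
  · intro z ξ hξ
    have hφ := phi_pos H.hδ z
    simp only [cut, ip, pow_one]
    by_cases hz : ps h (t - phi δ z) = 0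
    · simp [hz]
    obtain ⟨h1, -, -⟩ := cut_pt H.hδ H.hh x z hz
    have hg1 := hb.at H.hδ H.hh h1 hξ
    have hp := ps_nonneg h (t - phi δ z)
    rw [abs_mul, abs_of_nonneg (by positivity)]
    set φ := phi δ z
    have e1 : φ⁻¹ * |g (Gam δ t x (z, ξ))| ≤ (α * t + N * exp (lam * t) / lam) * (φ ^ 2)⁻¹ := by
      have hφt : φ ≤ t := by linarith [H.hh]
      have e2 : exp (lam * (t - φ)) * (lam * φ) ≤ exp (lam * t) := by
        have : exp (lam * t) = exp (lam * (t - φ)) * exp (lam * φ) := by rw [← exp_add]; ring_nf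
        rw [this]
        gcongr
        linarith [add_one_le_exp (lam * φ)]
      have e3' : N * exp (lam * (t - φ)) * φ ≤ N * exp (lam * t) / lam := by
        rw [le_div_iff₀ hl]
        calc _ = N * (exp (lam * (t - φ)) * (lam * φ)) := by ring
          _ ≤ _ := by gcongr
      calc _ ≤ φ⁻¹ * (α + N * exp (lam * (t - φ))) := by gcongr
        _ = (α * φ + N * exp (lam * (t - φ)) * φ) * (φ ^ 2)⁻¹ := by field_simp
        _ ≤ _ := by gcongr
    calc _ = ps h (t - φ) * (φ⁻¹ * |g (Gam δ t x (z, ξ))|) := by ring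
      _ ≤ ps h (t - φ) * ((α * t + N * exp (lam * t) / lam) * (φ ^ 2)⁻¹) := by gcongr
      _ = _ := by ring

lemma B2 {A : X6 → ℝ} (hA : SU A) {r τ : ℝ} (hr : 0 ≤ r) (hτ : 0 < τ) : ∃ C : ℝ, 0 < C ∧ ∀ {δ t h : ℝ} {x : E3}
    {g : Y3 → ℝ} {α : ℝ}, Par δ τ t h → XS r g → 0 ≤ α →
    CBd t x r g (fun _ => α) →
    |II δ t x (cut h t (ip 2)) A g| ≤ C * α := by
  obtain ⟨C, hC, he⟩ := est hA hr
  refine ⟨C * (S3 * τ + 1), by have := S3_nonneg; positivity, ?_⟩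
  intro δ t h x g α H hg hα hb
  have ht := H.tpos
  have hS := S3_nonneg
  have hw := Wa H
  refine (he H.hδ hg (hw.1.const_mul α) (w := (S3 * τ + 1) * α) ?_ ?_).trans (le_of_eq (by ring))
  · rw [integral_const_mul, mul_comm]
    gcongr
    refine hw.2.trans ?_
    have := mul_le_mul_of_nonneg_left H.ht.le hS
    linarith
  · intro z ξ hξ
    have hφ := phi_pos H.hδ z
    simp only [cut, ip]
    by_cases hz : ps h (t - phi δ z) = 0
    · simp [hz]
    obtain ⟨h1, -, -⟩ := cut_pt H.hδ H.hh x z hz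
    have hg1 := hb.at H.hδ H.hh h1 hξ
    have hp := ps_nonneg h (t - phi δ z)
    rw [abs_mul, abs_of_nonneg (by positivity), mul_comm]
    gcongr

lemma B3 {A : X6 → ℝ} (hA : SU A) {r τ : ℝ} (hr : 0 ≤ r) (hτ : 0 < τ) : ∃ C : ℝ, 0 < C ∧ ∀ {δ t h : ℝ} {x : E3}
    {g : Y3 → ℝ} {α : ℝ}, Par δ τ t h → XS r g → 0 ≤ α →
    (∀ s y ξ, 0 < s → s ≤ h → ‖y - x‖ ≤ t → ‖ξ‖ ≤ r → |g (s, y, ξ)| ≤ α) →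
    |II δ t x (dcut h t (ip 1)) A g| ≤ C * α ∧ |II δ t x (dcut h t (ip 2)) A g| ≤ C * α := by
  obtain ⟨C, hC, he⟩ := est hA hr
  refine ⟨C * (6 * S3 * τ + 12 * S3 + 1), by have := S3_nonneg; positivity, ?_⟩
  intro δ t h x g α H hg hα hb
  have ht := H.tpos
  have hS := S3_nonneg
  have h3 := mul_le_mul_of_nonneg_left H.ht.le hS
  have h4 : 0 ≤ S3 * τ := by positivity
  have key : ∀ n, ∀ z ξ : E3, ‖ξ‖ ≤ r → |dcut h t (ip n) (phi δ z) * g (Gam δ t x (z, ξ))| ≤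
      α * dcut h t (fun s => (s ^ n)⁻¹) (phi δ z) := by
    intro n z ξ hξ
    have hφ := phi_pos H.hδ z
    simp only [dcut, ip]
    by_cases hz : deriv (ps h) (t - phi δ z) = 0
    · simp [hz]
    obtain ⟨h1, h2, h3, -⟩ := H.big hz
    have hg1 : |g (Gam δ t x (z, ξ))| ≤ α := by
      apply hb _ _ _ (by linarith) h3 _ hξ
      have := norm_le_phi (δ := δ) z
      simp; linarith
    have hp := dps_nonneg H.hh (t - phi δ z)
    rw [abs_mul, abs_of_nonneg (by positivity), mul_comm]
    gcongr
  constructor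
  · have hw := We H
    refine (he H.hδ hg (hw.1.const_mul α) (w := (6 * S3 * τ + 12 * S3 + 1) * α) ?_ (key 1)).trans (le_of_eq (by ring))
    rw [integral_const_mul, mul_comm]
    gcongr
    refine hw.2.trans ?_
    linarith
  · have hw := Wf H
    refine (he H.hδ hg (hw.1.const_mul α) (w := (6 * S3 * τ + 12 * S3 + 1) * α) ?_ (key 2)).trans (le_of_eq (by ring))
    rw [integral_const_mul, mul_comm]
    gcongr
    refine hw.2.trans ?_
    linarith
end

noncomputable section


lemma estC {A : X6 → ℝ} (hA : SU A) {r : ℝ} (hr : 0 ≤ r) : ∃ C : ℝ, 0 < C ∧ ∀ {δ t : ℝ} {x : E3}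
    {q W : ℝ → ℝ} {g : Y3 → ℝ} {α w : ℝ}, 0 < δ → XS r g → 0 ≤ α → CBd t x r g (fun _ => α) →
    Integrable (fun z => W (phi δ z)) → ∫ z, W (phi δ z) ≤ w → (∀ s, 0 < s → |q s| ≤ W s) → (∀ s, t ≤ s → q s = 0) →
    |II δ t x q A g| ≤ C * (α * w) := by
  obtain ⟨C, hC, he⟩ := est hA hr
  refine ⟨C, hC, ?_⟩
  intro δ t x q W g α w hδ hg hα hb hi hw hq h0
  refine he hδ hg (hi.const_mul α) ?_ ?_
  · rw [integral_const_mul]; gcongr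
  · intro z ξ hξ
    have hφ := phi_pos hδ z
    rcases le_or_gt t (phi δ z) with h1 | h1
    · rw [h0 _ h1]; simp
      have := (abs_nonneg _).trans (hq _ hφ)
      positivity
    · have hg1 := hb.at hδ (h := 2 * (t - phi δ z)) (z := z) (by linarith) (by linarith) hξ
      rw [abs_mul, mul_comm]
      gcongr
      exact hq _ hφ

def dinv (d s : ℝ) : ℝ := ((d + s) ^ 2)⁻¹

lemma dinv_smooth {d : ℝ} (hd : 0 < d) : ContDiffOn ℝ 1 (dinv d) (Ioi 0) := by
  apply ContDiffOn.inv (by fun_prop)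
  intro s hs
  have : 0 < s := hs
  positivity

lemma dinv_deriv {d s : ℝ} (hd : 0 < d) (hs : 0 < s) : HasDerivAt (dinv d) (-2 * ((d + s) ^ 3)⁻¹) s := by
  have h1 : HasDerivAt (fun s => (d + s) ^ 2) (2 * (d + s)) s := by
    have := ((hasDerivAt_id s).const_add d).fun_pow 2
    simpa using this
  have := h1.inv (by positivity)
  refine this.congr_deriv ?_
  field_simp

lemma cut_zero {h t : ℝ} (hh : 0 < h) (c : ℝ → ℝ) {s : ℝ} (hs : t ≤ s) : cut h t c s = 0 := by
  rw [cut, ps_zero hh (by linarith), zero_mul]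
lemma dcut_zero {h t : ℝ} (hh : 0 < h) (c : ℝ → ℝ) {s : ℝ} (hs : t ≤ s) : dcut h t c s = 0 := by
  rw [dcut, dps_zero hh (by linarith), zero_mul]

lemma abs_ps_mul {h u a b : ℝ} (ha : |a| ≤ b) : |ps h u * a| ≤ ps h u * b := by
  rw [abs_mul, abs_of_nonneg (ps_nonneg _ _)]
  exact mul_le_mul_of_nonneg_left ha (ps_nonneg _ _)

lemma near_ineq {d s : ℝ} (hd : 0 < d) (hs : 0 < s) : |(s^2)⁻¹ - ((d+s)^2)⁻¹| ≤ 2 * d * (s ^ 2 * (d + s))⁻¹ := by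
  have e : (s^2)⁻¹ - ((d+s)^2)⁻¹ = (d^2 + 2 * d * s) / (s^2 * (d+s)^2) := by
    field_simp; ring
  rw [e, abs_of_nonneg (by positivity), div_le_iff₀ (by positivity)]
  have : 2 * d * (s ^ 2 * (d + s))⁻¹ * (s ^ 2 * (d + s) ^ 2) = 2 * d * (d + s) := by field_simp
  rw [this]; nlinarith

lemma far1 {d s : ℝ} (hd : 0 < d) (hs : 0 < s) : ((d+s)^2)⁻¹ / s ≤ (s ^ 2 * (d + s))⁻¹ := by
  rw [div_eq_mul_inv, ← mul_inv]
  apply inv_anti₀ (by positivity)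
  have : s ^ 2 * (d + s) = (d + s) * s * s := by ring
  rw [this]
  have : (d+s)^2 * s = (d + s) * s * (d + s) := by ring
  rw [this]; gcongr; linarith
lemma far2 {d s : ℝ} (hd : 0 < d) (hs : 0 < s) : ((d+s)^3)⁻¹ ≤ (s ^ 2 * (d + s))⁻¹ := by
  apply inv_anti₀ (by positivity)
  have : (d+s)^3 = (d + s)^2 * (d + s) := by ring
  rw [this]; gcongr; linarith
lemma far3 {d s : ℝ} (hd : 0 < d) (hs : 0 < s) : ((d+s)^2)⁻¹ ≤ (s ^ 2)⁻¹ := by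
  apply inv_anti₀ (by positivity)
  gcongr; linarith

lemma B4 {A : X6 → ℝ} (hA : SU A) {r τ : ℝ} (hr : 0 ≤ r) (hτ : 0 < τ) (d0 : ℝ) (dx : E3) : ∃ C : ℝ, 0 < C ∧
    ∀ {δ t h : ℝ} {x : E3} {g K : Y3 → ℝ} {H : Fin 3 → Y3 → ℝ} {α L : ℝ}, Par δ τ t h → Trip τ r g K H → 0 ≤ α → 0 ≤ L →
    CBd t x r g (fun _ => α) → CBd t x r K (fun _ => α) → (∀ l, CBd t x r (H l) (fun _ => α)) →
    CBd t x r (fun p => fderiv ℝ g p (d0, dx, 0)) (fun _ => L) →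
    |II δ t x (cut h t (ip 2)) A (fun p => fderiv ℝ g p (d0, dx, 0))| ≤ C * ((1 + α) * (1 + Real.log (1 + L))) := by
  obtain ⟨Ca, hCa, ha⟩ := estC hA hr
  have sK : SU (fun p => A p * alpha d0 dx p) := hA.mul (SU_alpha d0 dx)
  obtain ⟨Cb, hCb, hb⟩ := estC sK hr
  choose Cc hCc hc using fun l => estC (SU_Bl d0 dx hA l) hr
  obtain ⟨Cd, hCd, hd⟩ := estC (SU_A2 d0 dx hA) hr
  obtain ⟨Ce, hCe, he⟩ := estC (SU_A3 d0 dx hA) hr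
  have hS := S3_nonneg
  have hlt : 0 ≤ Real.log (1 + τ) := Real.log_nonneg (by linarith)
  set Wt := S3 * τ + S3 * (1 + Real.log (1 + τ)) + 12 * S3 with hWt
  have hWt0 : 0 ≤ Wt := by positivity
  have hsum : 0 ≤ ∑ l, Cc l := Finset.sum_nonneg fun l _ => (hCc l).le
  refine ⟨(2 * Ca + Cb + (∑ l, Cc l) + Cd + 3 * Ce) * (Wt + 1), by positivity, ?_⟩
  intro δ t h x g K H α L P T hα hL hg hK hH hf
  have ht := P.tpos
  set d := (1 + L)⁻¹ with hdd
  have hd0 : 0 < d := by positivity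
  have hdL : d * L ≤ 1 := by
    rw [hdd, inv_mul_le_iff₀ (by positivity)]; linarith
  have hlL : 0 ≤ Real.log (1 + L) := Real.log_nonneg (by linarith)
  have hw := Wd P hd0
  have hwa := Wa P
  have hwf := Wf P
  set Lg := 1 + Real.log (1 + L) with hLg
  have hLg1 : 1 ≤ Lg := by linarith
  have hlog : S3 * Real.log (1 + t / d) ≤ Wt * Lg := by
    have h1 : Real.log (1 + t / d) ≤ Real.log (1 + τ) + Real.log (1 + L) := by
      rw [← Real.log_mul (by positivity) (by positivity)]
      apply Real.log_le_log (by positivity)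
      rw [hdd, div_inv_eq_mul]
      have := P.ht
      nlinarith
    have h2 : Real.log (1 + t / d) ≤ (1 + Real.log (1 + τ)) * Lg := by
      nlinarith
    calc _ ≤ S3 * ((1 + Real.log (1 + τ)) * Lg) := by gcongr
      _ = (S3 * (1 + Real.log (1 + τ))) * Lg := by ring
      _ ≤ _ := by gcongr; rw [hWt]; nlinarith [mul_nonneg hS hτ.le]
  have hla : S3 * t ≤ Wt * Lg := by
    have h1 := mul_le_mul_of_nonneg_left P.ht.le hS
    have h2 : S3 * τ ≤ Wt := by rw [hWt]; nlinarith [mul_nonneg hS hlt]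
    nlinarith
  have hlf : 12 * S3 ≤ Wt * Lg := by
    have h2 : 12 * S3 ≤ Wt := by rw [hWt]; nlinarith [mul_nonneg hS hlt, mul_nonneg hS hτ.le]
    nlinarith
  have hG : G0 τ r (fun p => fderiv ℝ g p (d0, dx, 0)) := XS_fd T.hg _
  have q1 : Q1 (t - h / 2) (cut h t (fun s => ip 2 s - dinv d s)) := cut_Q1 P.hh ((inv_pow_contDiffOn 2).sub (dinv_smooth hd0))
  have q2 : Q1 (t - h / 2) (cut h t (dinv d)) := cut_Q1 P.hh (dinv_smooth hd0)
  rw [II_two P.cfg x hG q1.q0 q2.q0 hA hA 1 1 (fun s w ξ _ => by simp only [cut]; ring), one_mul, one_mul,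
    comb P.cfg q2 hA T x d0 dx]
  have n1 := ha (q := cut h t (fun s => ip 2 s - dinv d s)) (W := fun s => 2 * d * cut h t (fun s => (s ^ 2 * (d + s))⁻¹) s)
    (w := 2 * d * (Wt * Lg)) P.hδ hG.z hL hf (hw.1.const_mul _)
    (by rw [integral_const_mul]; gcongr; exact hw.2.trans hlog)
    (fun s hs => (abs_ps_mul (near_ineq hd0 hs)).trans (le_of_eq (by simp only [cut]; ring))) (fun s hs => cut_zero P.hh _ hs)
  have n2 := hb (q := cut h t (dinv d)) (W := cut h t (fun s => (s ^ 2)⁻¹))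
    P.hδ T.hK.z hα hK hwa.1 (hwa.2.trans hla)
    (fun s hs => abs_ps_mul (by rw [dinv, abs_of_nonneg (by positivity)]; exact far3 hd0 hs)) (fun s hs => cut_zero P.hh _ hs)
  have n3 := fun l => hc l (q := cut h t (dinv d)) (W := cut h t (fun s => (s ^ 2)⁻¹))
    P.hδ (T.hH l).z hα (hH l) hwa.1 (hwa.2.trans hla)
    (fun s hs => abs_ps_mul (by rw [dinv, abs_of_nonneg (by positivity)]; exact far3 hd0 hs)) (fun s hs => cut_zero P.hh _ hs)
  have n4 := hd (q := fun s => cut h t (dinv d) s / s) (W := cut h t (fun s => (s ^ 2 * (d + s))⁻¹))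
    P.hδ T.hg.z hα hg hw.1 (hw.2.trans hlog)
    (fun s hs => by
      have : cut h t (dinv d) s / s = ps h (t - s) * (((d+s)^2)⁻¹ / s) := by simp only [cut, dinv]; ring
      rw [this]
      exact abs_ps_mul (by rw [abs_of_nonneg (by positivity)]; exact far1 hd0 hs)) (fun s hs => by rw [cut_zero P.hh _ hs, zero_div])
  have n5 := he (q := deriv (cut h t (dinv d))) (W := fun s => dcut h t (fun s => (s ^ 2)⁻¹) s + 2 * cut h t (fun s => (s ^ 2 * (d + s))⁻¹) s)
    (w := 3 * (Wt * Lg))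
    P.hδ T.hg.z hα hg (hwf.1.add (hw.1.const_mul 2)) (by
      rw [integral_add hwf.1 (hw.1.const_mul 2), integral_const_mul]
      have := hwf.2.trans hlf
      have := hw.2.trans hlog
      linarith)
    (fun s hs => by
      rw [cut_deriv (dinv_deriv hd0 hs)]
      refine (abs_add_le _ _).trans (add_le_add ?_ ?_)
      · rw [abs_neg]; simp only [dcut]
        rw [abs_mul, abs_of_nonneg (dps_nonneg P.hh _)]
        refine mul_le_mul_of_nonneg_left ?_ (dps_nonneg P.hh _)
        rw [dinv, abs_of_nonneg (by positivity)]; exact far3 hd0 hs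
      · refine (abs_ps_mul (b := 2 * (s ^ 2 * (d + s))⁻¹) ?_).trans (le_of_eq (by simp only [cut]; ring))
        rw [abs_mul, abs_neg, abs_two, abs_of_nonneg (by positivity)]
        gcongr 2 * ?_
        exact far2 hd0 hs)
    (fun s hs => by
      have hz : cut h t (dinv d) =ᶠ[𝓝 s] fun _ => 0 := by
        filter_upwards [Ioi_mem_nhds (show t - h / 2 < s by linarith [P.hh])] with u hu
        exact q2.z u (le_of_lt hu)
      rw [hz.deriv_eq]; simp)
  have hX : 0 ≤ (Wt + 1) * Lg := by positivity
  have hXX : Wt * Lg ≤ (Wt + 1) * Lg := by gcongr; linarith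
  set X := (Wt + 1) * Lg
  have m1 : L * (2 * d * (Wt * Lg)) ≤ 2 * ((1 + α) * X) := by
    have : 0 ≤ Wt * Lg := by positivity
    calc _ = 2 * ((d * L) * (Wt * Lg)) := by ring
      _ ≤ 2 * (1 * X) := by gcongr
      _ ≤ _ := by gcongr; linarith
  have m2 : α * (Wt * Lg) ≤ (1 + α) * X := by gcongr; linarith
  have n3' : |∑ l, II δ t x (cut h t (dinv d)) (Bl d0 dx A l) (H l)| ≤ (∑ l, Cc l) * ((1 + α) * X) := by
    refine (Finset.abs_sum_le_sum_abs _ _).trans ?_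
    rw [Finset.sum_mul]
    exact Finset.sum_le_sum fun l _ => (n3 l).trans (mul_le_mul_of_nonneg_left m2 (hCc l).le)
  have k1 := n1.trans (mul_le_mul_of_nonneg_left m1 hCa.le)
  have k2 := n2.trans (mul_le_mul_of_nonneg_left m2 hCb.le)
  have k4 := n4.trans (mul_le_mul_of_nonneg_left m2 hCd.le)
  have m5 : α * (3 * (Wt * Lg)) ≤ 3 * ((1 + α) * X) := by linarith
  have k5 := n5.trans (mul_le_mul_of_nonneg_left m5 hCe.le)
  have e1 := abs_add_le (II δ t x (cut h t (fun s => ip 2 s - dinv d s)) A (fun p => fderiv ℝ g p (d0, dx, 0)))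
    (II δ t x (cut h t (dinv d)) (fun p => A p * alpha d0 dx p) K + ∑ l, II δ t x (cut h t (dinv d)) (Bl d0 dx A l) (H l)
      + II δ t x (fun s => cut h t (dinv d) s / s) (A2 d0 dx A) g + II δ t x (deriv (cut h t (dinv d))) (A3 d0 dx A) g)
  have e2 := abs_add_le (II δ t x (cut h t (dinv d)) (fun p => A p * alpha d0 dx p) K + ∑ l, II δ t x (cut h t (dinv d)) (Bl d0 dx A l) (H l)
      + II δ t x (fun s => cut h t (dinv d) s / s) (A2 d0 dx A) g) (II δ t x (deriv (cut h t (dinv d))) (A3 d0 dx A) g)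
  have e3' := abs_add_three (II δ t x (cut h t (dinv d)) (fun p => A p * alpha d0 dx p) K) (∑ l, II δ t x (cut h t (dinv d)) (Bl d0 dx A l) (H l))
      (II δ t x (fun s => cut h t (dinv d) s / s) (A2 d0 dx A) g)
  have e4 : (2 * Ca + Cb + (∑ l, Cc l) + Cd + 3 * Ce) * (Wt + 1) * ((1 + α) * Lg) = 
    Ca * (2 * ((1 + α) * X)) + (Cb * ((1 + α) * X) + (∑ l, Cc l) * ((1 + α) * X) + Cd * ((1 + α) * X) + Ce * (3 * ((1 + α) * X))) := by
    simp only [X]; ring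
  rw [e4]
  linarith
end

noncomputable section


def IB (t h : ℝ) (x : E3) (r : ℝ) (g : Y3 → ℝ) (α : ℝ) : Prop :=
  ∀ s y ξ, 0 < s → s ≤ h → ‖y - x‖ ≤ t → ‖ξ‖ ≤ r → |g (s, y, ξ)| ≤ α

lemma comb' {δ τ t h r : ℝ} (P : Par δ τ t h) {A : X6 → ℝ}
    (hA : SU A) {g K : Y3 → ℝ} {H : Fin 3 → Y3 → ℝ} (hg : Trip τ r g K H) (x : E3)
    (d0 : ℝ) (dx : E3) :
    |II δ t x (cut h t (ip 1)) A (fun p => fderiv ℝ g p (d0, dx, 0))| ≤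
      |II δ t x (cut h t (ip 1)) (fun p => A p * alpha d0 dx p) K|
      + ∑ l, |II δ t x (cut h t (ip 1)) (Bl d0 dx A l) (H l)|
      + |II δ t x (cut h t (ip 2)) (A2 d0 dx A) g| + (|II δ t x (dcut h t (ip 1)) (A3 d0 dx A) g|
      + |II δ t x (cut h t (ip 2)) (A3 d0 dx A) g|) := by
  rw [comb P.cfg (cutQ P.hh 1) hA hg x d0 dx]
  have e1 : II δ t x (fun s => cut h t (ip 1) s / s) (A2 d0 dx A) g = II δ t x (cut h t (ip 2)) (A2 d0 dx A) g :=
    II_congr_q P.hδ (fun s _ => cut_div 1) _ _ _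
  have e2 : II δ t x (deriv (cut h t (ip 1))) (A3 d0 dx A) g = (-1) * II δ t x (dcut h t (ip 1)) (A3 d0 dx A) g +
      (-1) * II δ t x (cut h t (ip 2)) (A3 d0 dx A) g := by
    apply II_two P.cfg x hg.hg.g0 (dcutQ P.hh 1) (cutQ P.hh 2).q0 (SU_A3 d0 dx hA) (SU_A3 d0 dx hA)
    intro s w ξ hs
    rw [cut_d hs 1]; push_cast; ring
  rw [e1, e2]
  refine (abs_add_le _ _).trans (add_le_add ((abs_add_three _ _ _).trans ?_) ?_)
  · gcongr; exact Finset.abs_sum_le_sum_abs _ _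
  · refine (abs_add_le _ _).trans (le_of_eq ?_); simp

lemma L0 {A : X6 → ℝ} (hA : SU A) {r τ : ℝ} (hr : 0 ≤ r) (hτ : 0 < τ) (d0 : ℝ) (dx : E3) : ∃ C : ℝ, 0 < C ∧
    ∀ {δ t h : ℝ} {x : E3} {g K : Y3 → ℝ} {H : Fin 3 → Y3 → ℝ} {α N lam : ℝ}, Par δ τ t h → Trip τ r g K H → 0 ≤ α → 0 ≤ N → 0 < lam →
    CBd t x r g (fun _ => α) → IB t h x r g α → CBd t x r K (fun s => α + N * exp (lam * s)) →
    (∀ l, CBd t x r (H l) (fun s => α + N * exp (lam * s))) →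
    |II δ t x (cut h t (ip 1)) A (fun p => fderiv ℝ g p (d0, dx, 0))| ≤ C * (α + N * exp (lam * t) / lam) := by
  have sK : SU (fun p => A p * alpha d0 dx p) := hA.mul (SU_alpha d0 dx)
  obtain ⟨Cb, hCb, hb⟩ := B1 sK hr hτ
  choose Cc hCc hc using fun l => B1 (SU_Bl d0 dx hA l) hr hτ
  obtain ⟨Cd, hCd, hd⟩ := B2 (SU_A2 d0 dx hA) hr hτ
  obtain ⟨Ce, hCe, he⟩ := B2 (SU_A3 d0 dx hA) hr hτ
  obtain ⟨Cf, hCf, hf⟩ := B3 (SU_A3 d0 dx hA) hr hτ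
  have hsum : 0 ≤ ∑ l, Cc l := Finset.sum_nonneg fun l _ => (hCc l).le
  refine ⟨Cb + (∑ l, Cc l) + Cd + (Cf + Ce), by positivity, ?_⟩
  intro δ t h x g K H α N lam P T hα hN hl bg ig bK bH
  have h0 : 0 ≤ N * exp (lam * t) / lam := by positivity
  have hle : α ≤ α + N * exp (lam * t) / lam := by linarith
  refine (comb' P hA T x d0 dx).trans ?_
  rw [add_mul, add_mul, add_mul, add_mul, Finset.sum_mul]
  gcongr with l
  · exact hb P T.hK.z hα hN hl bK
  · exact hc l P (T.hH l).z hα hN hl (bH l)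
  · exact (hd P T.hg.z hα bg).trans (by gcongr)
  · exact (hf P T.hg.z hα ig).1.trans (by gcongr)
  · exact (he P T.hg.z hα bg).trans (by gcongr)

lemma L1 {A : X6 → ℝ} (hA : SU A) {r τ : ℝ} (hr : 0 ≤ r) (hτ : 0 < τ) (d0 : ℝ) (dx e : E3) : ∃ C : ℝ, 0 < C ∧
    ∀ {δ t h : ℝ} {x : E3} {g0 g : Y3 → ℝ} {H0 H K : Fin 3 → Y3 → ℝ} {H' : Fin 3 → Fin 3 → Y3 → ℝ}
    {α D N lam L : ℝ}, Par δ τ t h → Trip τ r g (fun _ => 0) H → Trip τ r g0 (fun _ => 0) H0 →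
    (∀ l, Trip τ r (H0 l) (K l) (H' l)) →
    (∀ p ∈ Om τ, g p = fderiv ℝ g0 p (0, e, 0)) → (∀ l, ∀ p ∈ Om τ, H l p = fderiv ℝ (H0 l) p (0, e, 0)) →
    0 ≤ α → 0 ≤ D → 0 ≤ N → 0 < lam → 0 ≤ L →
    CBd t x r g0 (fun _ => α) → (∀ l, CBd t x r (H0 l) (fun _ => α)) → (∀ l, IB t h x r (H0 l) α) →
    (∀ l, CBd t x r (K l) (fun s => α + N * exp (lam * s))) → (∀ l m, CBd t x r (H' l m) (fun _ => α)) →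
    IB t h x r (fun p => fderiv ℝ g0 p (0, e, 0)) D → CBd t x r (fun p => fderiv ℝ g0 p (0, e, 0)) (fun _ => L) →
    |II δ t x (cut h t (ip 1)) A (fun p => fderiv ℝ g p (d0, dx, 0))| ≤
      C * ((1 + α + D) * (1 + Real.log (1 + L)) + N * exp (lam * t) / lam) := by
  choose Cc hCc hc using fun l => L0 (SU_Bl d0 dx hA l) hr hτ 0 e
  obtain ⟨Cd, hCd, hd⟩ := B4 (SU_A2 d0 dx hA) hr hτ 0 e
  obtain ⟨Ce, hCe, he⟩ := B4 (SU_A3 d0 dx hA) hr hτ 0 e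
  obtain ⟨Cf, hCf, hf⟩ := B3 (SU_A3 d0 dx hA) hr hτ
  have hsum : 0 ≤ ∑ l, Cc l := Finset.sum_nonneg fun l _ => (hCc l).le
  refine ⟨(∑ l, Cc l) + Cd + (Cf + Ce), by positivity, ?_⟩
  intro δ t h x g0 g H0 H K H' α D N lam L P T T0 T' eg eH hα hD hN hl hL b0 bH iH bK bH' ig bg
  have h0 : 0 ≤ N * exp (lam * t) / lam := by positivity
  have hlog : 0 ≤ Real.log (1 + L) := Real.log_nonneg (by linarith)
  set X := (1 + α + D) * (1 + Real.log (1 + L)) + N * exp (lam * t) / lam with hX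
  have x1 : α + N * exp (lam * t) / lam ≤ X := by
    rw [hX]; gcongr; nlinarith
  have x2 : (1 + α) * (1 + Real.log (1 + L)) ≤ X := by
    rw [hX]; nlinarith
  have x3 : D ≤ X := by rw [hX]; nlinarith
  refine (comb' P hA T x d0 dx).trans ?_
  have z1 : II δ t x (cut h t (ip 1)) (fun p => A p * alpha d0 dx p) (fun _ => 0) = 0 := by simp [II]
  rw [z1, abs_zero, zero_add, add_mul, add_mul, add_mul, Finset.sum_mul]
  have bz : CBd t x r (fun _ => 0) (fun _ => α) := fun _ _ _ _ _ _ => by simpa using hα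
  gcongr with l
  · rw [II_congr P.cfg (cutQ P.hh 1).q0 x (eH l)]
    refine (hc l P (T' l) hα hN hl (bH l) (iH l) (bK l) (fun m s y ξ h1 h2 h3 => ((bH' l m) s y ξ h1 h2 h3).trans ?_)).trans ?_
    · have : 0 ≤ N * exp (lam * s) := by positivity
      linarith
    · have := (hCc l).le
      gcongr
  · rw [II_congr P.cfg (cutQ P.hh 2).q0 x eg]
    exact (hd P T0 hα hL b0 bz bH bg).trans (by gcongr)
  · rw [II_congr P.cfg (dcutQ P.hh 1) x eg]
    exact (hf P (XS_fd T0.hg _).z hD ig).1.trans (by gcongr)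
  · rw [II_congr P.cfg (cutQ P.hh 2).q0 x eg]
    exact (he P T0 hα hL b0 bz bH bg).trans (by gcongr)

lemma Mx.JJbox {τ r : ℝ} {F0 : Y3 → ℝ} {E B : Fin 3 → Y3 → ℝ} {a b : Fin 3 → E3 → ℝ} {c : E3 → ℝ} (M : Mx τ r F0 E B a b c)
    {k : E3 → ℝ} (hk : KC k) (i : Fin 3) {δ t h : ℝ} (P : Par δ τ t h) (x : E3) :
    |JJ δ t x (cut h t (ip 1)) (fun _ => 1) (_root_.box (res (PPx k F0 B a i)) (fun l => res (cv (dk (e3 l) k) (E i))))| ≤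
      |II δ t x (cut h t (ip 1)) (fun p => a i p.2) (fun q => fderiv ℝ (cv k F0) q (1, 0, 0))|
      + |II δ t x (cut h t (ip 1)) (fun p => c p.2) (fun q => fderiv ℝ (cv k F0) q (0, e3 i, 0))|
      + |II δ t x (cut h t (ip 1)) (fun p => b (i+2) p.2) (fun q => fderiv ℝ (cv k F0) q (0, e3 (i+1), 0))|
      + |II δ t x (cut h t (ip 1)) (fun p => b (i+1) p.2) (fun q => fderiv ℝ (cv k F0) q (0, e3 (i+2), 0))| := by
  have hG : G1 τ r (cv k F0) := ⟨cv_C1 hk M.hf.c, cv_XS k M.hf.z⟩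
  have J := fun {m : E3 → ℝ} (hm : ContDiff ℝ (⊤ : ℕ∞) m) (d : Y3) => JJ_mom P.cfg (cutQ P.hh 1).q0 x hm (XS_fd hG d)
  obtain ⟨j1, i1⟩ := J (M.ha i) (1, 0, 0)
  obtain ⟨j2, i2⟩ := J M.hc (0, e3 i, 0)
  obtain ⟨j3, i3⟩ := J (M.hb (i+2)) (0, e3 (i+1), 0)
  obtain ⟨j4, i4⟩ := J (M.hb (i+1)) (0, e3 (i+2), 0)
  have e : JJ δ t x (cut h t (ip 1)) (fun _ => 1) (_root_.box (res (PPx k F0 B a i)) (fun l => res (cv (dk (e3 l) k) (E i)))) =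
    -(JJ δ t x (cut h t (ip 1)) (fun _ => 1) (res (mom (a i) (fun q => fderiv ℝ (cv k F0) q (1, 0, 0))))
    + JJ δ t x (cut h t (ip 1)) (fun _ => 1) (res (mom c (fun q => fderiv ℝ (cv k F0) q (0, e3 i, 0))))
    + JJ δ t x (cut h t (ip 1)) (fun _ => 1) (res (mom (b (i+2)) (fun q => fderiv ℝ (cv k F0) q (0, e3 (i+1), 0))))
    - JJ δ t x (cut h t (ip 1)) (fun _ => 1) (res (mom (b (i+1)) (fun q => fderiv ℝ (cv k F0) q (0, e3 (i+2), 0))))) := by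
    simp only [JJ]
    rw [← integral_add i1 i2, ← integral_add (i1.fun_add i2) i3, ← integral_sub ((i1.fun_add i2).fun_add i3) i4, ← integral_neg]
    congr 1; ext z
    by_cases hz : ps h (t - phi δ z) = 0
    · simp [cut, hz]
    · obtain ⟨h1, -, -⟩ := cut_pt P.hδ P.hh x z hz
      have hφ := phi_pos P.hδ z
      rw [M.box hk i (y := (t - phi δ z, x + z)) ⟨⟨by have := P.hh; linarith, by have := P.ht; linarith⟩, mem_univ _⟩]
      simp only [res, bx]; ring
  rw [e, abs_neg, j1, j2, j3, j4]
  refine (abs_sub _ _).trans (add_le_add ?_ le_rfl)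
  exact abs_add_three _ _ _
end

noncomputable section


structure Mol (ε : ℝ) (k : E3 → ℝ) : Prop where
  kc : KC k
  nn : ∀ y, 0 ≤ k y
  int : ∫ y, k y = 1
  sp : ∀ y, ε < ‖y‖ → k y = 0

lemma exists_Mol {ε : ℝ} (hε : 0 < ε) : ∃ k, Mol ε k := by
  let b : ContDiffBump (0 : E3) := ⟨ε / 2, ε, by positivity, by linarith⟩
  refine ⟨b.normed volume, ⟨b.contDiff_normed, b.hasCompactSupport_normed⟩, fun y => b.nonneg_normed y, b.integral_normed, fun y hy => ?_⟩
  by_contra h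
  have : y ∈ Function.support (b.normed volume) := h
  rw [b.support_normed_eq] at this
  simp [b] at this; linarith

lemma Mol.int' {ε : ℝ} {k : E3 → ℝ} (h : Mol ε k) : Integrable k :=
  h.kc.c.continuous.integrable_of_hasCompactSupport h.kc.s

lemma Mol.cx_le {ε : ℝ} {k : E3 → ℝ} (h : Mol ε k) {V : E3 → ℝ} {x : E3} {N : ℝ} 
    (hV : ∀ y, ‖y‖ ≤ ε → |V (x - y)| ≤ N) : |cx k V x| ≤ N := by
  have e : N = ∫ y, k y * N := by rw [integral_mul_const, h.int, one_mul]
  rw [e, ← Real.norm_eq_abs]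
  refine norm_integral_le_of_norm_le (h.int'.mul_const N) (Eventually.of_forall fun y => ?_)
  rw [Real.norm_eq_abs, abs_mul, abs_of_nonneg (h.nn y)]
  rcases le_or_gt ‖y‖ ε with h1 | h1
  · exact mul_le_mul_of_nonneg_left (hV y h1) (h.nn y)
  · simp [h.sp y h1]

lemma Mol.cv_le {ε : ℝ} {k : E3 → ℝ} (h : Mol ε k) {F : Y3 → ℝ} {p : Y3} {N : ℝ} 
    (hV : ∀ y, ‖y‖ ≤ ε → |F (p.1, p.2.1 - y, p.2.2)| ≤ N) : |cv k F p| ≤ N := h.cx_le hV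

lemma Mol.cv_near {ε : ℝ} {k : E3 → ℝ} (h : Mol ε k) {Ω : Set Y3} (hΩ : OK Ω) {F : Y3 → ℝ} (hF : ContinuousOn F Ω) {p : Y3} (hp : p ∈ Ω) {N : ℝ} 
    (hV : ∀ y, ‖y‖ ≤ ε → |F (p.1, p.2.1 - y, p.2.2) - F p| ≤ N) : |cv k F p - F p| ≤ N := by
  have e : cv k F p - F p = cv k (fun q => F q - F p) p := by
    rw [cv_sub hΩ h.kc hF continuousOn_const hp]
    congr 1
    simp only [cv, cx]
    rw [integral_mul_const, h.int, one_mul]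
  rw [e]
  exact h.cv_le hV

/-- Passing to the limit in the mollification parameter. -/
lemma mol_lim {Ω : Set Y3} (hΩ : OK Ω) {F : Y3 → ℝ} (hF : ContinuousOn F Ω) {p : Y3} (hp : p ∈ Ω) {R ε0 : ℝ} (hε0 : 0 < ε0)
    (h : ∀ ε k, 0 < ε → ε ≤ ε0 → Mol ε k → |cv k F p| ≤ R) : |F p| ≤ R := by
  refine le_of_forall_pos_le_add fun e he => ?_
  have hc : Continuous fun y : E3 => F (p.1, p.2.1 - y, p.2.2) :=
    hF.comp_continuous (f := fun y : E3 => ((p.1, p.2.1 - y, p.2.2) : Y3)) (by fun_prop) (fun y => hΩ.m hp rfl)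
  obtain ⟨d, hd, hdd⟩ := Metric.continuous_iff.1 hc 0 e he
  have hε : 0 < min ε0 (d / 2) := by positivity
  obtain ⟨k, hk⟩ := exists_Mol hε
  have h1 := h _ k hε (min_le_left _ _) hk
  have h2 : |cv k F p - F p| ≤ e := by
    refine hk.cv_near hΩ hF hp fun y hy => ?_
    have := hdd y (by rw [dist_zero_right]; have := min_le_right ε0 (d/2); linarith)
    rw [Real.dist_eq] at this
    simpa using this.le
  have := abs_sub_abs_le_abs_sub (F p) (cv k F p)
  rw [abs_sub_comm] at this
  linarith

lemma evIB {τ D : ℝ} (hτ : 0 < τ) {Φ : Y3 → ℝ} (hΦ : ContinuousOn Φ (Omc τ)) (h0 : ∀ y ξ, |Φ (0, y, ξ)| ≤ D) (t r : ℝ) (x : E3) :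
    ∀ᶠ h in 𝓝[>] (0:ℝ), IB t h x r Φ (D + 1) := by
  have hK : IsCompact (Icc 0 (τ/2) ×ˢ (closedBall x t ×ˢ closedBall (0:E3) r) : Set Y3) :=
    isCompact_Icc.prod ((isCompact_closedBall _ _).prod (isCompact_closedBall _ _))
  have hu := hK.uniformContinuousOn_of_continuous (hΦ.mono (fun p hp => ⟨⟨hp.1.1, by linarith [hp.1.2]⟩, mem_univ _⟩))
  obtain ⟨d, hd, hdd⟩ := Metric.uniformContinuousOn_iff.1 hu 1 one_pos
  have hm : 0 < min d (τ / 2) := by positivity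
  filter_upwards [Ioo_mem_nhdsGT hm] with h hh s y ξ hs hsh hy hξ
  have hh1 : h < d := hh.2.trans_le (min_le_left _ _)
  have hh2 : h < τ / 2 := hh.2.trans_le (min_le_right _ _)
  have := hdd (s, y, ξ) ⟨⟨hs.le, by linarith⟩, by simpa [dist_eq_norm] using hy, by simpa using hξ⟩
    (0, y, ξ) ⟨⟨le_rfl, by linarith⟩, by simpa [dist_eq_norm] using hy, by simpa using hξ⟩
    (by simp [Prod.dist_eq, abs_of_pos hs]; exact ⟨by linarith, hd⟩)
  rw [Real.dist_eq] at this
  have h2 := abs_sub_abs_le_abs_sub (Φ (s, y, ξ)) (Φ (0, y, ξ))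
  linarith [h0 y ξ]

lemma mom_le {m : E3 → ℝ} (hm : Continuous m) (r : ℝ) : ∃ C : ℝ, 0 < C ∧ ∀ (G : Y3 → ℝ) (p : Y3) (D : ℝ), XS r G →
    (∀ ξ, ‖ξ‖ ≤ r → |G (p.1, p.2.1, ξ)| ≤ D) → 0 ≤ D → |mom m G p| ≤ C * D := by
  obtain ⟨b, hb, hbs, hb1⟩ := exists_cutoff r
  have hi : Integrable fun ξ => |m ξ * b ξ| := ((hm.mul hb).integrable_of_hasCompactSupport hbs.mul_left).abs
  have h0 : 0 ≤ ∫ ξ, |m ξ * b ξ| := integral_nonneg fun _ => abs_nonneg _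
  refine ⟨(∫ ξ, |m ξ * b ξ|) + 1, by linarith, fun G p D hG hD hD0 => ?_⟩
  rw [mom_cut hb1 hG, mom, ← Real.norm_eq_abs]
  refine (norm_integral_le_of_norm_le (hi.mul_const D) (Eventually.of_forall fun ξ => ?_)).trans ?_
  · rw [Real.norm_eq_abs, abs_mul]
    rcases le_or_gt ‖ξ‖ r with h1 | h1
    · exact mul_le_mul_of_nonneg_left (hD ξ h1) (abs_nonneg _)
    · rw [hG (p.1, p.2.1, ξ) h1, abs_zero, mul_zero]; positivity
  · rw [integral_mul_const]
    nlinarith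

def DB (k : E3 → ℝ) (F : Y3 → ℝ) (D : ℝ) : Prop := ∀ y ξ, |cv k F (0, y, ξ)| ≤ D

section
variable {τ r : ℝ} {F0 : Y3 → ℝ} {E B : Fin 3 → Y3 → ℝ} {a b : Fin 3 → E3 → ℝ} {c : E3 → ℝ}

lemma Mx.FB (M : Mx τ r F0 E B a b c) (hr : 0 ≤ r) (hτ : 0 < τ) (cF : ContinuousOn F0 (Omc τ))
    (cE : ∀ i, ContinuousOn (E i) (Omc τ)) (cB : ∀ i, ContinuousOn (B i) (Omc τ)) : ∃ C : ℝ, 0 < C ∧ ∀ {k : E3 → ℝ} {i : Fin 3} {D : ℝ}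
    {t : ℝ} {x : E3} {Bd : ℝ}, KC k → 0 ≤ D →
    DB k (E i) D → (∀ l, DB (dk (e3 l) k) (E i) D) → (∀ l j, DB (dk (e3 l) k) (B j) D) → DB k F0 D → 0 < t → t < τ →
    (∀ᶠ h in 𝓝[>] (0:ℝ), ∀ δ, Par δ τ t h →
      |JJ δ t x (cut h t (ip 1)) (fun _ => 1) (_root_.box (res (PPx k F0 B a i)) (fun l => res (cv (dk (e3 l) k) (E i))))| ≤ Bd) →
    |cv k (E i) (t, x, 0)| ≤ C * (Bd + D + 1) := by
  choose Cm hCm hm using fun i => mom_le (M.ha i).continuous r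
  have hS := S3_nonneg
  have hc := c0_pos
  set Cs := ∑ i, Cm i with hCs
  have hCs0 : 0 ≤ Cs := Finset.sum_nonneg fun i _ => (hCm i).le
  have hle : ∀ i, Cm i ≤ Cs := fun i => Finset.single_le_sum (fun i _ => (hCm i).le) (Finset.mem_univ i)
  refine ⟨c0⁻¹ * (1 + (3 + Cs) * S3 * (24 * τ + 12)), by positivity, ?_⟩
  intro k i D t x Bd hk hD dE dQ dQB dF ht htτ hJ
  have p0 : ∀ y ξ : E3, ((0, y, ξ) : Y3) ∈ Omc τ := fun y ξ => ⟨⟨le_rfl, hτ⟩, mem_univ _⟩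
  have dP : ∀ y ξ, |PPx k F0 B a i (0, y, ξ)| ≤ (2 + Cs) * D := by
    intro y ξ
    unfold PPx
    rw [cv_mom (OK_Omc τ) hk (M.ha i).continuous cF M.hf.z (p0 y ξ)]
    have h1 := hm i (cv k F0) (0, y, ξ) D (cv_XS k M.hf.z) (fun ξ _ => dF y ξ) hD
    have h2 := dQB (i+1) (i+2) y ξ
    have h3 := dQB (i+2) (i+1) y ξ
    have h4 := abs_sub (cv (dk (e3 (i+1)) k) (B (i+2)) (0, y, ξ) - cv (dk (e3 (i+2)) k) (B (i+1)) (0, y, ξ)) (mom (a i) (cv k F0) (0, y, ξ))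
    have h5 := abs_sub (cv (dk (e3 (i+1)) k) (B (i+2)) (0, y, ξ)) (cv (dk (e3 (i+2)) k) (B (i+1)) (0, y, ξ))
    have h6 := mul_le_mul_of_nonneg_right (hle i) hD
    linarith
  have cP : ContinuousOn (PPx k F0 B a i) (Omc τ) :=
    ((cv_cont (OK_Omc τ) (hk.dk _) (cB _)).sub (cv_cont (OK_Omc τ) (hk.dk _) (cB _))).sub
      (cv_cont (OK_Omc τ) hk (mom_cont (OK_Omc τ) (M.ha i).continuous cF M.hf.z))
  have v1 := evIB hτ (cv_cont (OK_Omc τ) hk (cE i)) dE t r x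
  have v2 := evIB hτ cP dP t r x
  have v3 := eventually_all.2 fun l => evIB hτ (cv_cont (OK_Omc τ) (hk.dk (e3 l)) (cE i)) (dQ l) t r x
  obtain ⟨h, hJh, w1, w2, w3, hh⟩ := (hJ.and (v1.and (v2.and (v3.and (Ioo_mem_nhdsGT (show (0:ℝ) < t / 2 by linarith)))))).exists
  set D' := (3 + Cs) * (D + 1) with hD'
  have hD'0 : 0 ≤ D' := by positivity
  have d1 : D + 1 ≤ D' := by rw [hD']; nlinarith
  have d2 : (2 + Cs) * D + 1 ≤ D' := by rw [hD']; nlinarith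
  have r0 : ‖(0:E3)‖ ≤ r := by simpa using hr
  have := kirch_bound hh.1 hh.2.le htτ x (M.wav hk i) hD'0 (fun s y h1 h2 h3 => (w1 s y 0 h1 h2 h3 r0).trans d1)
    (fun s y h1 h2 h3 => (w2 s y 0 h1 h2 h3 r0).trans d2) (fun l s y h1 h2 h3 => (w3 l s y 0 h1 h2 h3 r0).trans d1) hJh
  have hBd : 0 ≤ Bd := (abs_nonneg _).trans (hJh (t/4) ⟨by linarith, le_rfl, hh.1, hh.2.le, htτ⟩)
  rw [mul_assoc, ← div_eq_inv_mul, le_div_iff₀ hc]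
  have e1 : res (cv k (E i)) (t, x) = cv k (E i) (t, x, 0) := rfl
  rw [e1] at this
  have e2 : D' * S3 * (24 * t + 12) ≤ D' * S3 * (24 * τ + 12) := by gcongr
  have e3' : 0 ≤ (3 + Cs) * S3 * (24 * τ + 12) := by positivity
  calc _ = c0 * |cv k (E i) (t, x, 0)| := mul_comm _ _
    _ ≤ Bd + D' * S3 * (24 * τ + 12) := by linarith
    _ ≤ _ := by rw [hD']; nlinarith [mul_nonneg e3' hBd]
end
end

noncomputable section


def CBe (t ε : ℝ) (x : E3) (r : ℝ) (g : Y3 → ℝ) (b : ℝ → ℝ) : Prop :=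
  ∀ s y ξ, 0 < s → s ≤ t → ‖y - x‖ ≤ t - s + ε → ‖ξ‖ ≤ r → |g (s, y, ξ)| ≤ b s

lemma Mol.CB {ε ε' : ℝ} {k : E3 → ℝ} (h : Mol ε' k) (hε : ε' ≤ ε) {t : ℝ} {x : E3} {r : ℝ} {g : Y3 → ℝ} {b : ℝ → ℝ}
    (hg : CBe t ε x r g b) : CBd t x r (cv k g) b := by
  intro s y ξ hs hy hξ
  refine h.cv_le fun z hz => hg s (y - z) ξ hs (by linarith [norm_nonneg (y - x)]) ?_ hξ
  have : y - z - x = (y - x) - z := by abel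
  rw [this]
  linarith [norm_sub_le (y - x) z]

lemma CBe_of {τ t ε : ℝ} {x : E3} {r : ℝ} {g : Y3 → ℝ} {m : ℝ} (ht : t < τ) (h : ∀ p ∈ Om τ, |g p| ≤ m) : CBe t ε x r g (fun _ => m) :=
  fun _ _ _ h1 h2 _ _ => h _ ⟨⟨h1, by simp only []; linarith⟩, mem_univ _⟩

lemma Mol.IB {ε : ℝ} {k : E3 → ℝ} (hk : Mol ε k) {τ t h : ℝ} {x : E3} {r : ℝ} {g : Y3 → ℝ} {m : ℝ} (hh : h < τ) (hg : ∀ p ∈ Om τ, |g p| ≤ m) : 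
    _root_.IB t h x r (cv k g) m :=
  fun s y ξ h1 h2 _ _ => hk.cv_le fun z _ => hg _ ⟨⟨h1, by simp only []; linarith⟩, mem_univ _⟩

lemma cv_zero (k : E3 → ℝ) : cv k (fun _ => 0) = fun _ => 0 := by
  ext p; simp [cv, cx]

section
variable {τ r : ℝ} {F0 : Y3 → ℝ} {E B : Fin 3 → Y3 → ℝ} {a b : Fin 3 → E3 → ℝ} {c : E3 → ℝ}

lemma Mx.lev0 (M : Mx τ r F0 E B a b c) (hr : 0 ≤ r) (hτ : 0 < τ) (cF : ContinuousOn F0 (Omc τ))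
    (cE : ∀ i, ContinuousOn (E i) (Omc τ)) (cB : ∀ i, ContinuousOn (B i) (Omc τ)) {D m : ℝ} (hD : 0 ≤ D) (hm : 0 ≤ m)
    (hI : ∀ ε k, Mol ε k → (∀ i, DB k (E i) D) ∧ (∀ l i, DB (dk (e3 l) k) (E i) D) ∧ (∀ l i, DB (dk (e3 l) k) (B i) D) ∧ DB k F0 D)
    {H : Fin 3 → Y3 → ℝ} (T : Trip τ r F0 (fun _ => 0) H) (hF : ∀ p ∈ Om τ, |F0 p| ≤ m) :
    ∃ C : ℝ, 0 < C ∧ ∀ {i : Fin 3} {t ε : ℝ} {x : E3} {N lam : ℝ}, 0 < t → t < τ → 0 < ε → 0 ≤ N → 0 < lam →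
    (∀ l, CBe t ε x r (H l) (fun s => N * exp (lam * s))) → |E i (t, x, 0)| ≤ C * (1 + N * exp (lam * t) / lam) := by
  obtain ⟨C1, hC1, h1⟩ := M.FB hr hτ cF cE cB
  have sm : ∀ {m : E3 → ℝ}, ContDiff ℝ (⊤ : ℕ∞) m → SU (fun p => m p.2) := fun hm => SU.of (hm.comp contDiff_snd)
  choose Ca hCa ha using fun i => L0 (sm (M.ha i)) hr hτ 1 0
  choose Cb hCb hb using fun i => L0 (sm M.hc) hr hτ 0 (e3 i)
  choose Cc hCc hc using fun i : Fin 3 => L0 (sm (M.hb (i+2))) hr hτ 0 (e3 (i+1))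
  choose Cd hCd hd using fun i : Fin 3 => L0 (sm (M.hb (i+1))) hr hτ 0 (e3 (i+2))
  set Cs := ∑ i, (Ca i + Cb i + Cc i + Cd i) with hCs
  have hpos : ∀ i, 0 ≤ Ca i + Cb i + Cc i + Cd i := fun i => by
    linarith [hCa i, hCb i, hCc i, hCd i]
  have hCs0 : 0 ≤ Cs := Finset.sum_nonneg fun i _ => hpos i
  have hle : ∀ i, Ca i + Cb i + Cc i + Cd i ≤ Cs := fun i => Finset.single_le_sum (fun i _ => hpos i) (Finset.mem_univ i)
  refine ⟨C1 * (Cs * (m + 1) + D + 1), by positivity, ?_⟩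
  intro i t ε x N lam ht htτ hε hN hl hH
  refine mol_lim (OK_Omc τ) (cE i) ⟨⟨ht.le, htτ⟩, mem_univ _⟩ hε fun ε' k hε' hεε hk => ?_
  obtain ⟨i1, i2, i3, i4⟩ := hI ε' k hk
  have hT : Trip τ r (cv k F0) (fun _ => 0) (fun l => cv k (H l)) := by
    have := T.cv hk.kc; rwa [cv_zero] at this
  set X := m + N * exp (lam * t) / lam with hX
  have h0 : 0 ≤ N * exp (lam * t) / lam := by positivity
  have hX0 : 0 ≤ X := by positivity
  refine (h1 (Bd := Cs * X) hk.kc hD (i1 i) (fun l => i2 l i) i3 i4 ht htτ ?_).trans ?_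
  · filter_upwards [Ioo_mem_nhdsGT hτ] with h hh δ P
    refine (M.JJbox hk.kc i P x).trans ?_
    have bg : CBd t x r (cv k F0) (fun _ => m) := hk.CB hεε (CBe_of htτ hF)
    have ig : IB t h x r (cv k F0) m := hk.IB hh.2 hF
    have bK : CBd t x r (fun _ => 0) (fun s => m + N * exp (lam * s)) := fun s _ _ _ _ _ => by
      rw [abs_zero]; positivity
    have bH : ∀ l, CBd t x r (cv k (H l)) (fun s => m + N * exp (lam * s)) := fun l s y ξ u1 u2 u3 =>
      (hk.CB hεε (hH l) s y ξ u1 u2 u3).trans (by simp only []; linarith)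
    have k1 := ha i P hT hm hN hl bg ig bK bH
    have k2 := hb i P hT hm hN hl bg ig bK bH
    have k3 := hc i P hT hm hN hl bg ig bK bH
    have k4 := hd i P hT hm hN hl bg ig bK bH
    have := mul_le_mul_of_nonneg_right (hle i) hX0
    linarith
  · rw [mul_assoc]
    refine mul_le_mul_of_nonneg_left ?_ hC1.le
    rw [hX]
    have q1 : Cs * (m + N * exp (lam * t) / lam) ≤ Cs * ((m + 1) * (1 + N * exp (lam * t) / lam)) :=
      mul_le_mul_of_nonneg_left (by nlinarith) hCs0
    nlinarith

lemma Mx.lev1 (M : Mx τ r F0 E B a b c) (hr : 0 ≤ r) (hτ : 0 < τ) (cF : ContinuousOn F0 (Omc τ))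
    (cE : ∀ i, ContinuousOn (E i) (Omc τ)) (cB : ∀ i, ContinuousOn (B i) (Omc τ)) {D m : ℝ} (hD : 0 ≤ D) (hm : 0 ≤ m)
    (j : Fin 3)
    (hI : ∀ ε k, Mol ε k → (∀ i, DB (dk (e3 j) k) (E i) D) ∧ (∀ l i, DB (dk (e3 l) (dk (e3 j) k)) (E i) D) ∧
      (∀ l i, DB (dk (e3 l) (dk (e3 j) k)) (B i) D) ∧ DB (dk (e3 j) k) F0 D)
    {H K : Fin 3 → Y3 → ℝ} {H' : Fin 3 → Fin 3 → Y3 → ℝ} (T : Trip τ r F0 (fun _ => 0) H) (T' : ∀ l, Trip τ r (H l) (K l) (H' l))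
    (hF : ∀ p ∈ Om τ, |F0 p| ≤ m) (hH : ∀ l, ∀ p ∈ Om τ, |H l p| ≤ m) (hH' : ∀ l n, ∀ p ∈ Om τ, |H' l n p| ≤ m) :
    ∃ C : ℝ, 0 < C ∧ ∀ {i : Fin 3} {t ε : ℝ} {x : E3} {N lam L : ℝ}, 0 < t → t < τ → 0 < ε → 0 ≤ N → 0 < lam → 0 ≤ L →
    (∀ l, CBe t ε x r (K l) (fun s => m + N * exp (lam * s))) → CBe t ε x r (fun p => fderiv ℝ F0 p (0, e3 j, 0)) (fun _ => L) →
    |fderiv ℝ (E i) (t, x, 0) (0, e3 j, 0)| ≤ C * ((1 + Real.log (1 + L)) + N * exp (lam * t) / lam) := by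
  obtain ⟨C1, hC1, h1⟩ := M.FB hr hτ cF cE cB
  have sm : ∀ {m : E3 → ℝ}, ContDiff ℝ (⊤ : ℕ∞) m → SU (fun p => m p.2) := fun hm => SU.of (hm.comp contDiff_snd)
  choose Ca hCa ha using fun i => L1 (sm (M.ha i)) hr hτ 1 0 (e3 j)
  choose Cb hCb hb using fun i => L1 (sm M.hc) hr hτ 0 (e3 i) (e3 j)
  choose Cc hCc hc using fun i : Fin 3 => L1 (sm (M.hb (i+2))) hr hτ 0 (e3 (i+1)) (e3 j)
  choose Cd hCd hd using fun i : Fin 3 => L1 (sm (M.hb (i+1))) hr hτ 0 (e3 (i+2)) (e3 j)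
  set Cs := ∑ i, (Ca i + Cb i + Cc i + Cd i) with hCs
  have hpos : ∀ i, 0 ≤ Ca i + Cb i + Cc i + Cd i := fun i => by
    linarith [hCa i, hCb i, hCc i, hCd i]
  have hCs0 : 0 ≤ Cs := Finset.sum_nonneg fun i _ => hpos i
  have hle : ∀ i, Ca i + Cb i + Cc i + Cd i ≤ Cs := fun i => Finset.single_le_sum (fun i _ => hpos i) (Finset.mem_univ i)
  refine ⟨C1 * (Cs * (1 + m + (D + 1)) + D + 1), by positivity, ?_⟩
  intro i t ε x N lam L ht htτ hε hN hl hL hK hfd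
  have hpt : ((t, x, 0) : Y3) ∈ Om τ := ⟨⟨ht, htτ⟩, mem_univ _⟩
  refine mol_lim (OK_Om τ) (F := fun q => fderiv ℝ (E i) q (0, e3 j, 0)) (fd_cont (M.hE i) _) hpt hε fun ε' k hε' hεε hk => ?_
  rw [← cv_dk hk.kc (M.hE i) hpt]
  obtain ⟨i1, i2, i3, i4⟩ := hI ε' k hk
  have hT : Trip τ r (cv (dk (e3 j) k) F0) (fun _ => 0) (fun l => cv (dk (e3 j) k) (H l)) := by
    have := T.cv (hk.kc.dk (e3 j)); rwa [cv_zero] at this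
  have hT0 : Trip τ r (cv k F0) (fun _ => 0) (fun l => cv k (H l)) := by
    have := T.cv hk.kc; rwa [cv_zero] at this
  have hT' := fun l => (T' l).cv hk.kc
  have eg : ∀ p ∈ Om τ, cv (dk (e3 j) k) F0 p = fderiv ℝ (cv k F0) p (0, e3 j, 0) := fun p hp => by
    rw [cv_dk hk.kc M.hf.c hp, cv_fd hk.kc M.hf.c hp]
  have eH : ∀ l, ∀ p ∈ Om τ, cv (dk (e3 j) k) (H l) p = fderiv ℝ (cv k (H l)) p (0, e3 j, 0) := fun l p hp => by
    rw [cv_dk hk.kc (T.hH l).c hp, cv_fd hk.kc (T.hH l).c hp]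
  set X := (1 + m + (D + 1)) * (1 + Real.log (1 + L)) + N * exp (lam * t) / lam with hX
  have h0 : 0 ≤ N * exp (lam * t) / lam := by positivity
  have hlog : 0 ≤ Real.log (1 + L) := Real.log_nonneg (by linarith)
  have hX0 : 0 ≤ X := by positivity
  refine (h1 (Bd := Cs * X) (hk.kc.dk _) hD (i1 i) (fun l => i2 l i) i3 i4 ht htτ ?_).trans ?_
  · filter_upwards [Ioo_mem_nhdsGT hτ, evIB hτ (cv_cont (OK_Omc τ) (hk.kc.dk (e3 j)) cF) i4 t r x] with h hh hIB δ P
    refine (M.JJbox (hk.kc.dk _) i P x).trans ?_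
    have b0 : CBd t x r (cv k F0) (fun _ => m) := hk.CB hεε (CBe_of htτ hF)
    have bH : ∀ l, CBd t x r (cv k (H l)) (fun _ => m) := fun l => hk.CB hεε (CBe_of htτ (hH l))
    have iH : ∀ l, IB t h x r (cv k (H l)) m := fun l => hk.IB hh.2 (hH l)
    have bK : ∀ l, CBd t x r (cv k (K l)) (fun s => m + N * exp (lam * s)) := fun l => hk.CB hεε (hK l)
    have bH' : ∀ l n, CBd t x r (cv k (H' l n)) (fun _ => m) := fun l n => hk.CB hεε (CBe_of htτ (hH' l n))
    have ig : IB t h x r (fun p => fderiv ℝ (cv k F0) p (0, e3 j, 0)) (D + 1) := fun s y ξ u1 u2 u3 u4 => by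
      simp only []
      rw [← eg _ ⟨⟨u1, by simp only []; linarith [hh.2]⟩, mem_univ _⟩]
      exact hIB s y ξ u1 u2 u3 u4
    have bg : CBd t x r (fun p => fderiv ℝ (cv k F0) p (0, e3 j, 0)) (fun _ => L) := fun s y ξ u1 u2 u3 => by
      simp only []
      rw [cv_fd hk.kc M.hf.c (p := (s, y, ξ)) ⟨⟨u1, by simp only []; linarith [norm_nonneg (y - x)]⟩, mem_univ _⟩]
      exact hk.CB hεε hfd s y ξ u1 u2 u3
    have hD1 : 0 ≤ D + 1 := by linarith
    have k1 := ha i P hT hT0 hT' eg eH hm hD1 hN hl hL b0 bH iH bK bH' ig bg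
    have k2 := hb i P hT hT0 hT' eg eH hm hD1 hN hl hL b0 bH iH bK bH' ig bg
    have k3 := hc i P hT hT0 hT' eg eH hm hD1 hN hl hL b0 bH iH bK bH' ig bg
    have k4 := hd i P hT hT0 hT' eg eH hm hD1 hN hl hL b0 bH iH bK bH' ig bg
    have := mul_le_mul_of_nonneg_right (hle i) hX0
    linarith
  · rw [mul_assoc]
    refine mul_le_mul_of_nonneg_left ?_ hC1.le
    rw [hX]
    have q1 : Cs * ((1 + m + (D + 1)) * (1 + Real.log (1 + L)) + N * exp (lam * t) / lam) ≤
        Cs * ((1 + m + (D + 1)) * ((1 + Real.log (1 + L)) + N * exp (lam * t) / lam)) :=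
      mul_le_mul_of_nonneg_left (by nlinarith) hCs0
    nlinarith
end
end

noncomputable section

lemma closing {T : ℝ} {e : ℝ → E3 → ℝ} {C Λ : ℝ} (hT : 0 ≤ T)
    (hc : ContinuousOn (fun p : ℝ × E3 => e p.1 p.2) (Icc 0 T ×ˢ univ))
    (hC : 0 < C) (hΛ : 0 ≤ Λ) (h0 : ∀ x, e 0 x ≤ C * Λ) (hpos : ∀ s y, 0 ≤ e s y)
    (H : ∀ t x ε N lam, 0 < t → t ≤ T → 0 < ε → 0 ≤ N → 0 < lam →
      (∀ s y, 0 < s → s ≤ t → ‖y - x‖ ≤ t - s + ε → e s y ≤ N * exp (lam * s)) →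
      e t x ≤ C * (Λ + N * exp (lam * t) / lam)) (x : E3) :
    e T x ≤ (2 * C * Λ + 1) * exp (2 * C * T) := by
  set lam := 2 * C with hlam
  have hl : 0 < lam := by positivity
  set g : ℝ × E3 → ℝ := fun p => e (max 0 (min T p.1)) p.2 * exp (-(lam * max 0 (min T p.1))) with hg
  have hmem : ∀ s : ℝ, max 0 (min T s) ∈ Icc 0 T := fun s => ⟨le_max_left _ _, max_le hT (min_le_left _ _)⟩
  have hgc : Continuous g := by
    refine Continuous.mul ?_ (by fun_prop)
    refine hc.comp_continuous (f := fun p : ℝ × E3 => (max 0 (min T p.1), p.2)) (by fun_prop) fun p => ⟨hmem _, mem_univ _⟩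
  have hge : ∀ s y, 0 ≤ s → s ≤ T → g (s, y) = e s y * exp (-(lam * s)) := fun s y h1 h2 => by
    simp only [hg, min_eq_right h2, max_eq_right h1]
  set K0 : Set (ℝ × E3) := {p | 0 ≤ p.1 ∧ p.1 ≤ T ∧ ‖p.2 - x‖ ≤ T - p.1} with hK0
  have hKc : IsCompact K0 := by
    refine (isCompact_Icc.prod (isCompact_closedBall x T)).of_isClosed_subset (s := Icc 0 T ×ˢ closedBall x T) ?_ ?_
    · have c1 : IsClosed {p : ℝ × E3 | 0 ≤ p.1} := isClosed_le (by fun_prop) (by fun_prop)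
      have c2 : IsClosed {p : ℝ × E3 | p.1 ≤ T} := isClosed_le (by fun_prop) (by fun_prop)
      have c3 : IsClosed {p : ℝ × E3 | ‖p.2 - x‖ ≤ T - p.1} := isClosed_le (by fun_prop) (by fun_prop)
      exact c1.inter (c2.inter c3)
    · rintro ⟨s, y⟩ ⟨h1, h2, h3⟩
      refine ⟨⟨h1, h2⟩, ?_⟩
      simp only [mem_closedBall, dist_eq_norm] at *
      linarith
  have hTx : (T, x) ∈ K0 := ⟨hT, le_rfl, by simp⟩
  obtain ⟨⟨s0, y0⟩, ⟨u1, u2, u3⟩, hmax⟩ := hKc.exists_isMaxOn ⟨_, hTx⟩ hgc.continuousOn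
  simp only [] at u1 u2 u3
  set N := g (s0, y0) with hN
  have hNe : N = e s0 y0 * exp (-(lam * s0)) := hge _ _ u1 u2
  have hN0 : 0 ≤ N := by rw [hNe]; exact mul_nonneg (hpos _ _) (exp_pos _).le
  have key : N ≤ 2 * C * Λ + 1 := by
    rcases u1.eq_or_lt with rfl | hs
    · rw [hNe]; simp only [mul_zero, neg_zero, exp_zero, mul_one]
      have := h0 y0
      nlinarith [mul_nonneg hC.le hΛ]
    · obtain ⟨ε, hε, hsub⟩ := hKc.exists_cthickening_subset_open (t := {p | g p < N + 1})
        (isOpen_lt hgc continuous_const) (fun p hp => by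
          have : g p ≤ N := hmax hp
          exact lt_of_le_of_lt this (by linarith))
      have := H s0 y0 ε (N + 1) lam hs u2 hε (by linarith) hl fun s y v1 v2 v3 => by
        have v4 : ‖y - x‖ ≤ T - s + ε := by
          have := norm_add_le (y - y0) (y0 - x)
          simp only [sub_add_sub_cancel] at this
          linarith
        have hsT : 0 ≤ T - s := by linarith
        have hp : 0 < T - s + ε := by linarith
        have v5 : (s, y) ∈ cthickening ε K0 := by
          refine mem_cthickening_of_dist_le (s, y) (s, x + ((T - s) / (T - s + ε)) • (y - x)) ε K0 ⟨v1.le, by simp only []; linarith, ?_⟩ ?_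
          · simp only [add_sub_cancel_left, norm_smul, Real.norm_eq_abs]
            rw [abs_of_nonneg (by positivity), div_mul_eq_mul_div, div_le_iff₀ hp]
            exact mul_le_mul_of_nonneg_left v4 hsT
          · rw [Prod.dist_eq]
            simp only [dist_self, dist_eq_norm]
            refine max_le hε.le ?_
            have : y - (x + ((T - s) / (T - s + ε)) • (y - x)) = (ε / (T - s + ε)) • (y - x) := by
              have : ε / (T - s + ε) = 1 - (T - s) / (T - s + ε) := by field_simp; ring
              rw [this, sub_smul, one_smul]; abel
            rw [this, norm_smul, Real.norm_eq_abs, abs_of_nonneg (by positivity), div_mul_eq_mul_div, div_le_iff₀ hp]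
            exact mul_le_mul_of_nonneg_left v4 hε.le
        have v6 : g (s, y) < N + 1 := hsub v5
        rw [hge s y v1.le (by linarith), exp_neg, ← div_eq_mul_inv, div_lt_iff₀ (exp_pos _)] at v6
        exact v6.le
      have h2 : N ≤ C * Λ + (N + 1) / 2 := by
        rw [hNe, exp_neg, ← div_eq_mul_inv, div_le_iff₀ (exp_pos _), div_eq_mul_inv (e s0 y0), ← exp_neg, ← hNe]
        refine this.trans ?_
        have h3 : C * ((N + 1) * exp (lam * s0) / lam) = (N + 1) / 2 * exp (lam * s0) := by
          rw [hlam]; field_simp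
        have h4 : C * Λ * 1 ≤ C * Λ * exp (lam * s0) :=
          mul_le_mul_of_nonneg_left (one_le_exp (by positivity)) (by positivity)
        rw [mul_add, h3]; linarith
      linarith
  have : g (T, x) ≤ N := hmax hTx
  rw [hge T x hT le_rfl, exp_neg, ← div_eq_mul_inv, div_le_iff₀ (exp_pos _)] at this
  exact this.trans (mul_le_mul_of_nonneg_right key (exp_pos _).le)
end

noncomputable section

lemma maxpr {τ r M : ℝ} {F0 : Y3 → ℝ} {A : Y3 → E3} (hM : 0 ≤ M) (hX : XS r F0)
    (cF : ContinuousOn F0 (Omc τ)) (dF : ∀ p ∈ Om τ, DifferentiableAt ℝ F0 p)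
    (he : ∀ p ∈ Om τ, fderiv ℝ F0 p (1, vrel p.2.2, A p) = 0)
    (h0 : ∀ x ξ, F0 (0, x, ξ) ≤ M) {T : ℝ} (hT : 0 ≤ T) (hTτ : T < τ) (x ξ : E3) : F0 (T, x, ξ) ≤ M := by
  by_cases hξ : r < ‖ξ‖
  · rw [hX (T, x, ξ) hξ]; exact hM
  push Not at hξ
  refine le_of_forall_pos_le_add fun η' hη' => ?_
  set η := η' / (T + 1) with hη_def
  have hη : 0 < η := by positivity
  have hηT : η * T ≤ η' := by
    rw [hη_def, div_mul_eq_mul_div, div_le_iff₀ (by linarith)]; nlinarith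
  set K : Set Y3 := {p | 0 ≤ p.1 ∧ p.1 ≤ T ∧ ‖p.2.1 - x‖ ≤ T - p.1 ∧ ‖p.2.2‖ ≤ r + 1} with hK
  have hKc : IsCompact K := by
    refine (isCompact_Icc.prod ((isCompact_closedBall x T).prod (isCompact_closedBall (0 : E3) (r + 1)))).of_isClosed_subset
      (s := Icc 0 T ×ˢ closedBall x T ×ˢ closedBall (0 : E3) (r + 1)) ?_ ?_
    · have c1 : IsClosed {p : Y3 | 0 ≤ p.1} := isClosed_le (by fun_prop) (by fun_prop)
      have c2 : IsClosed {p : Y3 | p.1 ≤ T} := isClosed_le (by fun_prop) (by fun_prop)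
      have c3 : IsClosed {p : Y3 | ‖p.2.1 - x‖ ≤ T - p.1} := isClosed_le (by fun_prop) (by fun_prop)
      have c4 : IsClosed {p : Y3 | ‖p.2.2‖ ≤ r + 1} := isClosed_le (by fun_prop) (by fun_prop)
      exact c1.inter (c2.inter (c3.inter c4))
    · rintro ⟨s, y, z⟩ ⟨h1, h2, h3, h4⟩
      refine ⟨⟨h1, h2⟩, ?_, ?_⟩
      · simp only [mem_closedBall, dist_eq_norm] at *
        linarith
      · simpa using h4
  have hTx : (T, x, ξ) ∈ K := ⟨hT, le_rfl, by simp, by simp only []; linarith⟩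
  have hgc : ContinuousOn (fun p : Y3 => F0 p - η * p.1) K :=
    (cF.mono fun p hp => ⟨⟨hp.1, hp.2.1.trans_lt hTτ⟩, mem_univ _⟩).sub (by fun_prop)
  obtain ⟨⟨s, y, z⟩, ⟨u1, u2, u3, u4⟩, hmax⟩ := hKc.exists_isMaxOn ⟨_, hTx⟩ hgc
  simp only [] at u1 u2 u3 u4
  have key : F0 (s, y, z) - η * s ≤ M := by
    by_cases hz : r < ‖z‖
    · rw [hX (s, y, z) hz]; nlinarith [mul_nonneg hη.le u1]
    push Not at hz
    rcases u1.eq_or_lt with rfl | hs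
    · have := h0 y z; linarith
    exfalso
    have hp : ((s, y, z) : Y3) ∈ Om τ := ⟨⟨hs, by simp only []; linarith⟩, mem_univ _⟩
    set d : Y3 := (1, vrel z, A (s, y, z)) with hd
    have h1 : HasDerivAt (fun h : ℝ => (s, y, z) + (-h) • d) (-d) 0 := by
      simpa using ((hasDerivAt_id (0:ℝ)).neg.smul_const d).const_add ((s, y, z) : Y3)
    have h2 : HasDerivAt (fun h : ℝ => F0 ((s, y, z) + (-h) • d)) 0 0 := by
      have e0 : ((s, y, z) : Y3) + (-(0:ℝ)) • d = (s, y, z) := by simp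
      have := HasFDerivAt.comp_hasDerivAt (x := (0:ℝ)) (f := fun h : ℝ => ((s, y, z) : Y3) + (-h) • d) (l := F0)
        (l' := fderiv ℝ F0 (s, y, z)) (by simp only [e0]; exact (dF (s, y, z) hp).hasFDerivAt) h1
      have e1 : fderiv ℝ F0 (s, y, z) (-d) = 0 := by rw [map_neg, he (s, y, z) hp, neg_zero]
      rw [e1] at this
      exact this
    have h3 : HasDerivAt (fun h : ℝ => F0 ((s, y, z) + (-h) • d) - η * (s - h)) η 0 := by
      have := h2.fun_sub (((hasDerivAt_id (0:ℝ)).const_sub s).const_mul η)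
      simpa using this
    have h4 := h3.tendsto_slope_zero_right
    have h5 : η ≤ 0 := by
      refine le_of_tendsto h4 ?_
      have hcz : ∀ᶠ h in 𝓝[>] (0:ℝ), ‖z + (-h) • A (s, y, z)‖ < r + 1 := by
        have : ContinuousAt (fun h : ℝ => ‖z + (-h) • A (s, y, z)‖) 0 := by fun_prop
        have h6 := this.eventually_lt (continuousAt_const (y := r + 1)) (by simp only [neg_zero, zero_smul, add_zero]; linarith)
        exact nhdsWithin_le_nhds h6
      filter_upwards [hcz, Ioo_mem_nhdsGT hs, self_mem_nhdsWithin] with h g1 g2 g3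
      have g3 : 0 < h := g3
      have hmem : ((s, y, z) : Y3) + (-h) • d ∈ K := by
        refine ⟨?_, ?_, ?_, ?_⟩
        · simp [hd]; linarith [g2.2]
        · simp [hd]; linarith
        · simp only [hd, Prod.fst_add, Prod.snd_add, Prod.smul_fst, Prod.smul_snd]
          have : ‖y + -h • vrel z - x‖ ≤ ‖y - x‖ + h * 1 := by
            have e : y + -h • vrel z - x = (y - x) + (-h) • vrel z := by abel
            rw [e]
            refine (norm_add_le _ _).trans (add_le_add_right ?_ _)
            rw [norm_smul, norm_neg, Real.norm_eq_abs, abs_of_pos g3]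
            exact mul_le_mul_of_nonneg_left (norm_vrel_lt z).le g3.le
          simp only [smul_eq_mul]
          linarith
        · exact g1.le
      have h7 : F0 ((s, y, z) + (-h) • d) - η * (((s, y, z) : Y3) + (-h) • d).1 ≤ F0 (s, y, z) - η * s := hmax hmem
      have e2 : (((s, y, z) : Y3) + (-h) • d).1 = s - h := by simp [hd]; ring
      rw [e2] at h7
      simp only [zero_add, neg_zero, zero_smul, add_zero, sub_zero, smul_eq_mul]
      exact mul_nonpos_of_nonneg_of_nonpos (inv_nonneg.2 g3.le) (by linarith)
    linarith
  have h8 : F0 (T, x, ξ) - η * T ≤ F0 (s, y, z) - η * s := hmax hTx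
  linarith

lemma fbound {τ r M : ℝ} {F0 : Y3 → ℝ} {A : Y3 → E3} (hM : 0 ≤ M) (hX : XS r F0)
    (cF : ContinuousOn F0 (Omc τ)) (dF : ∀ p ∈ Om τ, DifferentiableAt ℝ F0 p)
    (he : ∀ p ∈ Om τ, fderiv ℝ F0 p (1, vrel p.2.2, A p) = 0)
    (h0 : ∀ x ξ, |F0 (0, x, ξ)| ≤ M) {p : Y3} (hp : p ∈ Omc τ) : |F0 p| ≤ M := by
  refine abs_le'.2 ⟨maxpr hM hX cF dF he (fun x ξ => (abs_le'.1 (h0 x ξ)).1) hp.1.1 hp.1.2 p.2.1 p.2.2, ?_⟩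
  refine maxpr (r := r) (F0 := fun p => - F0 p) (A := A) hM (fun q hq => by simp only [hX q hq, neg_zero]) cF.neg (fun q hq => (dF q hq).neg) ?_
    (fun x ξ => (abs_le'.1 (h0 x ξ)).2) hp.1.1 hp.1.2 p.2.1 p.2.2
  intro q hq
  rw [fderiv_fun_neg, neg_apply, he q hq, neg_zero]
end

noncomputable section

def Fo (E B : Fin 3 → Y3 → ℝ) (l : Fin 3) (p : Y3) : ℝ :=
  E l p + (vrel p.2.2 (l+1) * B (l+2) p - vrel p.2.2 (l+2) * B (l+1) p)

structure Sol (τ r D : ℝ) (F0 : Y3 → ℝ) (E B : Fin 3 → Y3 → ℝ) (dE dB : Fin 3 → Fin 3 → Y3 → ℝ) : Prop where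
  hr : 0 ≤ r
  hτ : 0 < τ
  hD : 0 ≤ D
  hf : G1 τ r F0
  cF : ContinuousOn F0 (Omc τ)
  hE : ∀ i, ContDiffOn ℝ 1 (E i) (Om τ)
  hB : ∀ i, ContDiffOn ℝ 1 (B i) (Om τ)
  cE : ∀ i, ContinuousOn (E i) (Omc τ)
  cB : ∀ i, ContinuousOn (B i) (Omc τ)
  oE : ∀ i p, E i p = E i (p.1, p.2.1, 0)
  oB : ∀ i p, B i p = B i (p.1, p.2.1, 0)
  vl : ∀ p ∈ Om τ, TT F0 p = - ∑ l, fderiv ℝ (fun q => Fo E B l q * F0 q) p (0, 0, e3 l)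
  ME : Mx τ r F0 E B (fun i ξ => vrel ξ i) (fun _ _ => 0) (fun _ => 1)
  MB : Mx τ r F0 B (fun i p => - E i p) (fun _ _ => 0) (fun i ξ => - vrel ξ i) (fun _ => 0)
  cdE : ∀ k i, ContinuousOn (dE k i) (Omc τ)
  cdB : ∀ k i, ContinuousOn (dB k i) (Omc τ)
  odE : ∀ k i p, dE k i p = dE k i (p.1, p.2.1, 0)
  odB : ∀ k i p, dB k i p = dB k i (p.1, p.2.1, 0)
  edE : ∀ k i, ∀ p ∈ Om τ, dE k i p = fderiv ℝ (E i) p (0, e3 k, 0)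
  edB : ∀ k i, ∀ p ∈ Om τ, dB k i p = fderiv ℝ (B i) p (0, e3 k, 0)
  iF : ∀ x ξ, |F0 (0, x, ξ)| ≤ D
  iE : ∀ i x, |E i (0, x, 0)| ≤ D
  iB : ∀ i x, |B i (0, x, 0)| ≤ D
  idE : ∀ k i x, |dE k i (0, x, 0)| ≤ D
  idB : ∀ k i x, |dB k i (0, x, 0)| ≤ D
  mF : ∀ ε k, Mol ε k → DB k F0 D
  mF1 : ∀ ε k j, Mol ε k → DB (dk (e3 j) k) F0 D
  mE : ∀ ε k i, Mol ε k → DB k (E i) D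
  mB : ∀ ε k i, Mol ε k → DB k (B i) D
  mE1 : ∀ ε k j i, Mol ε k → DB (dk (e3 j) k) (E i) D
  mB1 : ∀ ε k j i, Mol ε k → DB (dk (e3 j) k) (B i) D
  mE2 : ∀ ε k l j i, Mol ε k → DB (dk (e3 l) (dk (e3 j) k)) (E i) D
  mB2 : ∀ ε k l j i, Mol ε k → DB (dk (e3 l) (dk (e3 j) k)) (B i) D

lemma contDiff_vc {n : WithTop ℕ∞} (i : Fin 3) : ContDiff ℝ n (fun ξ => vrel ξ i) := (contDiff_coord i).comp contDiff_vrel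

lemma abs_vc (ξ : E3) (i : Fin 3) : |vrel ξ i| ≤ 1 := by
  rw [← Real.norm_eq_abs]
  exact (PiLp.norm_apply_le _ _).trans (norm_vrel_lt ξ).le

lemma vsym (ξ : E3) (j k : Fin 3) : fderiv ℝ (fun ξ => vrel ξ j) ξ (e3 k) = fderiv ℝ (fun ξ => vrel ξ k) ξ (e3 j) := by
  set c : E3 → ℝ := fun ξ => (Real.sqrt (1 + ‖ξ‖ ^ 2))⁻¹ with hc
  have hq : ∀ ξ : E3, HasFDerivAt (fun ξ : E3 => 1 + ‖ξ‖ ^ 2) ((2:ℝ) • innerSL ℝ ξ) ξ := fun ξ => by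
    have := (hasStrictFDerivAt_norm_sq ξ).hasFDerivAt.const_add 1
    rwa [← Nat.cast_smul_eq_nsmul ℝ, Nat.cast_ofNat] at this
  have h0 : (1 + ‖ξ‖ ^ 2) ≠ 0 := by positivity
  have h1 : Real.sqrt (1 + ‖ξ‖ ^ 2) ≠ 0 := by positivity
  have h2 := ((hasDerivAt_inv h1).comp _ (Real.hasDerivAt_sqrt h0)).comp_hasFDerivAt ξ (hq ξ)
  obtain ⟨w, hw⟩ : ∃ w : ℝ, HasFDerivAt c (w • ((2:ℝ) • innerSL ℝ ξ)) ξ := ⟨_, h2⟩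
  have h3 : ∀ j, HasFDerivAt (fun ξ => vrel ξ j) (c ξ • (EuclideanSpace.proj (𝕜 := ℝ) j : E3 →L[ℝ] ℝ) + ξ j • (w • ((2:ℝ) • innerSL ℝ ξ))) ξ := by
    intro j
    have := hw.mul (EuclideanSpace.proj (𝕜 := ℝ) j : E3 →L[ℝ] ℝ).hasFDerivAt
    exact this
  have hi : ∀ k, ⟪ξ, e3 k⟫ = ξ k := fun k => by
    rw [inner_sum3]; simp [e3_apply]
  rw [(h3 j).fderiv, (h3 k).fderiv]
  have hp : ∀ i j, (EuclideanSpace.proj (𝕜 := ℝ) i : E3 →L[ℝ] ℝ) (e3 j) = if i = j then 1 else 0 := fun i j => e3_apply j i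
  simp only [add_apply, smul_apply, innerSL_apply_apply, hi, hp, smul_eq_mul, eq_comm (a := j)]
  ring

lemma oder {τ : ℝ} {F : Y3 → ℝ} (hF : ContDiffOn ℝ 1 F (Om τ)) (o : ∀ p, F p = F (p.1, p.2.1, 0)) {p : Y3} (hp : p ∈ Om τ) (e : E3) :
    fderiv ℝ F p (0, 0, e) = 0 := by
  have hd : DifferentiableAt ℝ F p := (hF.contDiffAt ((isOpen_Om τ).mem_nhds hp)).differentiableAt (by simp)
  rw [← hd.lineDeriv_eq_fderiv, lineDeriv]
  have : (fun t : ℝ => F (p + t • (0, 0, e))) = fun _ => F p := by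
    ext t; rw [o, o p]; simp
  rw [this]; simp

lemma Om_sub (τ : ℝ) : Om τ ⊆ Omc τ := fun _ hp => ⟨⟨hp.1.1.le, hp.1.2⟩, mem_univ _⟩

lemma ODiff {τ : ℝ} {F : Y3 → ℝ} (hF : ContDiffOn ℝ 1 F (Om τ)) {p : Y3} (hp : p ∈ Om τ) : DifferentiableAt ℝ F p :=
  (hF.contDiffAt ((isOpen_Om τ).mem_nhds hp)).differentiableAt (by simp)

section
variable {τ r D : ℝ} {F0 : Y3 → ℝ} {E B : Fin 3 → Y3 → ℝ} {dE dB : Fin 3 → Fin 3 → Y3 → ℝ}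

lemma vc3 (i : Fin 3) : ContDiff ℝ 1 (fun p : Y3 => vrel p.2.2 i) := (contDiff_vc i).comp (contDiff_snd.comp contDiff_snd)

lemma fd_vc3 (i : Fin 3) (p d : Y3) : fderiv ℝ (fun p : Y3 => vrel p.2.2 i) p d = fderiv ℝ (fun ξ => vrel ξ i) p.2.2 d.2.2 := by
  have h1 : HasFDerivAt (fun ξ => vrel ξ i) (fderiv ℝ (fun ξ => vrel ξ i) p.2.2) p.2.2 :=
    ((contDiff_vc (n := 1) i).differentiable (by simp) _).hasFDerivAt
  have h2 : HasFDerivAt (fun p : Y3 => p.2.2) ((ContinuousLinearMap.snd ℝ E3 E3).comp (ContinuousLinearMap.snd ℝ ℝ X6)) p :=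
    ((ContinuousLinearMap.snd ℝ E3 E3).comp (ContinuousLinearMap.snd ℝ ℝ X6)).hasFDerivAt
  have := HasFDerivAt.comp (f := fun p : Y3 => p.2.2) (g := fun ξ => vrel ξ i) p h1 h2
  have h3 := this.fderiv
  simp only [Function.comp_def] at h3
  rw [h3]; rfl

lemma Sol.hFo (S : Sol τ r D F0 E B dE dB) (l : Fin 3) : ContDiffOn ℝ 1 (Fo E B l) (Om τ) :=
  (S.hE l).add (((vc3 _).contDiffOn.mul (S.hB _)).sub ((vc3 _).contDiffOn.mul (S.hB _)))

lemma Sol.fdFo (S : Sol τ r D F0 E B dE dB) (l : Fin 3) {p : Y3} (hp : p ∈ Om τ) (d : Y3) :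
    fderiv ℝ (Fo E B l) p d = fderiv ℝ (E l) p d
      + ((fderiv ℝ (fun ξ => vrel ξ (l+1)) p.2.2 d.2.2 * B (l+2) p + vrel p.2.2 (l+1) * fderiv ℝ (B (l+2)) p d)
      - (fderiv ℝ (fun ξ => vrel ξ (l+2)) p.2.2 d.2.2 * B (l+1) p + vrel p.2.2 (l+2) * fderiv ℝ (B (l+1)) p d)) := by
  have hv : ∀ i, HasFDerivAt (fun p : Y3 => vrel p.2.2 i) (fderiv ℝ (fun p : Y3 => vrel p.2.2 i) p) p := fun i =>
    ((vc3 i).differentiable (by simp) _).hasFDerivAt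
  have h := (ODiff (S.hE l) hp).hasFDerivAt.fun_add (((hv (l+1)).fun_mul (ODiff (S.hB (l+2)) hp).hasFDerivAt).fun_sub
    ((hv (l+2)).fun_mul (ODiff (S.hB (l+1)) hp).hasFDerivAt))
  have h' : fderiv ℝ (Fo E B l) p = _ := h.fderiv
  rw [h']
  simp only [add_apply, sub_apply, smul_apply, fd_vc3, smul_eq_mul]
  ring

lemma Sol.fdFoξ (S : Sol τ r D F0 E B dE dB) (l : Fin 3) {p : Y3} (hp : p ∈ Om τ) (e : E3) :
    fderiv ℝ (Fo E B l) p (0, 0, e) = fderiv ℝ (fun ξ => vrel ξ (l+1)) p.2.2 e * B (l+2) p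
      - fderiv ℝ (fun ξ => vrel ξ (l+2)) p.2.2 e * B (l+1) p := by
  rw [S.fdFo l hp, oder (S.hE l) (S.oE l) hp, oder (S.hB _) (S.oB _) hp, oder (S.hB _) (S.oB _) hp]
  ring

lemma Sol.trip (S : Sol τ r D F0 E B dE dB) : Trip τ r F0 (fun _ => 0) (fun l p => Fo E B l p * F0 p) where
  hg := S.hf
  hK := ⟨continuousOn_const, fun _ _ => rfl⟩
  hH := fun l => ⟨(S.hFo l).mul S.hf.c, fun p hp => by simp only [S.hf.z p hp, mul_zero]⟩
  eq := fun p hp => by rw [S.vl p hp, zero_sub]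

lemma Sol.transp (S : Sol τ r D F0 E B dE dB) {p : Y3} (hp : p ∈ Om τ) :
    fderiv ℝ F0 p (1, vrel p.2.2, ∑ l, Fo E B l p • e3 l) = 0 := by
  have e1 : ((1, vrel p.2.2, ∑ l, Fo E B l p • e3 l) : Y3) = (1, vrel p.2.2, 0) + ∑ l, Fo E B l p • ((0, 0, e3 l) : Y3) := by
    simp [Fin.sum_univ_three]
  rw [e1, map_add, map_sum]
  have e2 := S.vl p hp
  rw [TT] at e2
  rw [e2]
  have e3' : ∀ l, fderiv ℝ (fun q => Fo E B l q * F0 q) p (0, 0, e3 l) = Fo E B l p * fderiv ℝ F0 p (0, 0, e3 l) + F0 p * fderiv ℝ (Fo E B l) p (0, 0, e3 l) := fun l => by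
    rw [((ODiff (S.hFo l) hp).hasFDerivAt.fun_mul (ODiff S.hf.c hp).hasFDerivAt).fderiv]
    simp
  simp only [e3', map_smul, smul_eq_mul, Finset.sum_add_distrib, ← Finset.mul_sum]
  have e4 : ∑ l, fderiv ℝ (Fo E B l) p (0, 0, e3 l) = 0 := by
    simp only [S.fdFoξ _ hp, Fin.sum_univ_three]
    simp only [Fin.isValue, zero_add, show (1:Fin 3) + 1 = 2 from rfl, show (1:Fin 3) + 2 = 0 from rfl, show (2:Fin 3) + 1 = 0 from rfl, show (2:Fin 3) + 2 = 1 from rfl]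
    rw [vsym p.2.2 1 0, vsym p.2.2 2 0, vsym p.2.2 2 1]
    ring
  rw [e4]; ring

lemma Sol.fM (S : Sol τ r D F0 E B dE dB) {p : Y3} (hp : p ∈ Omc τ) : |F0 p| ≤ D :=
  fbound (A := fun p => ∑ l, Fo E B l p • e3 l) S.hD S.hf.z S.cF (fun q hq => ODiff S.hf.c hq) (fun q hq => S.transp hq) S.iF hp

end
end

noncomputable section

section
variable {τ r D : ℝ} {F0 : Y3 → ℝ} {E B : Fin 3 → Y3 → ℝ} {dE dB : Fin 3 → Fin 3 → Y3 → ℝ}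

def ee (E B : Fin 3 → Y3 → ℝ) (s : ℝ) (y : E3) : ℝ := ∑ i, (|E i (s, y, 0)| + |B i (s, y, 0)|)

lemma ee_nn (E B : Fin 3 → Y3 → ℝ) (s : ℝ) (y : E3) : 0 ≤ ee E B s y := Finset.sum_nonneg fun _ _ => by positivity

lemma ee_cont (cE : ∀ i, ContinuousOn (E i) (Omc τ)) (cB : ∀ i, ContinuousOn (B i) (Omc τ)) {T : ℝ} (hT : T < τ) :
    ContinuousOn (fun p : ℝ × E3 => ee E B p.1 p.2) (Icc 0 T ×ˢ univ) := by
  unfold ee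
  have hm : MapsTo (fun p : ℝ × E3 => ((p.1, p.2, 0) : Y3)) (Icc 0 T ×ˢ univ) (Omc τ) := fun p hp =>
    ⟨⟨hp.1.1, hp.1.2.trans_lt hT⟩, mem_univ _⟩
  have hc : ContinuousOn (fun p : ℝ × E3 => ((p.1, p.2, 0) : Y3)) (Icc 0 T ×ˢ univ) := by fun_prop
  exact continuousOn_finsetSum _ fun i _ => ((cE i).comp hc hm).abs.add ((cB i).comp hc hm).abs

lemma le_ee (E B : Fin 3 → Y3 → ℝ) (i : Fin 3) (s : ℝ) (y : E3) : |E i (s, y, 0)| + |B i (s, y, 0)| ≤ ee E B s y :=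
  Finset.single_le_sum (f := fun i => |E i (s, y, 0)| + |B i (s, y, 0)|) (fun _ _ => by positivity) (Finset.mem_univ i)

lemma Sol.Fo_le (S : Sol τ r D F0 E B dE dB) (l : Fin 3) (p : Y3) : |Fo E B l p| ≤ ee E B p.1 p.2.1 := by
  have h1 : |Fo E B l p| ≤ |E l p| + (|B (l+2) p| + |B (l+1) p|) := by
    unfold Fo
    refine (abs_add_le _ _).trans (add_le_add_right ((abs_sub _ _).trans ?_) _)
    rw [abs_mul, abs_mul]
    exact add_le_add (mul_le_of_le_one_left (abs_nonneg _) (abs_vc _ _)) (mul_le_of_le_one_left (abs_nonneg _) (abs_vc _ _))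
  refine h1.trans ?_
  rw [S.oE, S.oB, S.oB (l+1), ee, sum3 l]
  linarith [abs_nonneg (B l (p.1, p.2.1, 0)), abs_nonneg (E (l+1) (p.1, p.2.1, 0)), abs_nonneg (E (l+2) (p.1, p.2.1, 0))]

lemma DB_neg {k : E3 → ℝ} {F : Y3 → ℝ} {D : ℝ} (h : DB k F D) : DB k (fun p => - F p) D := fun y ξ => by
  rw [cv_neg, abs_neg]; exact h y ξ

lemma Sol.lev0 (S : Sol τ r D F0 E B dE dB) : ∃ M : ℝ, 0 ≤ M ∧ ∀ p ∈ Omc τ, ee E B p.1 p.2.1 ≤ M := by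
  obtain ⟨C1, hC1, h1⟩ := S.ME.lev0 S.hr S.hτ S.cF S.cE S.cB S.hD S.hD (fun ε k hk =>
    ⟨fun i => S.mE ε k i hk, fun l i => S.mE1 ε k l i hk, fun l i => S.mB1 ε k l i hk, S.mF ε k hk⟩) S.trip
    (fun p hp => S.fM (Om_sub τ hp))
  obtain ⟨C2, hC2, h2⟩ := S.MB.lev0 S.hr S.hτ S.cF S.cB (fun i => (S.cE i).neg) S.hD S.hD (fun ε k hk =>
    ⟨fun i => S.mB ε k i hk, fun l i => S.mB1 ε k l i hk, fun l i => DB_neg (S.mE1 ε k l i hk), S.mF ε k hk⟩) S.trip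
    (fun p hp => S.fM (Om_sub τ hp))
  have hD := S.hD
  set C := 3 * (C1 + C2) * (1 + D) + 6 * D with hC
  have hC0 : 0 < C := by positivity
  refine ⟨(2 * C * 1 + 1) * exp (2 * C * τ), by positivity, fun p hp => ?_⟩
  refine (closing (e := ee E B) hp.1.1 (ee_cont S.cE S.cB hp.1.2) hC0 zero_le_one ?_ (ee_nn E B) ?_ p.2.1).trans ?_
  · intro x
    rw [ee, Fin.sum_univ_three]
    have := S.iE; have := S.iB
    have : 0 ≤ 3 * (C1 + C2) * (1 + D) := by positivity
    linarith [S.iE 0 x, S.iE 1 x, S.iE 2 x, S.iB 0 x, S.iB 1 x, S.iB 2 x]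
  · intro t x ε N lam ht htT hε hN hl H
    have htτ : t < τ := htT.trans_lt hp.1.2
    have hH : ∀ l, CBe t ε x r (fun p => Fo E B l p * F0 p) (fun s => N * D * exp (lam * s)) := fun l s y ξ u1 u2 u3 _ => by
      simp only []
      rw [abs_mul]
      have a1 := (S.Fo_le l (s, y, ξ)).trans (H s y u1 u2 u3)
      have a2 := S.fM (p := (s, y, ξ)) ⟨⟨u1.le, by simp only []; linarith⟩, mem_univ _⟩
      calc _ ≤ N * exp (lam * s) * D := mul_le_mul a1 a2 (abs_nonneg _) (by positivity)
        _ = _ := by ring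
    have g1 := fun i => h1 (i := i) ht htτ hε (mul_nonneg hN hD) hl hH
    have g2 := fun i => h2 (i := i) ht htτ hε (mul_nonneg hN hD) hl hH
    rw [ee, Fin.sum_univ_three]
    have hX : 0 ≤ N * exp (lam * t) / lam := by positivity
    have e1 : N * D * exp (lam * t) / lam = D * (N * exp (lam * t) / lam) := by ring
    simp only [e1] at g1 g2
    set X := N * exp (lam * t) / lam
    have : C * (1 + X) = 3 * (C1 * (1 + D * X)) + 3 * (C2 * (1 + D * X)) + 3 * (C1 + C2) * (D + X) + 6 * D * (1 + X) := by rw [hC]; ring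
    have h0 : 0 ≤ 3 * (C1 + C2) * (D + X) + 6 * D * (1 + X) := by positivity
    linarith [g1 0, g1 1, g1 2, g2 0, g2 1, g2 2]
  · refine mul_le_mul_of_nonneg_left (exp_le_exp.2 ?_) (by positivity)
    exact mul_le_mul_of_nonneg_left hp.1.2.le (by positivity)

def KK (F0 : Y3 → ℝ) (E B : Fin 3 → Y3 → ℝ) (l : Fin 3) (p : Y3) : ℝ :=
  Fo E B l p * 0 + TT (Fo E B l) p * F0 p + ∑ m, fderiv ℝ (Fo E B l) p (0, 0, e3 m) * (Fo E B m p * F0 p)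

lemma Sol.trip1 (S : Sol τ r D F0 E B dE dB) (l : Fin 3) :
    Trip τ r (fun p => Fo E B l p * F0 p) (KK F0 E B l) (fun m p => Fo E B l p * (Fo E B m p * F0 p)) :=
  S.trip.mul (S.hFo l)

def e1 (dE dB : Fin 3 → Fin 3 → Y3 → ℝ) (s : ℝ) (y : E3) : ℝ := ∑ k, ee (dE k) (dB k) s y

lemma ee_le_e1 (dE dB : Fin 3 → Fin 3 → Y3 → ℝ) (k : Fin 3) (s : ℝ) (y : E3) : ee (dE k) (dB k) s y ≤ e1 dE dB s y :=
  Finset.single_le_sum (f := fun k => ee (dE k) (dB k) s y) (fun _ _ => ee_nn _ _ _ _) (Finset.mem_univ k)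

lemma dir3 (F : Y3 → ℝ) (p : Y3) (v : E3) : fderiv ℝ F p (1, v, 0) = fderiv ℝ F p (1, 0, 0) + ∑ k, v k * fderiv ℝ F p (0, e3 k, 0) := by
  have : ((1, v, 0) : Y3) = (1, 0, 0) + ∑ k, v k • ((0, e3 k, 0) : Y3) := by
    have := sum_e3 v
    rw [Fin.sum_univ_three] at this
    simp [Fin.sum_univ_three, this]
  rw [this, map_add, map_sum]
  simp only [map_smul, smul_eq_mul]

lemma Sol.Kb (S : Sol τ r D F0 E B dE dB) {M : ℝ} (hM : 0 ≤ M) (hb : ∀ p ∈ Omc τ, ee E B p.1 p.2.1 ≤ M) :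
    ∃ m : ℝ, 0 ≤ m ∧ ∀ l, ∀ p ∈ Om τ, ‖p.2.2‖ ≤ r → |KK F0 E B l p| ≤ m + 9 * D * e1 dE dB p.1 p.2.1 := by
  choose Cv hCv hv using fun i : Fin 3 => mom_le (contDiff_vc (n := 0) i).continuous r
  obtain ⟨V, hV⟩ : ∃ V : ℝ, ∀ i m : Fin 3, ∀ ξ : E3, ‖ξ‖ ≤ r → |fderiv ℝ (fun ξ => vrel ξ i) ξ (e3 m)| ≤ V := by
    have : ∀ i m : Fin 3, ∃ V : ℝ, ∀ ξ : E3, ‖ξ‖ ≤ r → |fderiv ℝ (fun ξ => vrel ξ i) ξ (e3 m)| ≤ V := fun i m => by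
      have hc : Continuous fun ξ => fderiv ℝ (fun ξ => vrel ξ i) ξ (e3 m) :=
        ((contDiff_vc (n := 1) i).continuous_fderiv (by simp)).clm_apply continuous_const
      obtain ⟨V, hV⟩ := (isCompact_closedBall (0 : E3) r).exists_bound_of_continuousOn hc.continuousOn
      exact ⟨V, fun ξ hξ => hV ξ (by simpa using hξ)⟩
    choose V hV using this
    refine ⟨∑ i, ∑ m, |V i m|, fun i m ξ hξ => (hV i m ξ hξ).trans ((le_abs_self _).trans ?_)⟩
    exact (Finset.single_le_sum (f := fun m => |V i m|) (fun _ _ => abs_nonneg _) (Finset.mem_univ m)).trans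
      (Finset.single_le_sum (f := fun i => ∑ m, |V i m|) (fun _ _ => Finset.sum_nonneg fun _ _ => abs_nonneg _) (Finset.mem_univ i))
  have hV0 : 0 ≤ V := (abs_nonneg _).trans (hV 0 0 0 (by simpa using S.hr))
  have hD := S.hD
  set c := (Cv 0 + Cv 1 + Cv 2) * D with hc
  have hc0 : 0 ≤ c := mul_nonneg (by linarith [hCv 0, hCv 1, hCv 2]) hD
  have hcv : ∀ i, Cv i * D ≤ c := fun i => by
    refine mul_le_mul_of_nonneg_right ?_ hD
    fin_cases i <;> simp <;> linarith [hCv 0, hCv 1, hCv 2]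
  refine ⟨3 * c * D + 3 * (2 * V * M * (M * D)), by positivity, fun l p hp hξ => ?_⟩
  have hpc := Om_sub τ hp
  have hbE : ∀ i, |E i p| ≤ M := fun i => by
    have h1 := hb p hpc
    have := le_ee E B i p.1 p.2.1
    rw [S.oE]; linarith [abs_nonneg (B i (p.1, p.2.1, 0))]
  have hbB : ∀ i, |B i p| ≤ M := fun i => by
    have h1 := hb p hpc
    have := le_ee E B i p.1 p.2.1
    rw [S.oB]; linarith [abs_nonneg (E i (p.1, p.2.1, 0))]
  set ε := e1 dE dB p.1 p.2.1 with hε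
  have hsE : ∀ k i, |fderiv ℝ (E i) p (0, e3 k, 0)| + |fderiv ℝ (B i) p (0, e3 k, 0)| ≤ ee (dE k) (dB k) p.1 p.2.1 := fun k i => by
    rw [← S.edE k i p hp, ← S.edB k i p hp, S.odE, S.odB]
    exact le_ee (dE k) (dB k) i p.1 p.2.1
  have htE : ∀ i, |TT (E i) p| ≤ 3 * ε + c := fun i => by
    rw [TT, dir3, S.ME.e1 i p hp]
    have m1 := (hv i F0 p D S.hf.z (fun ξ _ => S.fM (p := (p.1, p.2.1, ξ)) ⟨hpc.1, mem_univ _⟩) hD).trans (hcv i)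
    have m2 := (hsE (i+1) (i+2)).trans (ee_le_e1 dE dB (i+1) p.1 p.2.1)
    have m3 := (hsE (i+2) (i+1)).trans (ee_le_e1 dE dB (i+2) p.1 p.2.1)
    have m4 : |∑ k, vrel p.2.2 k * fderiv ℝ (E i) p (0, e3 k, 0)| ≤ ε := by
      refine (Finset.abs_sum_le_sum_abs _ _).trans (Finset.sum_le_sum fun k _ => ?_)
      rw [abs_mul]
      refine (mul_le_of_le_one_left (abs_nonneg _) (abs_vc _ _)).trans ?_
      linarith [hsE k i, abs_nonneg (fderiv ℝ (B i) p (0, e3 k, 0))]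
    refine (abs_add_le _ _).trans ?_
    have m5 := abs_sub (fderiv ℝ (B (i+2)) p (0, e3 (i+1), 0) - fderiv ℝ (B (i+1)) p (0, e3 (i+2), 0)) (mom (fun ξ => vrel ξ i) F0 p)
    have m6 := abs_sub (fderiv ℝ (B (i+2)) p (0, e3 (i+1), 0)) (fderiv ℝ (B (i+1)) p (0, e3 (i+2), 0))
    linarith [abs_nonneg (fderiv ℝ (E (i+2)) p (0, e3 (i+1), 0)), abs_nonneg (fderiv ℝ (E (i+1)) p (0, e3 (i+2), 0))]
  have htB : ∀ i, |TT (B i) p| ≤ 3 * ε + c := fun i => by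
    rw [TT, dir3, S.ME.e2 i p hp]
    have m1 : mom (fun _ => 0) F0 p = 0 := by simp [mom]
    have m2 := (hsE (i+1) (i+2)).trans (ee_le_e1 dE dB (i+1) p.1 p.2.1)
    have m3 := (hsE (i+2) (i+1)).trans (ee_le_e1 dE dB (i+2) p.1 p.2.1)
    have m4 : |∑ k, vrel p.2.2 k * fderiv ℝ (B i) p (0, e3 k, 0)| ≤ ε := by
      refine (Finset.abs_sum_le_sum_abs _ _).trans (Finset.sum_le_sum fun k _ => ?_)
      rw [abs_mul]
      refine (mul_le_of_le_one_left (abs_nonneg _) (abs_vc _ _)).trans ?_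
      linarith [hsE k i, abs_nonneg (fderiv ℝ (E i) p (0, e3 k, 0))]
    rw [m1, sub_zero]
    refine (abs_add_le _ _).trans ?_
    rw [abs_neg]
    have m6 := abs_sub (fderiv ℝ (E (i+2)) p (0, e3 (i+1), 0)) (fderiv ℝ (E (i+1)) p (0, e3 (i+2), 0))
    linarith [abs_nonneg (fderiv ℝ (B (i+2)) p (0, e3 (i+1), 0)), abs_nonneg (fderiv ℝ (B (i+1)) p (0, e3 (i+2), 0))]
  have hTF : |TT (Fo E B l) p| ≤ 3 * (3 * ε + c) := by
    have e : TT (Fo E B l) p = TT (E l) p + (vrel p.2.2 (l+1) * TT (B (l+2)) p - vrel p.2.2 (l+2) * TT (B (l+1)) p) := by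
      simp only [TT]
      rw [S.fdFo l hp]; simp
    rw [e]
    have n1 : ∀ i j, |vrel p.2.2 i * TT (B j) p| ≤ 3 * ε + c := fun i j => by
      rw [abs_mul]; exact (mul_le_of_le_one_left (abs_nonneg _) (abs_vc _ _)).trans (htB j)
    have n2 := abs_add_le (TT (E l) p) (vrel p.2.2 (l+1) * TT (B (l+2)) p - vrel p.2.2 (l+2) * TT (B (l+1)) p)
    have n3 := abs_sub (vrel p.2.2 (l+1) * TT (B (l+2)) p) (vrel p.2.2 (l+2) * TT (B (l+1)) p)
    linarith [htE l, n1 (l+1) (l+2), n1 (l+2) (l+1)]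
  have hs : ∀ m, |fderiv ℝ (Fo E B l) p (0, 0, e3 m) * (Fo E B m p * F0 p)| ≤ 2 * V * M * (M * D) := fun m => by
    rw [abs_mul, abs_mul]
    refine mul_le_mul ?_ (mul_le_mul ((S.Fo_le m p).trans (hb p hpc)) (S.fM hpc) (abs_nonneg _) hM) (by positivity) (by positivity)
    rw [S.fdFoξ l hp]
    refine (abs_sub _ _).trans ?_
    rw [abs_mul, abs_mul]
    have n1 := mul_le_mul (hV (l+1) m p.2.2 hξ) (hbB (l+2)) (abs_nonneg _) hV0
    have n2 := mul_le_mul (hV (l+2) m p.2.2 hξ) (hbB (l+1)) (abs_nonneg _) hV0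
    linarith
  have hε0 : 0 ≤ ε := Finset.sum_nonneg fun _ _ => ee_nn _ _ _ _
  have hA : |TT (Fo E B l) p * F0 p| ≤ 3 * (3 * ε + c) * D := by
    rw [abs_mul]
    exact mul_le_mul hTF (S.fM hpc) (abs_nonneg _) (by positivity)
  have hB' : |∑ m, fderiv ℝ (Fo E B l) p (0, 0, e3 m) * (Fo E B m p * F0 p)| ≤ 3 * (2 * V * M * (M * D)) := by
    refine (Finset.abs_sum_le_sum_abs _ _).trans ?_
    rw [Fin.sum_univ_three]
    linarith [hs 0, hs 1, hs 2]
  rw [KK, mul_zero, zero_add]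
  refine (abs_add_le _ _).trans ?_
  linarith

end
end

noncomputable section

section
variable {τ r D : ℝ} {F0 : Y3 → ℝ} {E B : Fin 3 → Y3 → ℝ} {dE dB : Fin 3 → Fin 3 → Y3 → ℝ}

lemma Sol.lev1 (S : Sol τ r D F0 E B dE dB) : ∃ C : ℝ, 0 < C ∧ ∀ T L, 0 ≤ T → T < τ → 0 ≤ L →
    (∀ s y ξ j, 0 < s → s ≤ T → |fderiv ℝ F0 (s, y, ξ) (0, e3 j, 0)| ≤ L) → ∀ x,
    ee E B T x + e1 dE dB T x ≤ C * (1 + Real.log (1 + L)) := by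
  obtain ⟨M, hM, hb⟩ := S.lev0
  obtain ⟨m0, hm0, hK⟩ := S.Kb hM hb
  have hD := S.hD
  set m := D + M * D + M * (M * D) + m0 with hm
  have q1 : 0 ≤ M * D := by positivity
  have q2 : 0 ≤ M * (M * D) := by positivity
  have hm' : 0 ≤ m := by positivity
  have bF : ∀ p ∈ Om τ, |F0 p| ≤ m := fun p hp => (S.fM (Om_sub τ hp)).trans (by linarith)
  have bH0 : ∀ l, ∀ p ∈ Om τ, |Fo E B l p * F0 p| ≤ M * D := fun l p hp => by
    rw [abs_mul]
    exact mul_le_mul ((S.Fo_le l p).trans (hb p (Om_sub τ hp))) (S.fM (Om_sub τ hp)) (abs_nonneg _) hM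
  have bH : ∀ l, ∀ p ∈ Om τ, |Fo E B l p * F0 p| ≤ m := fun l p hp => (bH0 l p hp).trans (by linarith)
  have bH' : ∀ l n, ∀ p ∈ Om τ, |Fo E B l p * (Fo E B n p * F0 p)| ≤ m := fun l n p hp => by
    rw [abs_mul]
    refine (mul_le_mul ((S.Fo_le l p).trans (hb p (Om_sub τ hp))) (bH0 n p hp) (abs_nonneg _) hM).trans (by linarith)
  choose C1 hC1 h1 using fun j => S.ME.lev1 S.hr S.hτ S.cF S.cE S.cB S.hD hm' j (fun ε k hk =>
    ⟨fun i => S.mE1 ε k j i hk, fun l i => S.mE2 ε k l j i hk, fun l i => S.mB2 ε k l j i hk, S.mF1 ε k j hk⟩) S.trip S.trip1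
    bF bH bH'
  choose C2 hC2 h2 using fun j => S.MB.lev1 S.hr S.hτ S.cF S.cB (fun i => (S.cE i).neg) S.hD hm' j (fun ε k hk =>
    ⟨fun i => S.mB1 ε k j i hk, fun l i => S.mB2 ε k l j i hk, fun l i => DB_neg (S.mE2 ε k l j i hk), S.mF1 ε k j hk⟩) S.trip S.trip1
    bF bH bH'
  set A := ∑ j, (3 * C1 j + 3 * C2 j) with hA
  have hA0 : 0 ≤ A := Finset.sum_nonneg fun j _ => by linarith [hC1 j, hC2 j]
  set C := A * (1 + 9 * D) + 18 * D + 1 with hC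
  have hC0 : 0 < C := by positivity
  refine ⟨M + (2 * C + 1) * exp (2 * C * τ), by positivity, fun T L hT hTτ hL hgr x => ?_⟩
  have hlog : 0 ≤ Real.log (1 + L) := Real.log_nonneg (by linarith)
  set Λ := 1 + Real.log (1 + L) with hΛ
  have hΛ1 : 1 ≤ Λ := by linarith
  have hmain : e1 dE dB T x ≤ (2 * C * Λ + 1) * exp (2 * C * T) := by
    refine closing (e := e1 dE dB) hT ?_ hC0 (by linarith) ?_ (fun s y => Finset.sum_nonneg fun k _ => ee_nn _ _ _ _) ?_ x
    · exact continuousOn_finsetSum _ fun k _ => ee_cont (S.cdE k) (S.cdB k) hTτ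
    · intro x
      have h : e1 dE dB 0 x ≤ 18 * D := by
        have : ∀ k, ee (dE k) (dB k) 0 x ≤ 6 * D := fun k => by
          rw [ee, Fin.sum_univ_three]
          linarith [S.idE k 0 x, S.idE k 1 x, S.idE k 2 x, S.idB k 0 x, S.idB k 1 x, S.idB k 2 x]
        rw [e1, Fin.sum_univ_three]
        linarith [this 0, this 1, this 2]
      have : 18 * D ≤ C := by
        have : 0 ≤ A * (1 + 9 * D) := by positivity
        linarith
      nlinarith
    · intro t x ε N lam ht htT hε hN hl H
      have htτ : t < τ := htT.trans_lt hTτ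
      have hpt : ((t, x, 0) : Y3) ∈ Om τ := ⟨⟨ht, htτ⟩, mem_univ _⟩
      have bK : ∀ l, CBe t ε x r (KK F0 E B l) (fun s => m + 9 * D * N * exp (lam * s)) := fun l s y ξ u1 u2 u3 u4 => by
        refine (hK l (s, y, ξ) ⟨⟨u1, by simp only []; linarith⟩, mem_univ _⟩ u4).trans ?_
        have a1 := mul_le_mul_of_nonneg_left (H s y u1 u2 u3) (by positivity : 0 ≤ 9 * D)
        simp only []
        linarith
      have bg : ∀ j, CBe t ε x r (fun p => fderiv ℝ F0 p (0, e3 j, 0)) (fun _ => L) := fun j s y ξ u1 u2 _ _ =>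
        hgr s y ξ j u1 (u2.trans htT)
      have hN9 : 0 ≤ 9 * D * N := by positivity
      have g1 := fun j i => h1 j (i := i) ht htτ hε hN9 hl hL bK (bg j)
      have g2 := fun j i => h2 j (i := i) ht htτ hε hN9 hl hL bK (bg j)
      have hX : 0 ≤ N * exp (lam * t) / lam := by positivity
      have e1' : 9 * D * N * exp (lam * t) / lam = 9 * D * (N * exp (lam * t) / lam) := by ring
      simp only [e1', ← hΛ] at g1 g2
      set X := N * exp (lam * t) / lam
      have hsum : e1 dE dB t x ≤ A * (Λ + 9 * D * X) := by
        rw [hA, Finset.sum_mul, e1]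
        refine Finset.sum_le_sum fun j _ => ?_
        rw [ee, Fin.sum_univ_three]
        simp only [S.edE _ _ _ hpt, S.edB _ _ _ hpt]
        linarith [g1 j 0, g1 j 1, g1 j 2, g2 j 0, g2 j 1, g2 j 2]
      refine hsum.trans ?_
      have : C * (Λ + X) = A * (Λ + 9 * D * X) + A * (9 * D * Λ + X) + (18 * D + 1) * (Λ + X) := by rw [hC]; ring
      have h0 : 0 ≤ A * (9 * D * Λ + X) + (18 * D + 1) * (Λ + X) := by positivity
      linarith
  have h3 : (2 * C * Λ + 1) * exp (2 * C * T) ≤ (2 * C + 1) * Λ * exp (2 * C * τ) := by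
    refine mul_le_mul (by nlinarith) (exp_le_exp.2 (mul_le_mul_of_nonneg_left hTτ.le (by positivity))) (exp_pos _).le (by positivity)
  have h4 : ee E B T x ≤ M := hb (T, x, 0) ⟨⟨hT, hTτ⟩, mem_univ _⟩
  nlinarith
end
end

noncomputable section

def EE (F : ℝ → E3 → E3) (i : Fin 3) (p : Y3) : ℝ := F p.1 p.2.1 i
def dd (F : ℝ → E3 → E3) (k i : Fin 3) (p : Y3) : ℝ := fderiv ℝ (fun y => F p.1 y i) p.2.1 (e3 k)
def Sl (τ : ℝ) : Set (ℝ × E3) := Set.Ico 0 τ ×ˢ (Set.univ : Set E3)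

lemma sl_x {G : Y3 → ℝ} {p : Y3} (hG : DifferentiableAt ℝ G p) (e : E3) :
    fderiv ℝ (fun y => G (p.1, y, p.2.2)) p.2.1 e = fderiv ℝ G p (0, e, 0) := by
  have h2 : HasFDerivAt (fun y : E3 => ((p.1, y, p.2.2) : Y3)) ((0 : E3 →L[ℝ] ℝ).prod ((ContinuousLinearMap.id ℝ E3).prod 0)) p.2.1 :=
    (hasFDerivAt_const _ _).prodMk ((hasFDerivAt_id _).prodMk (hasFDerivAt_const _ _))
  have := HasFDerivAt.comp (f := fun y : E3 => ((p.1, y, p.2.2) : Y3)) (g := G) p.2.1 hG.hasFDerivAt h2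
  have h3 := this.fderiv
  simp only [Function.comp_def] at h3
  rw [h3]; rfl

lemma sl_ξ {G : Y3 → ℝ} {p : Y3} (hG : DifferentiableAt ℝ G p) (e : E3) :
    fderiv ℝ (fun y => G (p.1, p.2.1, y)) p.2.2 e = fderiv ℝ G p (0, 0, e) := by
  have h2 : HasFDerivAt (fun y : E3 => ((p.1, p.2.1, y) : Y3)) ((0 : E3 →L[ℝ] ℝ).prod ((0 : E3 →L[ℝ] E3).prod (ContinuousLinearMap.id ℝ E3))) p.2.2 :=
    (hasFDerivAt_const _ _).prodMk ((hasFDerivAt_const _ _).prodMk (hasFDerivAt_id _))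
  have := HasFDerivAt.comp (f := fun y : E3 => ((p.1, p.2.1, y) : Y3)) (g := G) p.2.2 hG.hasFDerivAt h2
  have h3 := this.fderiv
  simp only [Function.comp_def] at h3
  rw [h3]; rfl

lemma sl_t {G : Y3 → ℝ} {p : Y3} (hG : DifferentiableAt ℝ G p) :
    HasDerivAt (fun s => G (s, p.2)) (fderiv ℝ G p (1, 0, 0)) p.1 := by
  have h2 : HasDerivAt (fun s : ℝ => ((s, p.2) : Y3)) (1, 0) p.1 := (hasDerivAt_id _).prodMk (hasDerivAt_const _ _)
  exact HasFDerivAt.comp_hasDerivAt (f := fun s : ℝ => ((s, p.2) : Y3)) (l := G) p.1 hG.hasFDerivAt h2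

section
variable {τ : ℝ} {F : ℝ → E3 → E3}

lemma fl_i (h : ContDiffOn ℝ 1 (fun p : ℝ × E3 => F p.1 p.2) (Sl τ)) (i : Fin 3) :
    ContDiffOn ℝ 1 (fun p : ℝ × E3 => F p.1 p.2 i) (Sl τ) := (contDiff_coord i).comp_contDiffOn h

lemma fl_cd (h : ContDiffOn ℝ 1 (fun p : ℝ × E3 => F p.1 p.2) (Sl τ)) (i : Fin 3) : ContDiffOn ℝ 1 (EE F i) (Omc τ) :=
  (fl_i h i).comp (f := fun p : Y3 => (p.1, p.2.1)) (by fun_prop) fun p hp => ⟨hp.1, mem_univ _⟩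

lemma fl_sl (h : ContDiffOn ℝ 1 (fun p : ℝ × E3 => F p.1 p.2) (Sl τ)) (i : Fin 3) {t : ℝ} (ht : t ∈ Ico 0 τ) (x : E3) :
    HasFDerivAt (fun y => F t y i) ((fderivWithin ℝ (fun p : ℝ × E3 => F p.1 p.2 i) (Sl τ) (t, x)).comp
      ((0 : E3 →L[ℝ] ℝ).prod (ContinuousLinearMap.id ℝ E3))) x := by
  have h1 := ((fl_i h i).differentiableOn (by simp) (t, x) ⟨ht, mem_univ _⟩).hasFDerivWithinAt
  have h2 : HasFDerivAt (fun y : E3 => (t, y)) ((0 : E3 →L[ℝ] ℝ).prod (ContinuousLinearMap.id ℝ E3)) x :=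
    (hasFDerivAt_const _ _).prodMk (hasFDerivAt_id _)
  have h3 := HasFDerivWithinAt.comp (f := fun y : E3 => (t, y)) (g := fun p : ℝ × E3 => F p.1 p.2 i) (s := univ) x h1 h2.hasFDerivWithinAt
    (fun y _ => ⟨ht, mem_univ _⟩)
  exact hasFDerivWithinAt_univ.1 h3

lemma fl_cdd (h : ContDiffOn ℝ 1 (fun p : ℝ × E3 => F p.1 p.2) (Sl τ)) (k i : Fin 3) : ContinuousOn (dd F k i) (Omc τ) := by
  have hu : UniqueDiffOn ℝ (Sl τ) := (uniqueDiffOn_Ico 0 τ).prod uniqueDiffOn_univ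
  have hc := ((fl_i h i).continuousOn_fderivWithin hu (by simp)).comp (s := Omc τ) (f := fun p : Y3 => (p.1, p.2.1))
    (by fun_prop) (fun p hp => ⟨hp.1, mem_univ _⟩)
  refine (hc.clm_apply (continuousOn_const (c := ((0, e3 k) : ℝ × E3)))).congr fun p hp => ?_
  rw [dd, (fl_sl h i hp.1 p.2.1).fderiv]; rfl

lemma fl_cdO (h : ContDiffOn ℝ 1 (fun p : ℝ × E3 => F p.1 p.2) (Sl τ)) (i : Fin 3) : ContDiffOn ℝ 1 (EE F i) (Om τ) :=
  (fl_cd h i).mono (Om_sub τ)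

lemma fl_edd (h : ContDiffOn ℝ 1 (fun p : ℝ × E3 => F p.1 p.2) (Sl τ)) (k i : Fin 3) {p : Y3} (hp : p ∈ Om τ) :
    dd F k i p = fderiv ℝ (EE F i) p (0, e3 k, 0) := by
  rw [← sl_x (ODiff (fl_cdO h i) hp)]; rfl

lemma fl_dt (h : ContDiffOn ℝ 1 (fun p : ℝ × E3 => F p.1 p.2) (Sl τ)) (i : Fin 3) {p : Y3} (hp : p ∈ Om τ) :
    fderiv ℝ (EE F i) p (1, 0, 0) = (deriv (fun s => F s p.2.1) p.1) i := by
  have h1 := fun i => sl_t (ODiff (fl_cdO h i) hp)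
  have h2 : DifferentiableAt ℝ (fun s => F s p.2.1) p.1 := by
    rw [differentiableAt_euclidean]
    exact fun i => (h1 i).differentiableAt
  have h3 : HasDerivAt (fun s => F s p.2.1 i) ((deriv (fun s => F s p.2.1) p.1) i) p.1 :=
    (EuclideanSpace.proj (𝕜 := ℝ) i : E3 →L[ℝ] ℝ).hasFDerivAt.comp_hasDerivAt p.1 h2.hasDerivAt
  exact (h1 i).unique h3

lemma curl_i (F : E3 → E3) (x : E3) (i : Fin 3) : curl3 F x i =
    fderiv ℝ (fun y => F y (i+2)) x (e3 (i+1)) - fderiv ℝ (fun y => F y (i+1)) x (e3 (i+2)) := by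
  fin_cases i <;> rfl

lemma cross_i (a b : E3) (i : Fin 3) : cross3 a b i = a (i+1) * b (i+2) - a (i+2) * b (i+1) := by
  fin_cases i <;> rfl
end

lemma bd_cs {X : Type*} [TopologicalSpace X] {g : X → ℝ} (hc : Continuous g) (hs : HasCompactSupport g) : ∃ D : ℝ, 0 ≤ D ∧ ∀ x, |g x| ≤ D := by
  obtain ⟨D, hD⟩ := hs.exists_bound_of_continuous hc
  exact ⟨|D|, abs_nonneg _, fun x => (hD x).trans (le_abs_self _)⟩

lemma bd_max {ι : Type*} [Fintype ι] {X : Type*} {g : ι → X → ℝ} (h : ∀ i, ∃ D : ℝ, 0 ≤ D ∧ ∀ x, |g i x| ≤ D) :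
    ∃ D : ℝ, 0 ≤ D ∧ ∀ i x, |g i x| ≤ D := by
  choose D h0 h1 using h
  exact ⟨∑ i, D i, Finset.sum_nonneg fun i _ => h0 i, fun i x => (h1 i x).trans (Finset.single_le_sum (fun i _ => h0 i) (Finset.mem_univ i))⟩

lemma bd_E {V : E3 → E3} (hV : ContDiff ℝ 2 V) (hs : HasCompactSupport V) :
    ∃ D : ℝ, 0 ≤ D ∧ (∀ i x, |V x i| ≤ D) ∧ (∀ i j x, |fderiv ℝ (fun y => V y i) x (e3 j)| ≤ D) ∧
    (∀ i j l x, |fderiv ℝ (fun z => fderiv ℝ (fun y => V y i) z (e3 j)) x (e3 l)| ≤ D) := by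
  have hc : ∀ i, ContDiff ℝ 2 (fun y => V y i) := fun i => (contDiff_coord i).comp hV
  have hsi : ∀ i, HasCompactSupport (fun y => V y i) := fun i => hs.comp_left (g := fun v : E3 => v i) rfl
  have hc1 : ∀ i j, ContDiff ℝ 1 (fun z => fderiv ℝ (fun y => V y i) z (e3 j)) := fun i j =>
    ((hc i).fderiv_right (m := 1) (by norm_num)).clm_apply contDiff_const
  have hs1 : ∀ i j, HasCompactSupport (fun z => fderiv ℝ (fun y => V y i) z (e3 j)) := fun i j => (hsi i).fderiv_apply (𝕜 := ℝ) (e3 j)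
  obtain ⟨D1, p1, q1⟩ := bd_max (g := fun i x => V x i) fun i => bd_cs (hc i).continuous (hsi i)
  obtain ⟨D2, p2, q2⟩ := bd_max (g := fun (ij : Fin 3 × Fin 3) z => fderiv ℝ (fun y => V y ij.1) z (e3 ij.2)) fun ij =>
    bd_cs (hc1 ij.1 ij.2).continuous (hs1 ij.1 ij.2)
  obtain ⟨D3, p3, q3⟩ := bd_max (g := fun (ij : Fin 3 × Fin 3 × Fin 3) x => fderiv ℝ (fun z => fderiv ℝ (fun y => V y ij.1) z (e3 ij.2.1)) x (e3 ij.2.2)) fun ij =>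
    bd_cs (((hc1 ij.1 ij.2.1).continuous_fderiv (by simp)).clm_apply continuous_const) ((hs1 ij.1 ij.2.1).fderiv_apply (𝕜 := ℝ) (e3 ij.2.2))
  exact ⟨D1 + D2 + D3, by positivity, fun i x => (q1 i x).trans (by linarith), fun i j x => (q2 (i, j) x).trans (by linarith),
    fun i j l x => (q3 (i, j, l) x).trans (by linarith)⟩

lemma bd_f {g : E3 → E3 → ℝ} (hg : ContDiff ℝ 1 (fun p : E3 × E3 => g p.1 p.2)) (hs : HasCompactSupport (fun p : E3 × E3 => g p.1 p.2)) :
    ∃ D : ℝ, 0 ≤ D ∧ (∀ x ξ, |g x ξ| ≤ D) ∧ (∀ j x ξ, |fderiv ℝ (fun y => g y ξ) x (e3 j)| ≤ D) := by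
  obtain ⟨D1, p1, q1⟩ := bd_cs hg.continuous hs
  obtain ⟨D2, p2, q2⟩ := bd_max (g := fun (j : Fin 3) x => fderiv ℝ (fun p : E3 × E3 => g p.1 p.2) x (e3 j, 0)) fun j =>
    bd_cs ((hg.continuous_fderiv (by simp)).clm_apply continuous_const) (hs.fderiv_apply (𝕜 := ℝ) (e3 j, 0))
  refine ⟨D1 + D2, by positivity, fun x ξ => (q1 (x, ξ)).trans (by linarith), fun j x ξ => ?_⟩
  have h2 : HasFDerivAt (fun y : E3 => (y, ξ)) ((ContinuousLinearMap.id ℝ E3).prod (0 : E3 →L[ℝ] E3)) x :=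
    (hasFDerivAt_id _).prodMk (hasFDerivAt_const _ _)
  have := HasFDerivAt.comp (f := fun y : E3 => (y, ξ)) (g := fun p : E3 × E3 => g p.1 p.2) x
    (hg.differentiable (by simp) (x, ξ)).hasFDerivAt h2
  have h3 := this.fderiv
  simp only [Function.comp_def] at h3
  rw [h3]
  exact (q2 j (x, ξ)).trans (by linarith)

lemma cvx (k : E3 → ℝ) (F : Y3 → ℝ) (y ξ : E3) : cv k F (0, y, ξ) = cx k (fun x => F (0, x, ξ)) y := rfl
end

noncomputable section

def FF (τ : ℝ) (f : ℝ → E3 → E3 → ℝ) (p : Y3) : ℝ := by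
  classical exact if p.1 ∈ Ico 0 τ then f p.1 p.2.1 p.2.2 else 0

lemma FF_eq {τ : ℝ} {f : ℝ → E3 → E3 → ℝ} {p : Y3} (hp : p.1 ∈ Ico 0 τ) : FF τ f p = f p.1 p.2.1 p.2.2 := if_pos hp

lemma DB_of {k : E3 → ℝ} {F : Y3 → ℝ} {D : ℝ} (h : ∀ y ξ, |cx k (fun x => F (0, x, ξ)) y| ≤ D) : DB k F D := fun y ξ => h y ξ

lemma DB0 {ε D : ℝ} {k : E3 → ℝ} {V : E3 → ℝ} (hk : Mol ε k) (h : ∀ x, |V x| ≤ D) (y : E3) : |cx k V y| ≤ D :=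
  hk.cx_le fun _ _ => h _

lemma DB1 {ε D : ℝ} {k : E3 → ℝ} {V : E3 → ℝ} (hk : Mol ε k) (hV : ContDiff ℝ 1 V) (e : E3) (h : ∀ x, |fderiv ℝ V x e| ≤ D) (y : E3) :
    |cx (dk e k) V y| ≤ D := by
  rw [cx_dk hk.kc hV]; exact DB0 hk h y

lemma DB2 {ε D : ℝ} {k : E3 → ℝ} {V : E3 → ℝ} (hk : Mol ε k) (hV : ContDiff ℝ 2 V) (e e' : E3)
    (h : ∀ x, |fderiv ℝ (fun z => fderiv ℝ V z e') x e| ≤ D) (y : E3) :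
    |cx (dk e' (dk e k)) V y| ≤ D := by
  rw [cx_dk (hk.kc.dk e) (hV.of_le (by norm_num))]
  exact DB1 hk ((hV.fderiv_right (m := 1) (by norm_num)).clm_apply contDiff_const) e h y

theorem mkSol
    (τ : ℝ) (hτ : 0 < τ)
    (f : ℝ → E3 → E3 → ℝ) (Efld Bfld : ℝ → E3 → E3)
    (fin : E3 → E3 → ℝ) (Ein Bin : E3 → E3)
    (hfreg : ContDiffOn ℝ 1 (fun p : ℝ × E3 × E3 => f p.1 p.2.1 p.2.2)
      (Set.Ico 0 τ ×ˢ (Set.univ : Set (E3 × E3))))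
    (hEreg : ContDiffOn ℝ 1 (fun p : ℝ × E3 => Efld p.1 p.2)
      (Set.Ico 0 τ ×ˢ (Set.univ : Set E3)))
    (hBreg : ContDiffOn ℝ 1 (fun p : ℝ × E3 => Bfld p.1 p.2)
      (Set.Ico 0 τ ×ˢ (Set.univ : Set E3)))
    (hfinreg : ContDiff ℝ 1 (fun p : E3 × E3 => fin p.1 p.2))
    (hfinsupp : HasCompactSupport (fun p : E3 × E3 => fin p.1 p.2))
    (hEinreg : ContDiff ℝ 2 Ein) (hBinreg : ContDiff ℝ 2 Bin)
    (hEinsupp : HasCompactSupport Ein) (hBinsupp : HasCompactSupport Bin)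
    (hf0 : ∀ x ξ : E3, f 0 x ξ = fin x ξ)
    (hE0 : ∀ x : E3, Efld 0 x = Ein x) (hB0 : ∀ x : E3, Bfld 0 x = Bin x)
    (hintf : ∀ t ∈ Set.Ico 0 τ, ∀ x : E3, Integrable fun ξ : E3 => f t x ξ)
    (hVlasov : ∀ t ∈ Set.Ioo 0 τ, ∀ x ξ : E3,
      deriv (fun s => f s x ξ) t + ⟪vrel ξ, gradient (fun y => f t y ξ) x⟫
        = -∑ i : Fin 3,
            fderiv ℝ (fun η => (Efld t x + cross3 (vrel η) (Bfld t x)) i * f t x η) ξ (e3 i))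
    (hAmpere : ∀ t ∈ Set.Ioo 0 τ, ∀ x : E3,
      deriv (fun s => Efld s x) t - curl3 (Bfld t) x = -∫ ξ : E3, f t x ξ • vrel ξ)
    (hGaussE : ∀ t ∈ Set.Ioo 0 τ, ∀ x : E3, divg (Efld t) x = ∫ ξ : E3, f t x ξ)
    (hFaraday : ∀ t ∈ Set.Ioo 0 τ, ∀ x : E3,
      deriv (fun s => Bfld s x) t + curl3 (Efld t) x = 0)
    (hGaussB : ∀ t ∈ Set.Ioo 0 τ, ∀ x : E3, divg (Bfld t) x = 0)
    {r : ℝ} (hr : 0 < r) (hR : ∀ t ∈ Set.Ico 0 τ, ∀ x ξ : E3, r < ‖ξ‖ → f t x ξ = 0) :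
    ∃ D, Sol τ r D (FF τ f) (EE Efld) (EE Bfld) (dd Efld) (dd Bfld) := by
  have h0m : (0:ℝ) ∈ Ico 0 τ := ⟨le_rfl, hτ⟩
  have hz : XS r (FF τ f) := fun p hp => by
    by_cases h : p.1 ∈ Ico 0 τ
    · rw [FF_eq h]; exact hR _ h _ _ hp
    · exact if_neg h
  have hFc : ContDiffOn ℝ 1 (FF τ f) (Omc τ) := hfreg.congr fun p hp => FF_eq hp.1
  have hFO : ContDiffOn ℝ 1 (FF τ f) (Om τ) := hFc.mono (Om_sub τ)
  have hf : G1 τ r (FF τ f) := ⟨hFO, hz⟩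
  have hEO := fl_cdO hEreg
  have hBO := fl_cdO hBreg
  obtain ⟨D1, p1, a1, a2⟩ := bd_f hfinreg hfinsupp
  obtain ⟨D2, p2, b1, b2, b3⟩ := bd_E hEinreg hEinsupp
  obtain ⟨D3, p3, c1, c2, c3⟩ := bd_E hBinreg hBinsupp
  set D := D1 + D2 + D3 with hD
  replace a1 : ∀ x ξ, |fin x ξ| ≤ D := fun x ξ => (a1 x ξ).trans (by linarith)
  replace a2 : ∀ j x ξ, |fderiv ℝ (fun y => fin y ξ) x (e3 j)| ≤ D := fun j x ξ => (a2 j x ξ).trans (by linarith)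
  replace b1 : ∀ i x, |Ein x i| ≤ D := fun i x => (b1 i x).trans (by linarith)
  replace b2 : ∀ i j x, |fderiv ℝ (fun y => Ein y i) x (e3 j)| ≤ D := fun i j x => (b2 i j x).trans (by linarith)
  replace b3 : ∀ i j l x, |fderiv ℝ (fun z => fderiv ℝ (fun y => Ein y i) z (e3 j)) x (e3 l)| ≤ D := fun i j l x => (b3 i j l x).trans (by linarith)
  replace c1 : ∀ i x, |Bin x i| ≤ D := fun i x => (c1 i x).trans (by linarith)
  replace c2 : ∀ i j x, |fderiv ℝ (fun y => Bin y i) x (e3 j)| ≤ D := fun i j x => (c2 i j x).trans (by linarith)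
  replace c3 : ∀ i j l x, |fderiv ℝ (fun z => fderiv ℝ (fun y => Bin y i) z (e3 j)) x (e3 l)| ≤ D := fun i j l x => (c3 i j l x).trans (by linarith)
  have zF : ∀ x ξ, FF τ f (0, x, ξ) = fin x ξ := fun x ξ => by rw [FF_eq h0m, hf0]
  have zE : ∀ i x ξ, EE Efld i (0, x, ξ) = Ein x i := fun i x ξ => by rw [EE, hE0]
  have zB : ∀ i x ξ, EE Bfld i (0, x, ξ) = Bin x i := fun i x ξ => by rw [EE, hB0]
  have fs : ∀ ξ, ContDiff ℝ 1 (fun x => fin x ξ) := fun ξ => hfinreg.comp (f := fun x : E3 => (x, ξ)) (by fun_prop)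
  have Es : ∀ i, ContDiff ℝ 2 (fun x => Ein x i) := fun i => (contDiff_coord i).comp hEinreg
  have Bs : ∀ i, ContDiff ℝ 2 (fun x => Bin x i) := fun i => (contDiff_coord i).comp hBinreg
  have E10 : ∀ i, ∀ p ∈ Om τ, fderiv ℝ (EE Efld i) p (1, 0, 0) = fderiv ℝ (EE Bfld (i+2)) p (0, e3 (i+1), 0)
    - fderiv ℝ (EE Bfld (i+1)) p (0, e3 (i+2), 0) - mom (fun ξ => vrel ξ i) (FF τ f) p := fun i p hp => by
    have ht : p.1 ∈ Ico 0 τ := (Om_sub τ hp).1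
    have h1 := congrArg (fun v : E3 => v i) (hAmpere p.1 hp.1 p.2.1)
    have hint : Integrable (fun ξ : E3 => f p.1 p.2.1 ξ • vrel ξ) := by
      refine (hintf p.1 ht p.2.1).mono ((hintf p.1 ht p.2.1).aestronglyMeasurable.smul continuous_vrel.aestronglyMeasurable)
        (Eventually.of_forall fun ξ => ?_)
      rw [norm_smul]
      exact mul_le_of_le_one_right (norm_nonneg _) (norm_vrel_lt ξ).le
    have h2 : (∫ ξ : E3, f p.1 p.2.1 ξ • vrel ξ) i = mom (fun ξ => vrel ξ i) (FF τ f) p := by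
      have := (EuclideanSpace.proj (𝕜 := ℝ) i : E3 →L[ℝ] ℝ).integral_comp_comm hint
      refine this.symm.trans ?_
      unfold mom
      refine integral_congr_ae (Eventually.of_forall fun ξ => ?_)
      simp only []
      rw [FF_eq (p := (p.1, p.2.1, ξ)) ht]
      exact mul_comm _ _
    simp only [PiLp.sub_apply, PiLp.neg_apply] at h1
    rw [h2, curl_i, ← fl_dt hEreg i hp] at h1
    have h3 := fl_edd hBreg (i+1) (i+2) hp
    have h4 := fl_edd hBreg (i+2) (i+1) hp
    simp only [dd] at h3 h4
    rw [h3, h4] at h1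
    linarith
  have B10 : ∀ i, ∀ p ∈ Om τ, fderiv ℝ (EE Bfld i) p (1, 0, 0) = -(fderiv ℝ (EE Efld (i+2)) p (0, e3 (i+1), 0)
    - fderiv ℝ (EE Efld (i+1)) p (0, e3 (i+2), 0)) := fun i p hp => by
    have h1 := congrArg (fun v : E3 => v i) (hFaraday p.1 hp.1 p.2.1)
    simp only [PiLp.add_apply, PiLp.zero_apply] at h1
    rw [curl_i, ← fl_dt hBreg i hp] at h1
    have h3 := fl_edd hEreg (i+1) (i+2) hp
    have h4 := fl_edd hEreg (i+2) (i+1) hp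
    simp only [dd] at h3 h4
    rw [h3, h4] at h1
    linarith
  have mz : ∀ p, mom (fun _ => 0) (FF τ f) p = 0 := fun p => by simp [mom]
  refine ⟨D, {
    hr := hr.le
    hτ := hτ
    hD := by positivity
    hf := hf
    cF := hFc.continuousOn
    hE := hEO
    hB := hBO
    cE := fun i => (fl_cd hEreg i).continuousOn
    cB := fun i => (fl_cd hBreg i).continuousOn
    oE := fun _ _ => rfl
    oB := fun _ _ => rfl
    vl := ?_
    ME := ?_
    MB := ?_
    cdE := fl_cdd hEreg
    cdB := fl_cdd hBreg
    odE := fun _ _ _ => rfl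
    odB := fun _ _ _ => rfl
    edE := fun k i p hp => fl_edd hEreg k i hp
    edB := fun k i p hp => fl_edd hBreg k i hp
    iF := fun x ξ => by rw [zF]; exact a1 x ξ
    iE := fun i x => by rw [zE]; exact b1 i x
    iB := fun i x => by rw [zB]; exact c1 i x
    idE := fun k i x => by simp only [dd, hE0]; exact b2 i k x
    idB := fun k i x => by simp only [dd, hB0]; exact c2 i k x
    mF := fun ε k hk => DB_of fun y ξ => by simp only [zF]; exact DB0 hk (fun x => a1 x ξ) y
    mF1 := fun ε k j hk => DB_of fun y ξ => by simp only [zF]; exact DB1 hk (fs ξ) _ (fun x => a2 j x ξ) y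
    mE := fun ε k i hk => DB_of fun y ξ => by simp only [zE]; exact DB0 hk (b1 i) y
    mB := fun ε k i hk => DB_of fun y ξ => by simp only [zB]; exact DB0 hk (c1 i) y
    mE1 := fun ε k j i hk => DB_of fun y ξ => by simp only [zE]; exact DB1 hk ((Es i).of_le (by norm_num)) _ (b2 i j) y
    mB1 := fun ε k j i hk => DB_of fun y ξ => by simp only [zB]; exact DB1 hk ((Bs i).of_le (by norm_num)) _ (c2 i j) y
    mE2 := fun ε k l j i hk => DB_of fun y ξ => by simp only [zE]; exact DB2 hk (Es i) _ _ (b3 i l j) y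
    mB2 := fun ε k l j i hk => DB_of fun y ξ => by simp only [zB]; exact DB2 hk (Bs i) _ _ (c3 i l j) y }⟩
  · intro p hp
    have ht : p.1 ∈ Ico 0 τ := (Om_sub τ hp).1
    have hFd := ODiff hFO hp
    have h1 := hVlasov p.1 hp.1 p.2.1 p.2.2
    have e1 : deriv (fun s => f s p.2.1 p.2.2) p.1 = fderiv ℝ (FF τ f) p (1, 0, 0) := by
      refine HasDerivAt.deriv ((sl_t hFd).congr_of_eventuallyEq ?_)
      filter_upwards [isOpen_Ioo.mem_nhds hp.1] with s hs
      rw [FF_eq ⟨hs.1.le, hs.2⟩]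
    have e2 : ⟪vrel p.2.2, gradient (fun y => f p.1 y p.2.2) p.2.1⟫ = fderiv ℝ (FF τ f) p (0, vrel p.2.2, 0) := by
      rw [← sl_x hFd, real_inner_comm, gradient, InnerProductSpace.toDual_symm_apply]
      congr 2
      ext y
      rw [FF_eq (p := (p.1, y, p.2.2)) ht]
    have e3' : ∀ i, fderiv ℝ (fun η => (Efld p.1 p.2.1 + cross3 (vrel η) (Bfld p.1 p.2.1)) i * f p.1 p.2.1 η) p.2.2 (e3 i)
        = fderiv ℝ (fun q => Fo (EE Efld) (EE Bfld) i q * FF τ f q) p (0, 0, e3 i) := fun i => by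
      have hFo : ContDiffOn ℝ 1 (Fo (EE Efld) (EE Bfld) i) (Om τ) :=
        (hEO i).add (((vc3 _).contDiffOn.mul (hBO _)).sub ((vc3 _).contDiffOn.mul (hBO _)))
      rw [← sl_ξ ((ODiff hFo hp).fun_mul hFd)]
      congr 2
      ext η
      rw [FF_eq (p := (p.1, p.2.1, η)) ht, PiLp.add_apply, cross_i]
      rfl
    rw [e1, e2] at h1
    simp only [e3'] at h1
    rw [← h1, TT, ← map_add]
    simp
  · exact {
      hf := hf
      hE := hEO
      hB := hBO
      ha := fun i => contDiff_vc i
      hb := fun i => contDiff_const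
      hc := contDiff_const
      e1 := E10
      e2 := fun i p hp => by rw [mz, sub_zero]; exact B10 i p hp
      e4 := fun p hp => by
        have ht : p.1 ∈ Ico 0 τ := (Om_sub τ hp).1
        have h1 := hGaussE p.1 hp.1 p.2.1
        simp only [divg, pd3] at h1
        have h3 := fun i => fl_edd hEreg i i hp
        simp only [dd] at h3
        simp only [h3] at h1
        rw [h1, mom]
        refine integral_congr_ae (Eventually.of_forall fun ξ => ?_)
        simp only []
        rw [FF_eq (p := (p.1, p.2.1, ξ)) ht, one_mul] }
  · have nfd : ∀ i p d, fderiv ℝ (fun p => - EE Efld i p) p d = - fderiv ℝ (EE Efld i) p d := fun i p d => by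
      rw [fderiv_fun_neg, neg_apply]
    exact {
      hf := hf
      hE := hBO
      hB := fun i => (hEO i).neg
      ha := fun i => contDiff_const
      hb := fun i => (contDiff_vc i).neg
      hc := contDiff_const
      e1 := fun i p hp => by rw [nfd, nfd, mz, B10 i p hp]; ring
      e2 := fun i p hp => by
        have : mom (fun ξ => - vrel ξ i) (FF τ f) p = - mom (fun ξ => vrel ξ i) (FF τ f) p := by
          simp only [mom, neg_mul, integral_neg]
        rw [nfd, this, E10 i p hp]; ring
      e4 := fun p hp => by
        have h1 := hGaussB p.1 hp.1 p.2.1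
        simp only [divg, pd3] at h1
        have h3 := fun i => fl_edd hBreg i i hp
        simp only [dd] at h3
        simp only [h3] at h1
        rw [h1, mz] }

lemma nrm_coord (v : E3) : ‖v‖ ≤ ∑ i, |v i| := by
  conv_lhs => rw [← sum_e3 v]
  refine (norm_sum_le _ _).trans (Finset.sum_le_sum fun i _ => ?_)
  rw [norm_smul, Real.norm_eq_abs]
  simp [e3]

lemma nrm_op {F : ℝ → E3 → E3} {τ : ℝ} (h : ContDiffOn ℝ 1 (fun p : ℝ × E3 => F p.1 p.2) (Sl τ)) {t : ℝ} (ht : t ∈ Ico 0 τ) (x : E3) :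
    ‖fderiv ℝ (F t) x‖ ≤ ∑ k, ∑ i, |dd F k i (t, x, 0)| := by
  have hd : DifferentiableAt ℝ (F t) x := by
    rw [differentiableAt_euclidean]
    exact fun i => (fl_sl h i ht x).differentiableAt
  have hi : ∀ k i, (fderiv ℝ (F t) x (e3 k)) i = dd F k i (t, x, 0) := fun k i => by
    have := ((EuclideanSpace.proj (𝕜 := ℝ) i : E3 →L[ℝ] ℝ).hasFDerivAt (x := F t x)).comp x hd.hasFDerivAt
    have h2 : HasFDerivAt (fun y => F t y i) _ x := this
    simp only [dd]
    rw [h2.fderiv]; rfl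
  refine ContinuousLinearMap.opNorm_le_bound _ (Finset.sum_nonneg fun _ _ => Finset.sum_nonneg fun _ _ => abs_nonneg _) fun v => ?_
  conv_lhs => rw [← sum_e3 v, map_sum]
  refine (norm_sum_le _ _).trans ?_
  rw [Finset.sum_mul]
  refine Finset.sum_le_sum fun k _ => ?_
  rw [map_smul, norm_smul, mul_comm]
  refine mul_le_mul ?_ (PiLp.norm_apply_le v k) (norm_nonneg _) (Finset.sum_nonneg fun _ _ => abs_nonneg _)
  refine (nrm_coord _).trans (le_of_eq ?_)
  simp only [hi]

lemma log_lnpos {L : ℝ} (hL : 0 ≤ L) : Real.log (1 + L) ≤ 1 + lnpos L := by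
  unfold lnpos
  rcases le_total L 1 with h | h
  · have : Real.log (1 + L) ≤ 1 + L - 1 := Real.log_le_sub_one_of_pos (by linarith)
    linarith [le_max_right (Real.log L) 0]
  · have h1 : Real.log (1 + L) ≤ Real.log (2 * L) := Real.log_le_log (by linarith) (by linarith)
    rw [Real.log_mul (by norm_num) (by linarith)] at h1
    have h2 : Real.log 2 ≤ 2 - 1 := Real.log_le_sub_one_of_pos (by norm_num)
    linarith [le_max_left (Real.log L) 0]
end

/-- **Logarithmic bound on the field gradients under a momentum support bound**: if the
momentum support radius of a `C¹` solution of the relativistic Vlasov–Maxwell system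
remains bounded on `[0,τ)`, then there is a constant `C > 0` such that for all
`t ∈ [0,τ)`, `‖E(t)‖_{W^{1,∞}} + ‖B(t)‖_{W^{1,∞}} ≤ C (1 + ln₊ sup_{0≤s≤t} ‖∇ₓf(s)‖)`;
here the supremum bound is expressed through an arbitrary upper bound `L` for
`‖∇ₓ f(s)‖_{L^∞}`, `0 ≤ s ≤ t`. -/
theorem field_gradient_log_bound
    (τ : ℝ) (hτ : 0 < τ)
    (f : ℝ → E3 → E3 → ℝ) (Efld Bfld : ℝ → E3 → E3)
    (fin : E3 → E3 → ℝ) (Ein Bin : E3 → E3)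
    -- regularity of the solution on `[0,τ)`
    (hfreg : ContDiffOn ℝ 1 (fun p : ℝ × E3 × E3 => f p.1 p.2.1 p.2.2)
      (Set.Ico 0 τ ×ˢ (Set.univ : Set (E3 × E3))))
    (hEreg : ContDiffOn ℝ 1 (fun p : ℝ × E3 => Efld p.1 p.2)
      (Set.Ico 0 τ ×ˢ (Set.univ : Set E3)))
    (hBreg : ContDiffOn ℝ 1 (fun p : ℝ × E3 => Bfld p.1 p.2)
      (Set.Ico 0 τ ×ˢ (Set.univ : Set E3)))
    -- regularity, positivity and support of the initial data
    (hfinreg : ContDiff ℝ 1 (fun p : E3 × E3 => fin p.1 p.2))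
    (hfinpos : ∀ x ξ : E3, 0 ≤ fin x ξ)
    (hfinsupp : HasCompactSupport (fun p : E3 × E3 => fin p.1 p.2))
    (hEinreg : ContDiff ℝ 2 Ein) (hBinreg : ContDiff ℝ 2 Bin)
    (hEinsupp : HasCompactSupport Ein) (hBinsupp : HasCompactSupport Bin)
    -- initial conditions
    (hf0 : ∀ x ξ : E3, f 0 x ξ = fin x ξ)
    (hE0 : ∀ x : E3, Efld 0 x = Ein x) (hB0 : ∀ x : E3, Bfld 0 x = Bin x)
    -- integrability in the momentum variable
    (hintf : ∀ t ∈ Set.Ico 0 τ, ∀ x : E3, Integrable fun ξ : E3 => f t x ξ)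
    -- compatibility conditions on the initial data
    (hcompatE : ∀ x : E3, divg Ein x = ∫ ξ : E3, fin x ξ)
    (hcompatB : ∀ x : E3, divg Bin x = 0)
    -- the Vlasov equation
    (hVlasov : ∀ t ∈ Set.Ioo 0 τ, ∀ x ξ : E3,
      deriv (fun s => f s x ξ) t + ⟪vrel ξ, gradient (fun y => f t y ξ) x⟫
        = -∑ i : Fin 3,
            fderiv ℝ (fun η => (Efld t x + cross3 (vrel η) (Bfld t x)) i * f t x η) ξ (e3 i))
    -- the Maxwell equations
    (hAmpere : ∀ t ∈ Set.Ioo 0 τ, ∀ x : E3,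
      deriv (fun s => Efld s x) t - curl3 (Bfld t) x = -∫ ξ : E3, f t x ξ • vrel ξ)
    (hGaussE : ∀ t ∈ Set.Ioo 0 τ, ∀ x : E3, divg (Efld t) x = ∫ ξ : E3, f t x ξ)
    (hFaraday : ∀ t ∈ Set.Ioo 0 τ, ∀ x : E3,
      deriv (fun s => Bfld s x) t + curl3 (Efld t) x = 0)
    (hGaussB : ∀ t ∈ Set.Ioo 0 τ, ∀ x : E3, divg (Bfld t) x = 0)    -- bounded momentum support radius
    (hR : ∃ r : ℝ, 0 < r ∧ ∀ t ∈ Set.Ico 0 τ, ∀ x ξ : E3, r < ‖ξ‖ → f t x ξ = 0) :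
    ∃ C > (0:ℝ), ∀ t ∈ Set.Ico 0 τ, ∀ L : ℝ,
      (∀ s ∈ Set.Icc 0 t, ∀ x ξ : E3, ‖gradient (fun y => f s y ξ) x‖ ≤ L) →
      ∀ x : E3,
        ‖Efld t x‖ + ‖fderiv ℝ (Efld t) x‖ + ‖Bfld t x‖ + ‖fderiv ℝ (Bfld t) x‖
          ≤ C * (1 + lnpos L) := by
  obtain ⟨r, hr, hR⟩ := hR
  obtain ⟨D, S⟩ := mkSol τ hτ f Efld Bfld fin Ein Bin hfreg hEreg hBreg hfinreg hfinsupp hEinreg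
    hBinreg hEinsupp hBinsupp hf0 hE0 hB0 hintf hVlasov hAmpere hGaussE hFaraday hGaussB hr hR
  obtain ⟨C, hC, h⟩ := S.lev1
  refine ⟨2 * C, by positivity, fun t ht L hL x => ?_⟩
  have hL0 : 0 ≤ L := (norm_nonneg _).trans (hL t ⟨ht.1, le_rfl⟩ 0 0)
  have hg := h t L ht.1 ht.2 hL0 (fun s y ξ j hs hst => by
    have hsτ : s < τ := hst.trans_lt ht.2
    have hp : ((s, y, ξ) : Y3) ∈ Om τ := ⟨⟨hs, hsτ⟩, mem_univ _⟩
    have h1 := sl_x (ODiff S.hf.c hp) (e3 j)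
    have h2 : (fun y => FF τ f (s, y, ξ)) = fun y => f s y ξ := by
      funext y; exact FF_eq (p := (s, y, ξ)) ⟨hs.le, hsτ⟩
    rw [← h1]
    simp only
    rw [h2]
    have h3 := hL s ⟨hs.le, hst⟩ y ξ
    rw [gradient, LinearIsometryEquiv.norm_map] at h3
    have h4 := (fderiv ℝ (fun y => f s y ξ) y).le_opNorm (e3 j)
    have h5 : ‖e3 j‖ = 1 := by simp [e3]
    rw [h5, mul_one, Real.norm_eq_abs] at h4
    exact h4.trans h3) x
  have a1 := nrm_coord (Efld t x)
  have a2 := nrm_coord (Bfld t x)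
  have a3 := nrm_op hEreg ht x
  have a4 := nrm_op hBreg ht x
  have a5 := log_lnpos hL0
  have a6 : 0 ≤ lnpos L := le_max_right _ _
  have a7 : ee (EE Efld) (EE Bfld) t x = ∑ i, |Efld t x i| + ∑ i, |Bfld t x i| := by
    simp only [ee, EE, Finset.sum_add_distrib]
  have a8 : e1 (dd Efld) (dd Bfld) t x = ∑ k, ∑ i, |dd Efld k i (t, x, 0)| + ∑ k, ∑ i, |dd Bfld k i (t, x, 0)| := by
    simp only [e1, ee, Finset.sum_add_distrib]
  have a9 : C * (1 + Real.log (1 + L)) ≤ C * (2 * (1 + lnpos L)) :=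
    mul_le_mul_of_nonneg_left (by linarith) hC.le
  linarith
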